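/- Let T be a complete arithmetically definable theory in a countable arithmetically definable language with no finite models. If T is D-categorical for some nonzero arithmetic degree D, then T has no Vaughtian pair. -/

import Mathlib

open FirstOrder FirstOrder.Language

namespace ArMorley

/-! ## Arithmetical sets and arithmetic reducibility -/

/-- Function symbols of the language of arithmetic: `0`, `1`, `+`, `·`. -/
inductive ArFunc : ℕ → Type
  | zero : ArFunc 0
  | one : ArFunc 0
  | add : ArFunc 2
  | mul : ArFunc 2

/-- Relation symbols: `<` and a unary oracle predicate. -/
inductive ArRel : ℕ → Type
  | lt : ArRel 2
  | mem : ArRel 1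

/-- The language `(+, ·, 0, 1, <, Y)` of arithmetic with a unary oracle predicate. -/
def arithLang : FirstOrder.Language := ⟨ArFunc, ArRel⟩

/-- The standard structure on `ℕ`, with the oracle predicate interpreted by `Y`. -/
def arithStructure (Y : Set ℕ) : arithLang.Structure ℕ where
  funMap := fun {n} f =>
    match f with
    | ArFunc.zero => fun _ => 0
    | ArFunc.one => fun _ => 1
    | ArFunc.add => fun v => v 0 + v 1
    | ArFunc.mul => fun v => v 0 * v 1
  RelMap := fun {n} r =>
    match r with
    | ArRel.lt => fun v => v 0 < v 1
    | ArRel.mem => fun v => v 0 ∈ Y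

/-- `X ≤_ar Y` : `X` is definable without parameters in `(ℕ, +, ·, 0, 1, <, Y)`. -/
def ArReducible (X Y : Set ℕ) : Prop :=
  letI := arithStructure Y
  ∃ φ : arithLang.Formula (Fin 1), X = { n : ℕ | φ.Realize (fun _ => n) }

/-- `X` is arithmetical: definable without parameters in `(ℕ, +, ·, 0, 1, <)`. -/
def IsArithmetical (X : Set ℕ) : Prop := ArReducible X ∅

/-- `X` and `Y` have the same arithmetic degree. -/
def ArEquiv (X Y : Set ℕ) : Prop := ArReducible X Y ∧ ArReducible Y X

/-! ## Coding conventions -/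

/-- Code of a list of naturals. -/
def listCode (l : List ℕ) : ℕ := Encodable.encode l

/-- Code of a finite tuple of naturals. -/
def tupleCode {n : ℕ} (v : Fin n → ℕ) : ℕ := listCode (List.ofFn v)

/-- The subset of `ℕ` corresponding to a set of elements of a coded domain. -/
def subCode {A : Set ℕ} (S : Set ↥A) : Set ℕ := Subtype.val '' S

/-- Code of a set of `n`-tuples from a coded domain as a subset of `ℕ`. -/
def tupleSetCode {A : Set ℕ} {n : ℕ} (X : Set (Fin n → ↥A)) : Set ℕ :=
  { c : ℕ | ∃ v ∈ X, c = tupleCode (fun i => ((v i : ℕ))) }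

/-- Code of the graph of a function between coded domains. -/
def graphCode {A B : Set ℕ} (f : ↥A → ↥B) : Set ℕ :=
  { c : ℕ | ∃ a : ↥A, c = Nat.pair (a : ℕ) ((f a : ℕ)) }

/-! ## Gödel coded languages -/

/-- A fixed Gödel coding of the symbols of a countable first-order language. -/
structure GoedelCoding (L : FirstOrder.Language) where
  encFun : ∀ n, L.Functions n → ℕ
  encFun_inj : ∀ n, Function.Injective (encFun n)
  encRel : ∀ n, L.Relations n → ℕ
  encRel_inj : ∀ n, Function.Injective (encRel n)

variable {L : FirstOrder.Language}

/-- The set of codes of the symbols of `L`. -/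
def symbolCodes (g : GoedelCoding L) : Set ℕ :=
  { c | (∃ (n : ℕ) (f : L.Functions n), c = Nat.pair 0 (Nat.pair n (g.encFun n f))) ∨
        (∃ (n : ℕ) (R : L.Relations n), c = Nat.pair 1 (Nat.pair n (g.encRel n R))) }

/-- `L` is an arithmetically definable language. -/
def ArithLang (g : GoedelCoding L) : Prop := IsArithmetical (symbolCodes g)

/-- Code of a term, with a given coding of the variables. -/
def termCode (g : GoedelCoding L) {α : Type} (encα : α → ℕ) (t : L.Term α) : ℕ :=
  listCode (t.listEncode.map (Sum.elim (fun a => Nat.pair 0 (encα a))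
    (fun p => Nat.pair 1 (Nat.pair p.1 (g.encFun p.1 p.2)))))

/-- Code of a (bounded) formula, with a given coding of free variables. -/
def formulaCode (g : GoedelCoding L) {α : Type} (encα : α → ℕ) {n : ℕ}
    (φ : L.BoundedFormula α n) : ℕ :=
  listCode (φ.listEncode.map (Sum.elim
    (fun p => Nat.pair 0 (Nat.pair p.1
      (termCode g (Sum.elim (fun a => Nat.pair 0 (encα a)) (fun i => Nat.pair 1 i.1)) p.2)))
    (Sum.elim
      (fun q => Nat.pair 1 (Nat.pair q.1 (g.encRel q.1 q.2)))
      (fun m => Nat.pair 2 m))))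

/-- Code of a sentence. -/
def sentenceCode (g : GoedelCoding L) (φ : L.Sentence) : ℕ :=
  formulaCode g (fun a : Empty => a.elim) φ

/-- The set of codes of the axioms of a theory. -/
def theoryCode (g : GoedelCoding L) (T : L.Theory) : Set ℕ :=
  { c | ∃ φ ∈ T, c = sentenceCode g φ }

/-- `T` is an arithmetically definable theory. -/
def ArithTheory (g : GoedelCoding L) (T : L.Theory) : Prop := IsArithmetical (theoryCode g T)

/-! ## Coded structures -/

/-- A coded `L`-structure: an `L`-structure whose domain is a subset of `ℕ`
with infinite complement. -/
structure CodedStructure (L : FirstOrder.Language) where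
  carrier : Set ℕ
  compl_infinite : (carrierᶜ : Set ℕ).Infinite
  struc : L.Structure ↥carrier

/-- A coded structure is a model of `T`. -/
def CodedStructure.Models (M : CodedStructure L) (T : L.Theory) : Prop :=
  ∀ φ ∈ T, @Sentence.Realize L ↥M.carrier M.struc φ

/-- The (coded) elementary diagram of a coded structure. -/
def elemDiagram (g : GoedelCoding L) (M : CodedStructure L) : Set ℕ :=
  { c | ∃ (k : ℕ) (φ : L.Formula (Fin k)) (a : Fin k → ↥M.carrier),
      c = Nat.pair (Nat.pair k (formulaCode g Fin.val φ)) (tupleCode fun i => ((a i : ℕ))) ∧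
      (letI := M.struc; φ.Realize a) }

/-- A coded structure is arithmetically decidable if its elementary diagram is arithmetical. -/
def ArithDecidable (g : GoedelCoding L) (M : CodedStructure L) : Prop :=
  IsArithmetical (elemDiagram g M)

/-- `M ≼ N` for coded structures: `M`'s domain is contained in `N`'s, and the
inclusion is elementary. -/
structure ElemSub (M N : CodedStructure L) : Prop where
  subset : M.carrier ⊆ N.carrier
  elem : ∀ (k : ℕ) (φ : L.Formula (Fin k)) (a : Fin k → ↥M.carrier),
    (letI := M.struc; φ.Realize a) ↔
      (letI := N.struc; φ.Realize (fun i => (⟨((a i : ℕ)), subset (a i).2⟩ : ↥N.carrier)))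

/-- A coded model of `T` is arithmetically extendible if it is an elementary substructure of
an arithmetically decidable coded model of `T`. -/
def ArithExtendible (g : GoedelCoding L) (T : L.Theory) (M : CodedStructure L) : Prop :=
  ∃ N : CodedStructure L, ArithDecidable g N ∧ N.Models T ∧ ElemSub M N

/-! ## Model-theoretic notions in arbitrary structures -/

/-- `N` (with structure `SN`) is a model of `T`. -/
def ModelsT (L : FirstOrder.Language) (T : L.Theory) (N : Type) (SN : L.Structure N) : Prop :=
  ∀ φ ∈ T, @Sentence.Realize L N SN φ

/-- `T` has no finite models. -/
def NoFiniteModels (L : FirstOrder.Language) (T : L.Theory) : Prop :=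
  ∀ (N : Type) (SN : L.Structure N), ModelsT L T N SN → Infinite N

/-- Elementary embeddings, with the structures given explicitly. -/
def EEmb (L : FirstOrder.Language) (M : Type) (SM : L.Structure M)
    (N : Type) (SN : L.Structure N) : Type _ :=
  @FirstOrder.Language.ElementaryEmbedding L M N SM SN

/-- The underlying map of an elementary embedding. -/
def EEmb.fn {L : FirstOrder.Language} {M : Type} {SM : L.Structure M}
    {N : Type} {SN : L.Structure N} (j : EEmb L M SM N SN) : M → N :=
  @FirstOrder.Language.ElementaryEmbedding.toFun L M N SM SN j

/-- A subset of `N^n` definable with parameters from `P`. -/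
def DefinableOverT (L : FirstOrder.Language) (N : Type) (SN : L.Structure N) (P : Set N)
    {n : ℕ} (X : Set (Fin n → N)) : Prop :=
  letI := SN
  ∃ (m : ℕ) (ψ : L.Formula (Fin n ⊕ Fin m)) (b : Fin m → N),
    (∀ i, b i ∈ P) ∧ X = { v | ψ.Realize (Sum.elim v b) }

/-- A subset of `N` definable with (arbitrary) parameters. -/
def Definable1 (L : FirstOrder.Language) (N : Type) (SN : L.Structure N) (Y : Set N) : Prop :=
  letI := SN
  ∃ (m : ℕ) (ψ : L.Formula (Fin 1 ⊕ Fin m)) (b : Fin m → N),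
    Y = { x : N | ψ.Realize (Sum.elim (fun _ => x) b) }

/-- The algebraic closure of `B` in `N`: elements satisfying a formula with parameters
from `B` having finitely many solutions. -/
def aclIn (L : FirstOrder.Language) (N : Type) (SN : L.Structure N) (B : Set N) : Set N :=
  letI := SN
  { a : N | ∃ (k : ℕ) (φ : L.Formula (Fin 1 ⊕ Fin k)) (b : Fin k → N),
      (∀ i, b i ∈ B) ∧ φ.Realize (Sum.elim (fun _ => a) b) ∧
      { x : N | φ.Realize (Sum.elim (fun _ => x) b) }.Finite }

/-- The domain of the substructure of `N` generated by `B`: values of terms at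
arguments from `B`. -/
def genSub (L : FirstOrder.Language) (N : Type) (SN : L.Structure N) (B : Set N) : Set N :=
  letI := SN
  { a : N | ∃ (t : L.Term ℕ) (v : ℕ → N), (∀ i, v i ∈ B) ∧ a = t.realize v }

/-- The set defined by a formula `φ(x, p̄)` in one free variable with parameters `p̄`. -/
def smSet (L : FirstOrder.Language) (N : Type) (SN : L.Structure N) {k : ℕ}
    (φ : L.Formula (Fin 1 ⊕ Fin k)) (p : Fin k → N) : Set N :=
  letI := SN
  { x : N | φ.Realize (Sum.elim (fun _ => x) p) }

/-- A definable tuple-set in a coded structure, with parameters from `P`. -/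
def DefinableOver (M : CodedStructure L) (P : Set ↥M.carrier) {n : ℕ}
    (X : Set (Fin n → ↥M.carrier)) : Prop :=
  DefinableOverT L ↥M.carrier M.struc P X

/-- A definable tuple-set in a coded structure, with arbitrary parameters. -/
def DefinableIn (M : CodedStructure L) {n : ℕ} (X : Set (Fin n → ↥M.carrier)) : Prop :=
  DefinableOver M Set.univ X

/-! ## Isomorphisms of coded structures and `D`-categoricity -/

/-- An isomorphism of coded `L`-structures. -/
structure CodedIso (M N : CodedStructure L) where
  toFun : ↥M.carrier → ↥N.carrier
  invFun : ↥N.carrier → ↥M.carrier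
  left_inv : Function.LeftInverse invFun toFun
  right_inv : Function.RightInverse invFun toFun
  map_fun : ∀ {k : ℕ} (f : L.Functions k) (v : Fin k → ↥M.carrier),
    toFun (M.struc.funMap f v) = N.struc.funMap f (toFun ∘ v)
  map_rel : ∀ {k : ℕ} (r : L.Relations k) (v : Fin k → ↥M.carrier),
    M.struc.RelMap r v ↔ N.struc.RelMap r (toFun ∘ v)

/-- `f` is a `D`-preserving isomorphism, where `d` is a representative of the
arithmetic degree `D`. -/
def DPreserving (d : Set ℕ) {M N : CodedStructure L} (f : CodedIso M N) : Prop :=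
  ArReducible (graphCode f.toFun) d ∧
  ArReducible (graphCode f.invFun) d ∧
  (∀ (n : ℕ) (X : Set (Fin n → ↥M.carrier)), DefinableIn M X →
      ArEquiv (tupleSetCode X) d →
      ArEquiv (tupleSetCode ((fun v => f.toFun ∘ v) '' X)) d) ∧
  (∀ (n : ℕ) (Y : Set (Fin n → ↥N.carrier)), DefinableIn N Y →
      ArEquiv (tupleSetCode Y) d →
      ArEquiv (tupleSetCode ((fun v => f.invFun ∘ v) '' Y)) d)

/-- `T` is `D`-categorical, where `d` is a representative of the nonzero
arithmetic degree `D`. -/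
def DCategorical (g : GoedelCoding L) (T : L.Theory) (d : Set ℕ) : Prop :=
  ∀ M₀ M₁ M₂ : CodedStructure L,
    ArithDecidable g M₀ → M₀.Models T →
    M₁.Models T → ArithExtendible g T M₁ →
    M₂.Models T → ArithExtendible g T M₂ →
    ElemSub M₀ M₁ → ElemSub M₀ M₂ →
    ArEquiv M₁.carrier d → ArEquiv M₂.carrier d →
    ∃ f : CodedIso M₁ M₂, DPreserving d f ∧
      ∀ (x : ℕ) (hx : x ∈ M₀.carrier) (h₁ : x ∈ M₁.carrier),
        ((f.toFun ⟨x, h₁⟩ : ℕ)) = x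

/-! ## Vaughtian pairs, prime models, strong minimality -/

/-- `T` has a Vaughtian pair. -/
def HasVaughtianPair (T : L.Theory) : Prop :=
  ∃ (N : Type) (SN : L.Structure N),
    ModelsT L T N SN ∧
    ∃ S : @FirstOrder.Language.ElementarySubstructure L N SN,
      ((S.toSubstructure : Set N) ≠ Set.univ ∧
      ∃ (k : ℕ) (φ : L.Formula (Fin 1 ⊕ Fin k)) (a : Fin k → N),
        (∀ i, a i ∈ (S.toSubstructure : Set N)) ∧
        smSet L N SN φ a ⊆ (S.toSubstructure : Set N) ∧
        (smSet L N SN φ a).Infinite)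

/-- A coded model of `T` is prime: it elementarily embeds into every model of `T`. -/
def PrimeModel (L : FirstOrder.Language) (T : L.Theory) (P : CodedStructure L) : Prop :=
  P.Models T ∧ ∀ (N : Type) (SN : L.Structure N), ModelsT L T N SN →
    Nonempty (EEmb L ↥P.carrier P.struc N SN)

/-- `φ(x, p̄)` is strongly minimal over the coded model `M`: its solution set in `M` is
infinite, and in every elementary extension of `M` modelling `T` every definable subset of
its solution set is finite or cofinite in it. -/
def StronglyMinimalOver (T : L.Theory) (M : CodedStructure L) {k : ℕ}
    (φ : L.Formula (Fin 1 ⊕ Fin k)) (p : Fin k → ↥M.carrier) : Prop :=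
  (smSet L ↥M.carrier M.struc φ p).Infinite ∧
  ∀ (N : Type) (SN : L.Structure N), ModelsT L T N SN →
    ∀ j : EEmb L ↥M.carrier M.struc N SN,
      ∀ Y : Set N, Definable1 L N SN Y →
        Y ⊆ smSet L N SN φ (fun i => j.fn (p i)) →
        (Y.Finite ∨ ((smSet L N SN φ (fun i => j.fn (p i))) \ Y).Finite)

/-- `T` is a strongly minimal theory: every model is infinite, and every
parameter-definable subset of any model is finite or cofinite. -/
def StronglyMinimalTheory (L : FirstOrder.Language) (T : L.Theory) : Prop :=
  (∀ (N : Type) (SN : L.Structure N), ModelsT L T N SN → Infinite N) ∧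
  (∀ (N : Type) (SN : L.Structure N), ModelsT L T N SN →
    ∀ Y : Set N, Definable1 L N SN Y → (Y.Finite ∨ (Yᶜ : Set N).Finite))

/-- The structural control clause: an arithmetically decidable prime model together with
a strongly minimal formula over it generating every elementary extension. -/
def GeneratesAll (T : L.Theory) (P : CodedStructure L) {k : ℕ}
    (φ : L.Formula (Fin 1 ⊕ Fin k)) (p : Fin k → ↥P.carrier) : Prop :=
  ∀ (N : Type) (SN : L.Structure N), ModelsT L T N SN →
    ∀ j : EEmb L ↥P.carrier P.struc N SN,
      aclIn L N SN (Set.range j.fn ∪ smSet L N SN φ (fun i => j.fn (p i))) = Set.univ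

/-- Clause (3) of the arithmetic Baldwin–Lachlan theorem. -/
def SMControl (g : GoedelCoding L) (T : L.Theory) : Prop :=
  ∃ (P : CodedStructure L), ArithDecidable g P ∧ PrimeModel L T P ∧
    ∃ (k : ℕ) (φ : L.Formula (Fin 1 ⊕ Fin k)) (p : Fin k → ↥P.carrier),
      StronglyMinimalOver T P φ p ∧ GeneratesAll T P φ p

/-! ## Types and arithmetical stability -/

/-- A formula with a finite parameter tuple from a coded structure, in `n` object
variables. -/
def ParamFormula (L : FirstOrder.Language) (M : CodedStructure L) (n : ℕ) : Type :=
  Σ k : ℕ, L.Formula (Fin n ⊕ Fin k) × (Fin k → ↥M.carrier)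

/-- All parameters of `q` lie in `A`. -/
def paramsIn {M : CodedStructure L} {n : ℕ} (A : Set ℕ) (q : ParamFormula L M n) : Prop :=
  ∀ i, ((q.2.2 i : ℕ)) ∈ A

/-- `p` is consistent with the elementary diagram of `M`: it is realized in some
elementary extension of `M`. -/
def TypeConsistent (M : CodedStructure L) {n : ℕ} (p : Set (ParamFormula L M n)) : Prop :=
  ∃ (N : Type) (SN : L.Structure N) (j : EEmb L ↥M.carrier M.struc N SN) (b : Fin n → N),
    ∀ q ∈ p, letI := SN; q.2.1.Realize (Sum.elim b (fun i => j.fn (q.2.2 i)))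

/-- `p` is a (complete) `n`-type over `A` inside `M`: a maximal set of formulas with
parameters from `A` consistent with the elementary diagram of `M`. -/
def IsNType (M : CodedStructure L) (A : Set ℕ) (n : ℕ)
    (p : Set (ParamFormula L M n)) : Prop :=
  (∀ q ∈ p, paramsIn A q) ∧
  TypeConsistent M p ∧
  ∀ q : ParamFormula L M n, paramsIn A q → q ∉ p → ¬ TypeConsistent M (insert q p)

/-- The code of a formula-with-parameters. -/
def pfCode (g : GoedelCoding L) {M : CodedStructure L} {n : ℕ} (q : ParamFormula L M n) : ℕ :=
  Nat.pair
    (Nat.pair q.1 (formulaCode g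
      (Sum.elim (fun i : Fin n => Nat.pair 0 i.1) (fun j : Fin q.1 => Nat.pair 1 j.1)) q.2.1))
    (tupleCode fun i => ((q.2.2 i : ℕ)))

/-- The set of codes of the formulas of `p`. -/
def typeCode (g : GoedelCoding L) {M : CodedStructure L} {n : ℕ}
    (p : Set (ParamFormula L M n)) : Set ℕ :=
  { c | ∃ q ∈ p, c = pfCode g q }

/-- `p` is realized in the coded elementary extension `N` of `M`. -/
def RealizesType {M N : CodedStructure L} (h : M.carrier ⊆ N.carrier) {n : ℕ}
    (p : Set (ParamFormula L M n)) : Prop :=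
  ∃ b : Fin n → ↥N.carrier, ∀ q ∈ p,
    letI := N.struc
    q.2.1.Realize (Sum.elim b (fun i => (⟨((q.2.2 i : ℕ)), h (q.2.2 i).2⟩ : ↥N.carrier)))

/-- The `(n, i)`-th column of an effective join. -/
def tripleSection (X : Set ℕ) (n i : ℕ) : Set ℕ := { m | Nat.pair n (Nat.pair i m) ∈ X }

/-- `T` is arithmetically stable: over every arithmetically decidable model and every
arithmetical parameter set, the family of arithmetic `n`-types (for all `n ≥ 1`) has a
uniform arithmetical code in which every arithmetic `n`-type appears at least once. -/
def ArithStable (g : GoedelCoding L) (T : L.Theory) : Prop :=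
  ∀ M : CodedStructure L, ArithDecidable g M → M.Models T →
    ∀ A : Set ℕ, A ⊆ M.carrier → IsArithmetical A →
      ∃ X : Set ℕ, IsArithmetical X ∧
        (∀ n, 1 ≤ n → ∀ i : ℕ, ∃ p : Set (ParamFormula L M n),
            IsNType M A n p ∧ IsArithmetical (typeCode g p) ∧
            tripleSection X n i = typeCode g p) ∧
        (∀ n, 1 ≤ n → ∀ p : Set (ParamFormula L M n),
            IsNType M A n p → IsArithmetical (typeCode g p) →
            ∃ i : ℕ, tripleSection X n i = typeCode g p)

/-- The set of elements occurring as a coordinate of a tuple in `X`. -/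
def coordSet {N : Type} {n : ℕ} (X : Set (Fin n → N)) : Set N :=
  { m | ∃ v ∈ X, ∃ i, v i = m }

/-! ## Relations definable in arithmetic with an oracle -/

/-- `R` is definable without parameters in `(ℕ, +, ·, 0, 1, <, Z)`. -/
def ArithDef (Z : Set ℕ) {α : Type} (R : (α → ℕ) → Prop) : Prop :=
  ∃ φ : arithLang.Formula α, ∀ v, @Formula.Realize arithLang ℕ (arithStructure Z) α φ v ↔ R v

namespace ArithDef

variable {Z : Set ℕ} {α β : Type} {R S : (α → ℕ) → Prop}

theorem congr (h : ArithDef Z R) (e : ∀ v, S v ↔ R v) : ArithDef Z S := by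
  obtain ⟨φ, hφ⟩ := h
  exact ⟨φ, fun v => (hφ v).trans (e v).symm⟩

theorem not (h : ArithDef Z R) : ArithDef Z (fun v => ¬ R v) := by
  let _ := arithStructure Z
  obtain ⟨φ, hφ⟩ := h
  exact ⟨φ.not, fun v => by rw [Formula.realize_not, hφ]⟩

theorem imp (h : ArithDef Z R) (h' : ArithDef Z S) : ArithDef Z (fun v => R v → S v) := by
  let _ := arithStructure Z
  obtain ⟨φ, hφ⟩ := h
  obtain ⟨ψ, hψ⟩ := h'
  exact ⟨φ.imp ψ, fun v => by rw [Formula.realize_imp, hφ, hψ]⟩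

theorem and (h : ArithDef Z R) (h' : ArithDef Z S) : ArithDef Z (fun v => R v ∧ S v) :=
  (h.imp h'.not).not.congr fun v => by tauto

theorem or (h : ArithDef Z R) (h' : ArithDef Z S) : ArithDef Z (fun v => R v ∨ S v) :=
  (h.not.imp h').congr fun v => by tauto

theorem relabel (h : ArithDef Z R) (σ : α → β) : ArithDef Z (fun v : β → ℕ => R (v ∘ σ)) := by
  let _ := arithStructure Z
  obtain ⟨φ, hφ⟩ := h
  exact ⟨φ.relabel σ, fun v => by rw [Formula.realize_relabel, hφ]⟩

theorem ex {R : (α ⊕ Unit → ℕ) → Prop} (h : ArithDef Z R) :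
    ArithDef Z (fun v : α → ℕ => ∃ x, R (Sum.elim v fun _ => x)) := by
  let _ := arithStructure Z
  obtain ⟨φ, hφ⟩ := h
  refine ⟨φ.iExs Unit, fun v => ?_⟩
  rw [Formula.realize_iExs]
  exact ⟨fun ⟨i, hi⟩ => ⟨i (), (hφ _).1 hi⟩, fun ⟨x, hx⟩ => ⟨fun _ => x, (hφ _).2 hx⟩⟩

theorem all {R : (α ⊕ Unit → ℕ) → Prop} (h : ArithDef Z R) :
    ArithDef Z (fun v : α → ℕ => ∀ x, R (Sum.elim v fun _ => x)) :=
  h.not.ex.not.congr fun v => by simp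

end ArithDef

/-- `f` has a definable graph. -/
def ArithFun (Z : Set ℕ) {α : Type} (f : (α → ℕ) → ℕ) : Prop :=
  ArithDef Z (fun w : α ⊕ Unit → ℕ => f (w ∘ Sum.inl) = w (Sum.inr ()))

namespace ArithFun

variable {Z : Set ℕ} {α β : Type} {f g h : (α → ℕ) → ℕ}

theorem term (t : arithLang.Term α) :
    ArithFun Z (fun v => @Term.realize arithLang ℕ (arithStructure Z) α v t) := by
  let _ := arithStructure Z
  refine ⟨(t.relabel Sum.inl).equal (Term.var (Sum.inr ())), fun v => ?_⟩
  rw [Formula.realize_equal, Term.realize_relabel]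
  rfl

theorem var (i : α) : ArithFun Z (fun v => v i) := term (Term.var i)

theorem congr (hf : ArithFun Z f) (e : ∀ v, g v = f v) : ArithFun Z g := by
  obtain rfl : g = f := funext e
  exact hf

theorem relabel (hf : ArithFun Z f) (σ : α → β) : ArithFun Z (fun v : β → ℕ => f (v ∘ σ)) :=
  (ArithDef.relabel hf (Sum.map σ id)).congr fun _ => Iff.rfl

theorem subst₁ {R : (α ⊕ Unit → ℕ) → Prop} (hR : ArithDef Z R) (hf : ArithFun Z f) :
    ArithDef Z (fun v => R (Sum.elim v fun _ => f v)) :=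
  (hf.and hR).ex.congr fun v => by simp [Function.comp_def]

theorem comp_rel {R : ℕ → Prop} (hR : ArithDef Z (fun v : Unit → ℕ => R (v ())))
    (hf : ArithFun Z f) : ArithDef Z (fun v => R (f v)) :=
  (subst₁ (hR.relabel (Sum.inr : Unit → α ⊕ Unit)) hf).congr fun _ => Iff.rfl

theorem comp_rel₂ {R : ℕ → ℕ → Prop} (hR : ArithDef Z (fun v : Bool → ℕ => R (v false) (v true)))
    (hf : ArithFun Z f) (hg : ArithFun Z g) : ArithDef Z (fun v => R (f v) (g v)) := by
  have h1 : ArithDef Z (fun v : α ⊕ Unit → ℕ => R (v (Sum.inr ())) (g (v ∘ Sum.inl))) := by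
    refine (subst₁ (hR.relabel (fun b : Bool => bif b then Sum.inr () else Sum.inl (Sum.inr ())))
      (hg.relabel Sum.inl)).congr fun v => ?_
    simp
  exact (subst₁ h1 hf).congr fun _ => Iff.rfl

theorem comp {F : ℕ → ℕ} (hF : ArithFun Z (fun v : Unit → ℕ => F (v ()))) (hf : ArithFun Z f) :
    ArithFun Z (fun v => F (f v)) := by
  have : ArithDef Z (fun v : Bool → ℕ => F (v false) = v true) :=
    (ArithDef.relabel hF (Sum.elim (fun _ => false) fun _ => true)).congr fun _ => Iff.rfl
  exact (comp_rel₂ (R := fun a b => F a = b) this (hf.relabel Sum.inl) (var (Sum.inr ()))).congr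
    fun _ => Iff.rfl

theorem comp₂ {F : ℕ → ℕ → ℕ} (hF : ArithFun Z (fun v : Bool → ℕ => F (v false) (v true)))
    (hf : ArithFun Z f) (hg : ArithFun Z g) : ArithFun Z (fun v => F (f v) (g v)) := by
  have h1 : ArithDef Z (fun v : (α ⊕ Unit) ⊕ Unit → ℕ =>
      F (v (Sum.inr ())) (g (v ∘ Sum.inl ∘ Sum.inl)) = v (Sum.inl (Sum.inr ()))) := by
    refine (subst₁ (f := fun v : (α ⊕ Unit) ⊕ Unit → ℕ => g (v ∘ Sum.inl ∘ Sum.inl))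
      (ArithDef.relabel hF (Sum.elim (fun b : Bool => bif b then Sum.inr () else
        Sum.inl (Sum.inr ())) fun _ => Sum.inl (Sum.inl (Sum.inr ()))))
      (hg.relabel (Sum.inl ∘ Sum.inl))).congr fun v => ?_
    simp [Function.comp_def]
  exact (subst₁ h1 (hf.relabel Sum.inl)).congr fun _ => Iff.rfl

theorem zero : ArithFun Z (fun _ : α → ℕ => 0) :=
  (term (Z := Z) (Term.func (L := arithLang) (l := 0) (ArFunc.zero : ArFunc 0) ![])).congr fun _ => rfl

theorem one : ArithFun Z (fun _ : α → ℕ => 1) :=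
  (term (Z := Z) (Term.func (L := arithLang) (l := 0) (ArFunc.one : ArFunc 0) ![])).congr fun _ => rfl

theorem add (hf : ArithFun Z f) (hg : ArithFun Z g) : ArithFun Z (fun v => f v + g v) :=
  comp₂ (F := fun a b => a + b) ((term (Z := Z) (Term.func (L := arithLang) (l := 2) (ArFunc.add : ArFunc 2)
    ![Term.var false, Term.var true])).congr fun _ => rfl) hf hg

theorem mul (hf : ArithFun Z f) (hg : ArithFun Z g) : ArithFun Z (fun v => f v * g v) :=
  comp₂ (F := fun a b => a * b) ((term (Z := Z) (Term.func (L := arithLang) (l := 2) (ArFunc.mul : ArFunc 2)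
    ![Term.var false, Term.var true])).congr fun _ => rfl) hf hg

theorem lt (hf : ArithFun Z f) (hg : ArithFun Z g) : ArithDef Z (fun v => f v < g v) := by
  let _ := arithStructure Z
  exact comp_rel₂ (R := fun a b => a < b) ⟨Relations.formula (L := arithLang) (n := 2) ArRel.lt
    ![Term.var false, Term.var true], fun v => Iff.rfl⟩ hf hg

theorem mem (hf : ArithFun Z f) : ArithDef Z (fun v => f v ∈ Z) := by
  let _ := arithStructure Z
  exact comp_rel (R := fun a => a ∈ Z) ⟨Relations.formula (L := arithLang) (n := 1) ArRel.mem
    ![Term.var ()], fun v => Iff.rfl⟩ hf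

theorem eq (hf : ArithFun Z f) (hg : ArithFun Z g) : ArithDef Z (fun v => f v = g v) :=
  (subst₁ hf hg).congr fun _ => Iff.rfl

theorem pair (hf : ArithFun Z f) (hg : ArithFun Z g) :
    ArithFun Z (fun v => Nat.pair (f v) (g v)) := by
  have h : ArithFun Z (fun v : Bool → ℕ => Nat.pair (v false) (v true)) := by
    have a := var (Z := Z) (Sum.inl false : Bool ⊕ Unit)
    have b := var (Z := Z) (Sum.inl true : Bool ⊕ Unit)
    have c := var (Z := Z) (Sum.inr () : Bool ⊕ Unit)
    refine (((a.lt b).and (((b.mul b).add a).eq c)).or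
      ((a.lt b).not.and ((((a.mul a).add a).add b).eq c))).congr fun v => ?_
    simp only [Nat.pair, Function.comp]
    split_ifs <;> simp_all
  exact comp₂ (F := Nat.pair) h hf hg

theorem unpair_fst (hf : ArithFun Z f) : ArithFun Z (fun v => (f v).unpair.1) := by
  have h : ArithFun Z (fun v : Unit → ℕ => (v ()).unpair.1) := by
    have a := var (Z := Z) (Sum.inl (Sum.inl ()) : (Unit ⊕ Unit) ⊕ Unit)
    have b := var (Z := Z) (Sum.inl (Sum.inr ()) : (Unit ⊕ Unit) ⊕ Unit)
    have c := var (Z := Z) (Sum.inr () : (Unit ⊕ Unit) ⊕ Unit)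
    refine ((b.pair c).eq a).ex.congr fun v => ?_
    constructor
    · intro h
      exact ⟨(v (Sum.inl ())).unpair.2, by simp [← h]⟩
    · rintro ⟨x, hx⟩
      simp only [Sum.elim_inl, Sum.elim_inr] at hx
      simp [← hx]
  exact comp (F := fun a => a.unpair.1) h hf

theorem unpair_snd (hf : ArithFun Z f) : ArithFun Z (fun v => (f v).unpair.2) := by
  have h : ArithFun Z (fun v : Unit → ℕ => (v ()).unpair.2) := by
    have a := var (Z := Z) (Sum.inl (Sum.inl ()) : (Unit ⊕ Unit) ⊕ Unit)
    have b := var (Z := Z) (Sum.inl (Sum.inr ()) : (Unit ⊕ Unit) ⊕ Unit)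
    have c := var (Z := Z) (Sum.inr () : (Unit ⊕ Unit) ⊕ Unit)
    refine ((c.pair b).eq a).ex.congr fun v => ?_
    constructor
    · intro h
      exact ⟨(v (Sum.inl ())).unpair.1, by simp [← h]⟩
    · rintro ⟨x, hx⟩
      simp only [Sum.elim_inl, Sum.elim_inr] at hx
      simp [← hx]
  exact comp (F := fun a => a.unpair.2) h hf

theorem mod (hf : ArithFun Z f) (hg : ArithFun Z g) : ArithFun Z (fun v => f v % g v) := by
  have h : ArithFun Z (fun v : Bool → ℕ => v false % v true) := by
    have a := var (Z := Z) (Sum.inl (Sum.inl false) : (Bool ⊕ Unit) ⊕ Unit)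
    have b := var (Z := Z) (Sum.inl (Sum.inl true) : (Bool ⊕ Unit) ⊕ Unit)
    have c := var (Z := Z) (Sum.inl (Sum.inr ()) : (Bool ⊕ Unit) ⊕ Unit)
    have q := var (Z := Z) (Sum.inr () : (Bool ⊕ Unit) ⊕ Unit)
    refine ((((b.mul q).add c).eq a).and ((b.eq zero).or (c.lt b))).ex.congr fun v => ?_
    simp only [Function.comp, Sum.elim_inl, Sum.elim_inr]
    constructor
    · intro h
      refine ⟨v (Sum.inl false) / v (Sum.inl true), ?_, ?_⟩
      · rw [← h, add_comm, Nat.mod_add_div]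
      · rcases Nat.eq_zero_or_pos (v (Sum.inl true)) with h0 | h0
        · exact .inl h0
        · exact .inr (h ▸ Nat.mod_lt _ h0)
    · rintro ⟨x, hx, h0 | h0⟩
      · rw [h0] at hx ⊢
        simpa using hx.symm
      · rw [← hx, Nat.mul_add_mod, Nat.mod_eq_of_lt h0]
  exact comp₂ (F := fun a b => a % b) h hf hg

theorem beta (hf : ArithFun Z f) (hg : ArithFun Z g) :
    ArithFun Z (fun v => Nat.beta (f v) (g v)) :=
  (hf.unpair_fst.mod (((hg.add one).mul hf.unpair_snd).add one)).congr fun _ => rfl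

theorem exists_beta (F : ℕ → ℕ) (n : ℕ) : ∃ s, ∀ i ≤ n, Nat.beta s i = F i := by
  let l := (List.range (n + 1)).map F
  refine ⟨Nat.unbeta l, fun i hi => ?_⟩
  have hi' : i < l.length := by simp [l]; omega
  simpa [l] using Nat.beta_unbeta_coe l ⟨i, hi'⟩

theorem of_natPrimrec {F : ℕ → ℕ} (h : Nat.Primrec F) :
    ArithFun Z (fun v : Unit → ℕ => F (v ())) := by
  induction h with
  | zero => exact zero
  | succ => exact (var ()).add one
  | left => exact (var ()).unpair_fst
  | right => exact (var ()).unpair_snd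
  | pair _ _ hf hg => exact hf.pair hg
  | comp _ _ hf hg => exact comp hf hg
  | @prec F G _ _ hF hG =>
    let H : ℕ → ℕ → ℕ := fun z n => n.rec (F z) fun y IH => G (Nat.pair z (Nat.pair y IH))
    have key : ∀ z n y, H z n = y ↔ ∃ s, Nat.beta s 0 = F z ∧
        (∀ i, i < n → Nat.beta s (i + 1) = G (Nat.pair z (Nat.pair i (Nat.beta s i)))) ∧
        Nat.beta s n = y := by
      intro z n y
      constructor
      · rintro rfl
        obtain ⟨s, hs⟩ := exists_beta (H z) n
        refine ⟨s, hs 0 (Nat.zero_le _), fun i hi => ?_, hs n le_rfl⟩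
        rw [hs _ hi, hs _ hi.le]
      · rintro ⟨s, h0, h1, rfl⟩
        have : ∀ i ≤ n, Nat.beta s i = H z i := by
          intro i
          induction i with
          | zero => exact fun _ => h0
          | succ i ih => exact fun hi => by rw [h1 i hi, ih (by omega)]
        exact (this n le_rfl).symm
    have a := var (Z := Z) (Sum.inl (Sum.inl ()) : (Unit ⊕ Unit) ⊕ Unit)
    have y := var (Z := Z) (Sum.inl (Sum.inr ()) : (Unit ⊕ Unit) ⊕ Unit)
    have s := var (Z := Z) (Sum.inr () : (Unit ⊕ Unit) ⊕ Unit)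
    have a' := var (Z := Z) (Sum.inl (Sum.inl (Sum.inl ())) : ((Unit ⊕ Unit) ⊕ Unit) ⊕ Unit)
    have s' := var (Z := Z) (Sum.inl (Sum.inr ()) : ((Unit ⊕ Unit) ⊕ Unit) ⊕ Unit)
    have i := var (Z := Z) (Sum.inr () : ((Unit ⊕ Unit) ⊕ Unit) ⊕ Unit)
    refine (((s.beta zero).eq (comp hF a.unpair_fst)).and
      (((i.lt a'.unpair_snd).imp ((s'.beta (i.add one)).eq
        (comp hG (a'.unpair_fst.pair (i.pair (s'.beta i)))))).all.and
        ((s.beta a.unpair_snd).eq y))).ex.congr fun v => ?_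
    exact key _ _ _

end ArithFun

theorem ArithDef.of_formula {Y Z : Set ℕ} (hY : ArithDef Z (fun v : Unit → ℕ => v () ∈ Y))
    {α : Type} {n : ℕ} (φ : arithLang.BoundedFormula α n) :
    ArithDef Z (fun v : α ⊕ Fin n → ℕ => @BoundedFormula.Realize arithLang ℕ (arithStructure Y) α n φ
      (v ∘ Sum.inl) (v ∘ Sum.inr)) := by
  have ht : ∀ {β : Type} (t : arithLang.Term β),
      ArithFun Z (fun v : β → ℕ => @Term.realize arithLang ℕ (arithStructure Y) β v t) := by
    intro β t
    induction t with
    | var i => exact ArithFun.var i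
    | @func l f ts ih =>
      cases f with
      | zero => exact ArithFun.zero
      | one => exact ArithFun.one
      | add => exact (ih 0).add (ih 1)
      | mul => exact (ih 0).mul (ih 1)
  have ht' : ∀ {n : ℕ} (t : arithLang.Term (α ⊕ Fin n)),
      ArithFun Z (fun v : α ⊕ Fin n → ℕ => @Term.realize arithLang ℕ (arithStructure Y) _
        (Sum.elim (v ∘ Sum.inl) (v ∘ Sum.inr)) t) := fun t =>
    (ht t).congr fun v => by rw [Sum.elim_comp_inl_inr]
  induction φ with
  | falsum =>
    refine ((ArithFun.zero).lt ArithFun.zero).congr fun v => ?_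
    simp only [lt_irrefl, iff_false]
    exact id
  | equal t₁ t₂ => exact (ht' t₁).eq (ht' t₂)
  | @rel n l r ts =>
    cases r with
    | lt => exact (ht' (ts 0)).lt (ht' (ts 1))
    | mem => exact ArithFun.comp_rel hY (ht' (ts 0))
  | imp _ _ h₁ h₂ => exact h₁.imp h₂
  | @all n f h =>
    refine (ArithDef.all (h.relabel (Sum.elim (fun a => Sum.inl (Sum.inl a))
      (Fin.snoc (fun i => Sum.inl (Sum.inr i)) (Sum.inr ()))))).congr fun v => ?_
    refine forall_congr' fun x => ?_
    have : Fin.snoc (v ∘ Sum.inr) x = ((Sum.elim v fun _ : Unit => x) ∘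
      (Sum.elim (fun a => Sum.inl (Sum.inl a))
      (Fin.snoc (fun i : Fin n => Sum.inl (Sum.inr i)) (Sum.inr ()))) : α ⊕ Fin (n+1) → ℕ) ∘ Sum.inr := by
      funext i
      refine Fin.lastCases ?_ (fun i => ?_) i <;> simp
    rw [← this]
    rfl

theorem arReducible_iff {X Z : Set ℕ} :
    ArReducible X Z ↔ ArithDef Z (fun v : Unit → ℕ => v () ∈ X) := by
  let _ := arithStructure Z
  constructor
  · rintro ⟨φ, rfl⟩
    have h : ArithDef Z (fun v : Fin 1 → ℕ => φ.Realize v) := ⟨φ, fun _ => Iff.rfl⟩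
    exact (h.relabel fun _ => ()).congr fun _ => Iff.rfl
  · intro h
    obtain ⟨φ, hφ⟩ := h.relabel (fun _ : Unit => (0 : Fin 1))
    exact ⟨φ, Set.ext fun n => (hφ fun _ => n).symm⟩

theorem ArReducible.trans {X Y Z : Set ℕ} (h : ArReducible X Y) (h' : ArReducible Y Z) :
    ArReducible X Z := by
  obtain ⟨φ, hφ⟩ := h
  rw [arReducible_iff] at h' ⊢
  refine ((ArithDef.of_formula h' φ).relabel
    (Sum.elim (fun _ => ()) Fin.elim0)).congr fun v => ?_
  rw [hφ]
  exact iff_of_eq (congr_arg (@BoundedFormula.Realize arithLang ℕ (arithStructure Y) _ _ φ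
    (fun _ => v ())) (Subsingleton.elim _ _))

theorem arReducible_empty (Z : Set ℕ) : ArReducible ∅ Z :=
  arReducible_iff.2 (((ArithFun.zero).lt ArithFun.zero).congr fun _ => by simp)

theorem IsArithmetical.arReducible {X : Set ℕ} (h : IsArithmetical X) (Z : Set ℕ) :
    ArReducible X Z := ArReducible.trans h (arReducible_empty Z)

/-! ## Arithmetical predicates on primitively codable types -/

/-- `p` is arithmetical in `Z`. -/
def ArP (Z : Set ℕ) {α : Type} [Primcodable α] (p : α → Prop) : Prop :=
  ArithDef Z (fun v : Unit → ℕ => ∃ a : α, Encodable.encode a = v () ∧ p a)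

namespace ArP

variable {Z : Set ℕ} {α β γ : Type} [Primcodable α] [Primcodable β] [Primcodable γ]
  {p q : α → Prop}

theorem congr (h : ArP Z p) (e : ∀ a, q a ↔ p a) : ArP Z q := by
  obtain rfl : q = p := funext fun a => propext (e a)
  exact h

theorem nat_iff {p : ℕ → Prop} : ArP Z p ↔ ArReducible {n | p n} Z := by
  rw [arReducible_iff]
  exact ⟨fun h => ArithDef.congr h fun v => by simp, fun h => ArithDef.congr h fun v => by simp⟩

theorem mono (h : ArP ∅ p) (Z : Set ℕ) : ArP Z p := by
  have h1 : IsArithmetical {n | ∃ a : α, Encodable.encode a = n ∧ p a} := arReducible_iff.2 h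
  exact arReducible_iff.1 (h1.arReducible Z)

theorem true' : ArP Z (fun _ : α => True) := by
  have h := ArithFun.of_natPrimrec (Z := Z) (Primcodable.prim α)
  refine (h.eq ((ArithFun.var ()).add ArithFun.one)).congr fun v => ?_
  constructor
  · rintro ⟨a, ha, -⟩
    simp [← ha]
  · intro h
    cases hd : Encodable.decode (α := α) (v ()) with
    | none => simp [hd] at h
    | some a => exact ⟨a, by simpa [hd] using h, trivial⟩

theorem not (h : ArP Z p) : ArP Z (fun a => ¬ p a) :=
  (ArithDef.and (true' (α := α)) (ArithDef.not h)).congr fun v => by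
    constructor
    · rintro ⟨a, ha, hp⟩
      refine ⟨⟨a, ha, trivial⟩, ?_⟩
      rintro ⟨b, hb, hb'⟩
      exact hp (Encodable.encode_injective (hb.trans ha.symm) ▸ hb')
    · rintro ⟨⟨a, ha, -⟩, hp⟩
      exact ⟨a, ha, fun h => hp ⟨a, ha, h⟩⟩

theorem and (h : ArP Z p) (h' : ArP Z q) : ArP Z (fun a => p a ∧ q a) :=
  (ArithDef.and h h').congr fun v => by
    constructor
    · rintro ⟨a, ha, hp, hq⟩
      exact ⟨⟨a, ha, hp⟩, ⟨a, ha, hq⟩⟩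
    · rintro ⟨⟨a, ha, hp⟩, ⟨b, hb, hq⟩⟩
      exact ⟨a, ha, hp, Encodable.encode_injective (hb.trans ha.symm) ▸ hq⟩

theorem or (h : ArP Z p) (h' : ArP Z q) : ArP Z (fun a => p a ∨ q a) :=
  (h.not.and h'.not).not.congr fun a => by tauto

theorem imp (h : ArP Z p) (h' : ArP Z q) : ArP Z (fun a => p a → q a) :=
  (h.not.or h').congr fun a => by tauto

theorem iff (h : ArP Z p) (h' : ArP Z q) : ArP Z (fun a => (p a ↔ q a)) :=
  ((h.imp h').and (h'.imp h)).congr fun a => by tauto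

theorem comp {p : β → Prop} (hp : ArP Z p) {f : α → β} (hf : Primrec f) :
    ArP Z (fun a => p (f a)) := by
  have hF := ArithFun.of_natPrimrec (Z := Z) hf
  have h1 : ArithDef Z (fun v : Unit → ℕ => ∃ m, Encodable.encode
      ((Encodable.decode (α := α) (v ())).map f) = m + 1 ∧ ∃ b, Encodable.encode b = m ∧ p b) :=
    ((ArithFun.comp (F := fun n => Encodable.encode
      ((Encodable.decode (α := α) n).map f)) hF (ArithFun.var (Sum.inl ()))).eq
      ((ArithFun.var (Sum.inr ())).add ArithFun.one)).and
      (ArithFun.comp_rel (R := fun m => ∃ b, Encodable.encode b = m ∧ p b) hp (ArithFun.var (Sum.inr ()))) |>.ex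
  refine (ArithDef.and (true' (α := α)) h1).congr fun v => ?_
  constructor
  · rintro ⟨a, ha, hp⟩
    exact ⟨⟨a, ha, trivial⟩, Encodable.encode (f a), by simp [← ha], _, rfl, hp⟩
  · rintro ⟨⟨a, ha, -⟩, m, hm, b, hb, hp⟩
    refine ⟨a, ha, ?_⟩
    simp only [← ha, Encodable.encodek, Option.map_some, Encodable.encode_some,
      Nat.succ_eq_add_one, Nat.add_right_cancel_iff, ← hb] at hm
    have : f a = b := Encodable.encode_injective hm
    exact show p (f a) from this ▸ hp

theorem ex {p : α → β → Prop} (h : ArP Z (fun x : α × β => p x.1 x.2)) :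
    ArP Z (fun a => ∃ b, p a b) := by
  have h1 := ArithFun.comp_rel (R := fun m => ∃ x : α × β, Encodable.encode x = m ∧ p x.1 x.2) h ((ArithFun.var (Sum.inl ())).pair (ArithFun.var (Sum.inr ())) :
    ArithFun Z fun v : Unit ⊕ Unit → ℕ => _)
  refine h1.ex.congr fun v => ?_
  constructor
  · rintro ⟨a, ha, b, hp⟩
    exact ⟨Encodable.encode b, (a, b), by simp [← ha], hp⟩
  · rintro ⟨m, ⟨a, b⟩, hab, hp⟩
    simp only [Encodable.encode_prod_val, Sum.elim_inl, Sum.elim_inr, Nat.pair_eq_pair] at hab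
    exact ⟨a, hab.1, b, hp⟩

theorem all {p : α → β → Prop} (h : ArP Z (fun x : α × β => p x.1 x.2)) :
    ArP Z (fun a => ∀ b, p a b) :=
  (ex (p := fun a b => ¬ p a b) h.not).not.congr fun a => by simp

theorem eq {f g : α → β} (hf : Primrec f) (hg : Primrec g) : ArP Z (fun a => f a = g a) := by
  have hF := ArithFun.of_natPrimrec (Z := Z) hf
  have hG := ArithFun.of_natPrimrec (Z := Z) hg
  refine (ArithDef.and (true' (α := α)) (hF.eq hG)).congr fun v => ?_
  constructor
  · rintro ⟨a, ha, h⟩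
    exact ⟨⟨a, ha, trivial⟩, by simp [← ha, h]⟩
  · rintro ⟨⟨a, ha, -⟩, h⟩
    exact ⟨a, ha, by simpa [← ha] using h⟩

theorem of_reducible {X : Set ℕ} (h : ArReducible X Z) : ArP Z (fun n => n ∈ X) :=
  nat_iff.2 h

theorem oracle (Z : Set ℕ) : ArP Z (fun n => n ∈ Z) :=
  of_reducible (arReducible_iff.2 (ArithFun.var ()).mem)

theorem mem {f : α → β} {g : α → List β} (hf : Primrec f) (hg : Primrec g) :
    ArP Z (fun a => f a ∈ g a) := by
  refine (ex (β := ℕ) (p := fun a i => (g a)[i]? = some (f a)) (eq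
    (Primrec.list_getElem?.comp (hg.comp .fst) .snd)
    (Primrec.option_some.comp (hf.comp .fst)))).congr fun a => ?_
  simp [List.mem_iff_getElem?]

theorem lt {f g : α → ℕ} (hf : Primrec f) (hg : Primrec g) : ArP Z (fun a => f a < g a) :=
  (ex (β := ℕ) (p := fun a i => f a + i + 1 = g a) (eq (Primrec.succ.comp (Primrec.nat_add.comp
    (hf.comp .fst) .snd)) (hg.comp .fst))).congr fun a =>
      ⟨fun h => ⟨g a - f a - 1, by omega⟩, fun ⟨i, hi⟩ => by omega⟩

end ArP

section Automation

variable {Z : Set ℕ} {α β γ δ : Type} [Primcodable α] [Primcodable β] [Primcodable γ]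
  [Primcodable δ]

theorem primrec_id : Primrec (fun a : α => a) := Primrec.id

theorem primrec_const (b : β) : Primrec (fun _ : α => b) := Primrec.const b

theorem primrec_comp {f : β → γ} {g : α → β} (hf : Primrec f) (hg : Primrec g) :
    Primrec (fun a => f (g a)) := hf.comp hg

theorem primrec_fst {f : α → β × γ} (hf : Primrec f) : Primrec (fun a => (f a).1) :=
  Primrec.fst.comp hf

theorem primrec_snd {f : α → β × γ} (hf : Primrec f) : Primrec (fun a => (f a).2) :=
  Primrec.snd.comp hf

theorem primrec_mk {f : α → β} {g : α → γ} (hf : Primrec f) (hg : Primrec g) :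
    Primrec (fun a => (f a, g a)) := hf.pair hg

theorem primrec_cons {f : α → β} {g : α → List β} (hf : Primrec f) (hg : Primrec g) :
    Primrec (fun a => f a :: g a) := Primrec.list_cons.comp hf hg

theorem primrec_append {f : α → List β} {g : α → List β} (hf : Primrec f) (hg : Primrec g) :
    Primrec (fun a => f a ++ g a) := Primrec.list_append.comp hf hg

theorem primrec_map {f : α → List β} {g : α → β → γ} (hf : Primrec f)
    (hg : Primrec fun p : α × β => g p.1 p.2) : Primrec (fun a => (f a).map (g a)) :=
  Primrec.list_map hf hg

theorem primrec_pair {f g : α → ℕ} (hf : Primrec f) (hg : Primrec g) :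
    Primrec (fun a => Nat.pair (f a) (g a)) := Primrec₂.natPair.comp hf hg

theorem primrec_add {f g : α → ℕ} (hf : Primrec f) (hg : Primrec g) :
    Primrec (fun a => f a + g a) := Primrec.nat_add.comp hf hg

theorem primrec_encode {f : α → β} (hf : Primrec f) :
    Primrec (fun a => Encodable.encode (f a)) := Primrec.encode.comp hf

theorem primrec_decode {f : α → ℕ} (hf : Primrec f) :
    Primrec (fun a => (Encodable.decode (f a) : Option β)) := Primrec.decode.comp hf

theorem primrec_length {f : α → List β} (hf : Primrec f) :
    Primrec (fun a => (f a).length) := Primrec.list_length.comp hf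

theorem primrec_getElem? {f : α → List β} {g : α → ℕ} (hf : Primrec f) (hg : Primrec g) :
    Primrec (fun a => (f a)[g a]?) := Primrec.list_getElem?.comp hf hg

theorem primrec_some {f : α → β} (hf : Primrec f) : Primrec (fun a => some (f a)) :=
  Primrec.option_some.comp hf

theorem primrec_inl {f : α → β} (hf : Primrec f) : Primrec (fun a => (Sum.inl (f a) : β ⊕ γ)) :=
  Primrec.sumInl.comp hf

theorem primrec_inr {f : α → β} (hf : Primrec f) : Primrec (fun a => (Sum.inr (f a) : γ ⊕ β)) :=
  Primrec.sumInr.comp hf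

theorem primrec_flatten {f : α → List (List β)} (hf : Primrec f) :
    Primrec (fun a => (f a).flatten) := Primrec.list_flatten.comp hf

theorem ArP.comp' {p : β → Prop} {f : α → β} (hp : ArP Z p) (hf : Primrec f) :
    ArP Z (fun a => p (f a)) := hp.comp hf

end Automation

attribute [fun_prop] Primrec ArP
attribute [fun_prop] primrec_id primrec_const primrec_comp primrec_fst primrec_snd primrec_mk
  primrec_cons primrec_append primrec_map primrec_pair primrec_add primrec_encode primrec_decode
  primrec_length primrec_getElem? primrec_some primrec_inl primrec_inr primrec_flatten
attribute [fun_prop] ArP.comp' ArP.and ArP.or ArP.not ArP.imp ArP.iff ArP.eq ArP.lt ArP.mem ArP.ex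
  ArP.all

/-! ## Inductively generated predicates -/

/-- The least predicate closed under the rules `R`, a rule being a list of premises with a
conclusion. -/
inductive Gen {β : Type} (R : List β × β → Prop) : β → Prop
  | mk (ps : List β) (y : β) (hR : R (ps, y)) (h : ∀ p ∈ ps, Gen R p) : Gen R y

theorem gen_iff_exists_derivation {β : Type} {R : List β × β → Prop} {y : β} :
    Gen R y ↔ ∃ d : List β, y ∈ d ∧ ∀ (d₁ : List β) (x : β) (d₂ : List β), d = d₁ ++ x :: d₂ →
      ∃ ps : List β, R (ps, x) ∧ ∀ p, p ∈ ps → p ∈ d₂ := by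
  constructor
  · intro h
    induction h with
    | mk ps y hR _ ih =>
      have aux : ∀ qs : List β, (∀ q ∈ qs, q ∈ ps) → ∃ d : List β, (∀ q ∈ qs, q ∈ d) ∧
          ∀ (d₁ : List β) (x : β) (d₂ : List β), d = d₁ ++ x :: d₂ →
            ∃ ps : List β, R (ps, x) ∧ ∀ p, p ∈ ps → p ∈ d₂ := by
        intro qs
        induction qs with
        | nil => exact fun _ => ⟨[], by simp, by simp⟩
        | cons q qs ihq =>
          intro hq
          obtain ⟨d, hd, hd'⟩ := ihq fun q' h => hq q' (List.mem_cons_of_mem _ h)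
          obtain ⟨e, he, he'⟩ := ih q (hq q List.mem_cons_self)
          refine ⟨d ++ e, ?_, fun d₁ x d₂ hdx => ?_⟩
          · intro q' h
            rcases List.mem_cons.1 h with rfl | h
            · exact List.mem_append_right _ he
            · exact List.mem_append_left _ (hd _ h)
          · rcases List.append_eq_append_iff.1 hdx with ⟨a, rfl, h2⟩ | ⟨a, rfl, h2⟩
            · exact he' _ _ _ h2
            · cases a with
              | nil =>
                obtain ⟨ps, h3, h4⟩ := he' [] x d₂ (by simpa using h2.symm)
                exact ⟨ps, h3, h4⟩
              | cons z a =>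
                simp only [List.cons_append, List.cons.injEq] at h2
                obtain ⟨rfl, rfl⟩ := h2
                obtain ⟨ps, h3, h4⟩ := hd' d₁ x a rfl
                exact ⟨ps, h3, fun p hp => List.mem_append_left _ (h4 p hp)⟩
      obtain ⟨d, hd, hd'⟩ := aux ps fun _ h => h
      refine ⟨y :: d, List.mem_cons_self, fun d₁ x d₂ hdx => ?_⟩
      cases d₁ with
      | nil =>
        simp only [List.nil_append, List.cons.injEq] at hdx
        obtain ⟨rfl, rfl⟩ := hdx
        exact ⟨ps, hR, hd⟩
      | cons z d₁ =>
        simp only [List.cons_append, List.cons.injEq] at hdx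
        exact hd' _ _ _ hdx.2
  · rintro ⟨d, hy, hd⟩
    have : ∀ e f : List β, d = f ++ e → ∀ x ∈ e, Gen R x := by
      intro e
      induction e with
      | nil => simp
      | cons z e ih =>
        intro f hf x hx
        have ihe := ih (f ++ [z]) (by simp [hf])
        rcases List.mem_cons.1 hx with rfl | hx
        · obtain ⟨ps, h1, h2⟩ := hd _ _ _ hf
          exact ⟨ps, x, h1, fun p hp => ihe p (h2 p hp)⟩
        · exact ihe x hx
    exact this d [] rfl y hy

theorem ArP.gen {Z : Set ℕ} {β : Type} [Primcodable β] {R : List β × β → Prop} (hR : ArP Z R) :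
    ArP Z (Gen R) := by
  refine ArP.congr ?_ fun y => gen_iff_exists_derivation
  fun_prop

/-! ## Arithmetical compactness for propositional clauses -/

/-- `X` satisfies the clause `⋀ c.1 → ⋁ c.2`. -/
def ClauseSat {I : Type} (X : I → Prop) (c : List I × List I) : Prop :=
  (∀ i, i ∈ c.1 → X i) → ∃ i, i ∈ c.2 ∧ X i

section Compactness

variable {I : Type}

/-- The finite set of clauses `F` is satisfied by a finite set. -/
def ListSat (F : List (List I × List I)) : Prop :=
  ∃ A : List I, ∀ c, c ∈ F → ClauseSat (· ∈ A) c

/-- The clauses `σ` are finitely consistent with the clauses `C`. -/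
def Ext (C : List I × List I → Prop) (σ : List (List I × List I)) : Prop :=
  ∀ F : List (List I × List I), (∀ c, c ∈ F → C c) → ListSat (F ++ σ)

theorem ListSat.of_forall {F : List (List I × List I)} {X : I → Prop}
    (h : ∀ c, c ∈ F → ClauseSat X c) : ListSat F := by
  classical
  refine ⟨(F.flatMap fun c => c.1 ++ c.2).filter (fun i => X i), fun c hc hneg => ?_⟩
  obtain ⟨i, hi, hXi⟩ := h c hc fun i hi => by simpa using (List.mem_filter.1 (hneg i hi)).2
  exact ⟨i, hi, List.mem_filter.2 ⟨List.mem_flatMap.2 ⟨c, hc, by simp [hi]⟩, by simpa using hXi⟩⟩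

theorem Ext.cons {C : List I × List I → Prop} {σ : List (List I × List I)} (h : Ext C σ) (i : I)
    (hi : ¬ Ext C (([], [i]) :: σ)) : Ext C (([i], []) :: σ) := by
  intro F hF
  unfold Ext at hi
  push Not at hi
  obtain ⟨G, hG, hG'⟩ := hi
  obtain ⟨A, hA⟩ := h (F ++ G) (by
    intro c hc
    rcases List.mem_append.1 hc with hc | hc
    exacts [hF c hc, hG c hc])
  have hiA : i ∉ A := by
    intro hiA
    refine hG' ⟨A, fun c hc => ?_⟩
    rcases List.mem_append.1 hc with hc | hc
    · exact hA c (by simp [hc])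
    · rcases List.mem_cons.1 hc with rfl | hc
      · exact fun _ => ⟨i, by simp, hiA⟩
      · exact hA c (by simp [hc])
  refine ⟨A, fun c hc => ?_⟩
  rcases List.mem_append.1 hc with hc | hc
  · exact hA c (by simp [hc])
  · rcases List.mem_cons.1 hc with rfl | hc
    · exact fun h => absurd (h i (by simp)) hiA
    · exact hA c (by simp [hc])

variable [Primcodable I]

/-- One step of the greedy construction of a satisfying assignment. -/
def GreedyStep (C : List I × List I → Prop) (n : ℕ) (σ τ : List (List I × List I)) : Prop :=
  (Encodable.decode (α := I) n = none ∧ τ = σ) ∨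
  ∃ i, Encodable.decode n = some i ∧ ((Ext C (([], [i]) :: σ) ∧ τ = ([], [i]) :: σ) ∨
    (¬ Ext C (([], [i]) :: σ) ∧ τ = ([i], []) :: σ))

/-- The rules generating the greedy construction. -/
def GreedyRule (C : List I × List I → Prop)
    (r : List (ℕ × List (List I × List I)) × (ℕ × List (List I × List I))) : Prop :=
  (r.2.1 = 0 ∧ r.2.2 = []) ∨
  ∃ n σ, r.1 = [(n, σ)] ∧ r.2.1 = n + 1 ∧ GreedyStep C n σ r.2.2

theorem exists_arithmetical_assignment {Z : Set ℕ} {C : List I × List I → Prop} (hC : ArP Z C)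
    (hfin : ∀ F : List (List I × List I), (∀ c ∈ F, C c) → ∃ X : I → Prop, ∀ c ∈ F, ClauseSat X c) :
    ∃ X : I → Prop, ArP Z X ∧ ∀ c, C c → ClauseSat X c := by
  classical
  have hstep : ∀ n σ, ∃ τ, GreedyStep C n σ τ := by
    intro n σ
    cases h : Encodable.decode (α := I) n with
    | none => exact ⟨σ, .inl ⟨h, rfl⟩⟩
    | some i =>
      by_cases he : Ext C (([], [i]) :: σ)
      · exact ⟨_, .inr ⟨i, h, .inl ⟨he, rfl⟩⟩⟩
      · exact ⟨_, .inr ⟨i, h, .inr ⟨he, rfl⟩⟩⟩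
  have huniq : ∀ n σ τ τ', GreedyStep C n σ τ → GreedyStep C n σ τ' → τ = τ' := by
    unfold GreedyStep
    intro n σ τ τ'
    cases h : Encodable.decode (α := I) n with
    | none => rintro (⟨-, rfl⟩ | ⟨i, h, -⟩) (⟨-, rfl⟩ | ⟨i, h, -⟩) <;> first | rfl | cases h
    | some j =>
      rintro (⟨h, -⟩ | ⟨i, hi, h⟩) (⟨h', -⟩ | ⟨i', hi', h'⟩)
      · cases h
      · cases h
      · cases h'
      · cases hi
        cases hi'
        rcases h with ⟨h1, rfl⟩ | ⟨h1, rfl⟩ <;> rcases h' with ⟨h2, rfl⟩ | ⟨h2, rfl⟩ <;>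
          first | rfl | exact absurd h1 h2 | exact absurd h2 h1
  choose step hstep using hstep
  let s : ℕ → List (List I × List I) := fun n => n.rec [] step
  have hgen : ∀ n σ, Gen (GreedyRule C) (n, σ) ↔ σ = s n := by
    intro n σ
    constructor
    · have : ∀ x, Gen (GreedyRule C) x → x.2 = s x.1 := by
        intro x hx
        induction hx with
        | mk ps y hR _ ih =>
          obtain ⟨n, σ⟩ := y
          rcases hR with ⟨rfl, rfl⟩ | ⟨m, τ, rfl, rfl, h⟩
          · rfl
          · have := ih (m, τ) (by simp)
            simp only at this
            subst this
            exact huniq _ _ _ _ h (hstep _ _)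
      exact this _
    · rintro rfl
      induction n with
      | zero => exact ⟨[], _, .inl ⟨rfl, rfl⟩, by simp⟩
      | succ n ih => exact ⟨[(n, s n)], _, .inr ⟨n, s n, rfl, rfl, hstep _ _⟩, by simpa using ih⟩
  have hext : ∀ n, Ext C (s n) := by
    intro n
    induction n with
    | zero =>
      intro F hF
      obtain ⟨X, hX⟩ := hfin F hF
      exact ListSat.of_forall (X := X) (by simpa [s] using hX)
    | succ n ih =>
      have h : GreedyStep C n (s n) (s (n + 1)) := hstep _ _
      rcases h with ⟨-, h⟩ | ⟨i, -, ⟨h, h'⟩ | ⟨h, h'⟩⟩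
      · rwa [h]
      · rwa [h']
      · rw [h']
        exact ih.cons i h
  have hmono : ∀ m n, m ≤ n → ∀ c ∈ s m, c ∈ s n := by
    intro m n hmn
    induction hmn with
    | refl => exact fun _ h => h
    | @step n _ ih =>
      intro c hc
      have h : GreedyStep C n (s n) (s (n + 1)) := hstep _ _
      rcases h with ⟨-, h⟩ | ⟨i, -, ⟨-, h⟩ | ⟨-, h⟩⟩ <;> rw [h]
      · exact ih c hc
      · exact List.mem_cons_of_mem _ (ih c hc)
      · exact List.mem_cons_of_mem _ (ih c hc)
  have hdec : ∀ i : I, ([], [i]) ∈ s (Encodable.encode i + 1) ∨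
      ([i], []) ∈ s (Encodable.encode i + 1) := by
    intro i
    have h : GreedyStep C (Encodable.encode i) (s _) (s (Encodable.encode i + 1)) := hstep _ _
    rcases h with ⟨h, -⟩ | ⟨j, hj, h⟩
    · simp at h
    · simp only [Encodable.encodek, Option.some.injEq] at hj
      subst hj
      rcases h with ⟨-, h⟩ | ⟨-, h⟩ <;> rw [h] <;> simp
  refine ⟨fun i => ∃ x, Gen (GreedyRule C) x ∧ ([], [i]) ∈ x.2, ?_, ?_⟩
  · have hE : ArP Z (Ext C) := by
      unfold Ext ListSat ClauseSat
      fun_prop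
    have hR : ArP Z (GreedyRule C) := by
      unfold GreedyRule GreedyStep
      fun_prop
    have := ArP.gen hR
    fun_prop
  · intro c hc hneg
    by_contra hpos
    push Not at hpos
    have hn : ∀ l : List I, ∃ n, ∀ i ∈ l, Encodable.encode i + 1 ≤ n := by
      intro l
      induction l with
      | nil => exact ⟨0, by simp⟩
      | cons i l ih =>
        obtain ⟨n, hn⟩ := ih
        refine ⟨max n (Encodable.encode i + 1), fun j hj => ?_⟩
        rcases List.mem_cons.1 hj with rfl | hj
        · exact le_max_right _ _
        · exact (hn j hj).trans (le_max_left _ _)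
    obtain ⟨n, hn⟩ := hn c.2
    have hneg' : ∀ l : List I, (∀ i ∈ l, i ∈ c.1) → ∃ m, ∀ i ∈ l, ([], [i]) ∈ s m := by
      intro l
      induction l with
      | nil => exact fun _ => ⟨0, by simp⟩
      | cons i l ih =>
        intro hl
        obtain ⟨m, hm⟩ := ih fun j hj => hl j (List.mem_cons_of_mem _ hj)
        obtain ⟨⟨k, σ⟩, h1, h2⟩ := hneg i (hl i List.mem_cons_self)
        rw [hgen] at h1
        refine ⟨max m k, fun j hj => ?_⟩
        rcases List.mem_cons.1 hj with rfl | hj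
        · exact hmono _ _ (le_max_right _ _) _ (h1 ▸ h2)
        · exact hmono _ _ (le_max_left _ _) _ (hm j hj)
    obtain ⟨m, hm⟩ := hneg' c.1 fun _ h => h
    obtain ⟨A, hA⟩ := hext (max m n) [c] (by simpa using hc)
    have h1 : ∀ i ∈ c.1, i ∈ A := by
      intro i hi
      obtain ⟨j, hj, hj'⟩ := hA ([], [i])
        (List.mem_append_right _ (hmono _ _ (le_max_left _ _) _ (hm i hi))) (by simp)
      simp only [List.mem_singleton] at hj
      exact hj ▸ hj'
    obtain ⟨i, hi, hiA⟩ := hA c (by simp) h1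
    rcases hdec i with h | h
    · exact hpos i hi (Encodable.encode i + 1, s (Encodable.encode i + 1)) ((hgen _ _).2 rfl) h
    · obtain ⟨j, hj, -⟩ := hA ([i], [])
        (List.mem_append_right _ (hmono _ _ ((hn i hi).trans (le_max_right _ _)) _ h))
        (by simpa using hiA)
      simp at hj

end Compactness

/-! ## Countably saturated Vaughtian pairs -/

section Saturation

open Filter

/-- Countable types with countably many parameters are realized in `M`. -/
def CountablySat (L : FirstOrder.Language) (M : Type) [L.Structure M] : Prop :=
  ∀ (φ : ℕ → L.Formula (ℕ ⊕ Unit)) (v : ℕ → M),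
    (∀ n, ∃ x, ∀ i < n, (φ i).Realize (Sum.elim v fun _ => x)) →
    ∃ x, ∀ i, (φ i).Realize (Sum.elim v fun _ => x)

/-- The ultrapower of `M` by a nonprincipal ultrafilter on `ℕ`. -/
abbrev Ultrapower (M : Type) : Type := (hyperfilter ℕ : Filter ℕ).Product fun _ => M

/-- The class of a sequence. -/
noncomputable def Ultrapower.mk {M : Type} (x : ℕ → M) : Ultrapower M := Quotient.mk'' x

/-- A sequence representing an element of the ultrapower. -/
noncomputable def Ultrapower.out {M : Type} (x : Ultrapower M) : ℕ → M := Quotient.out x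

theorem Ultrapower.mk_out {M : Type} (x : Ultrapower M) : Ultrapower.mk x.out = x :=
  Quotient.out_eq x

theorem Ultrapower.mk_eq {M : Type} {x y : ℕ → M} :
    Ultrapower.mk x = Ultrapower.mk y ↔ ∀ᶠ k in hyperfilter ℕ, x k = y k :=
  Quotient.eq''

variable {L : FirstOrder.Language} {M : Type} [L.Structure M] [Nonempty M]

theorem Ultrapower.realize_mk {β : Type} (φ : L.Formula β) (x : β → ℕ → M) :
    (φ.Realize fun i => Ultrapower.mk (x i)) ↔ ∀ᶠ k in hyperfilter ℕ, φ.Realize fun i => x i k :=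
  Ultraproduct.realize_formula_cast φ x

theorem Ultrapower.realize_out {β : Type} (φ : L.Formula β) (x : β → Ultrapower M) :
    φ.Realize x ↔ ∀ᶠ k in hyperfilter ℕ, φ.Realize fun i => (x i).out k := by
  rw [← Ultrapower.realize_mk]
  simp only [Ultrapower.mk_out]

theorem eventually_ge_hyperfilter (n : ℕ) : ∀ᶠ k in hyperfilter ℕ, n ≤ k :=
  Nat.hyperfilter_le_atTop (eventually_ge_atTop n)

theorem countablySat_ultrapower : CountablySat L (Ultrapower M) := by
  intro φ v h
  have hw : ∀ n, ∀ᶠ k in hyperfilter ℕ, ∃ y : M, ∀ i < n,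
      (φ i).Realize (Sum.elim (fun j => (v j).out k) fun _ => y) := by
    intro n
    obtain ⟨x, hx⟩ := h n
    have : ∀ᶠ k in hyperfilter ℕ, ∀ i ∈ Set.Iio n,
        (φ i).Realize (Sum.elim (fun j => (v j).out k) fun _ => x.out k) := by
      rw [eventually_all_finite (Set.finite_Iio n)]
      intro i hi
      refine ((Ultrapower.realize_out _ _).1 (hx i hi)).mono fun k hk => ?_
      convert hk using 1
      funext j
      cases j <;> rfl
    exact this.mono fun k hk => ⟨x.out k, hk⟩
  let P : ℕ → ℕ → M → Prop := fun k n y => ∀ i < n,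
      (φ i).Realize (Sum.elim (fun j => (v j).out k) fun _ => y)
  have hy : ∀ k, ∃ y : M, ∀ n ≤ k, (∃ y, P k n y) → P k n y := by
    intro k
    have : ∀ m, ∃ y : M, ∀ n ≤ m, (∃ y, P k n y) → P k n y := by
      intro m
      induction m with
      | zero =>
        obtain ⟨y⟩ := ‹Nonempty M›
        exact ⟨y, fun n hn _ i hi => by omega⟩
      | succ m ih =>
        by_cases hm : ∃ y, P k (m + 1) y
        · obtain ⟨y, hy⟩ := hm
          exact ⟨y, fun n hn _ i hi => hy i (by omega)⟩
        · obtain ⟨y, hy⟩ := ih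
          refine ⟨y, fun n hn h => ?_⟩
          rcases Nat.lt_or_ge m n with h' | h'
          · obtain rfl : n = m + 1 := by omega
            exact absurd h hm
          · exact hy n h' h
    exact this k
  choose y hy using hy
  refine ⟨Ultrapower.mk y, fun i => ?_⟩
  have key := Ultrapower.realize_mk (φ i) (Sum.elim (fun j => (v j).out) fun _ : Unit => y)
  have e : (fun j => Ultrapower.mk (Sum.elim (fun j => (v j).out) (fun _ : Unit => y) j)) =
      Sum.elim v fun _ => Ultrapower.mk y := by
    funext j
    cases j
    · exact Ultrapower.mk_out _
    · rfl
  rw [e] at key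
  rw [key]
  filter_upwards [hw (i + 1), eventually_ge_hyperfilter (i + 1)] with k h1 h2
  have := hy k (i + 1) h2 h1 i (Nat.lt_succ_self i)
  convert this using 1
  funext j
  cases j <;> rfl

end Saturation

/-- A pair `ι : P → N` of countably saturated models witnessing a Vaughtian pair for `φ`. -/
structure SaturatedPair {L : FirstOrder.Language} {k : ℕ} (φ : L.Formula (Fin 1 ⊕ Fin k))
    (N P : Type) [L.Structure N] [L.Structure P] where
  satN : CountablySat L N
  satP : CountablySat L P
  ι : P → N
  elem : ∀ {β : Type} (ψ : L.Formula β) (v : β → P), ψ.Realize v ↔ ψ.Realize (ι ∘ v)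
  a : Fin k → P
  sub : ∀ x : N, φ.Realize (Sum.elim (fun _ => x) (ι ∘ a)) → ∃ z, ι z = x
  ne : ∃ b, ∀ z, ι z ≠ b
  inf : {x : N | φ.Realize (Sum.elim (fun _ => x) (ι ∘ a))}.Infinite

theorem HasVaughtianPair.exists_saturatedPair {L : FirstOrder.Language} {T : L.Theory}
    (h : HasVaughtianPair T) : ∃ (k : ℕ) (φ : L.Formula (Fin 1 ⊕ Fin k)) (N P : Type)
      (_ : L.Structure N) (_ : L.Structure P), (∀ ψ ∈ T, N ⊨ ψ) ∧
      Nonempty (SaturatedPair φ N P) := by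
  obtain ⟨N, SN, hN, S, hne, k, φ, a, ha, hsub, hinf⟩ := h
  obtain ⟨b, hb⟩ := (Set.ne_univ_iff_exists_notMem _).1 hne
  obtain ⟨s, hs⟩ := hinf.nonempty
  have : Nonempty N := ⟨b⟩
  have : Nonempty S := ⟨⟨s, hsub hs⟩⟩
  have hφ : ∀ x : Ultrapower N, φ.Realize (Sum.elim (fun _ => x) fun i => Ultrapower.mk fun _ => a i) ↔
      ∀ᶠ k in Filter.hyperfilter ℕ, φ.Realize (Sum.elim (fun _ => x.out k) a) := by
    intro x
    have := Ultrapower.realize_mk φ (Sum.elim (fun _ => x.out) fun i _ => a i)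
    convert! this using 2
    · funext j
      cases j
      · exact (Ultrapower.mk_out _).symm
      · rfl
    · congr! 2
      funext j
      cases j <;> rfl
  have ea : ∀ i, Ultrapower.mk (fun j => ((Ultrapower.mk fun _ =>
      (⟨a i, ha i⟩ : S)).out j : N)) = Ultrapower.mk fun _ => a i := by
    intro i
    rw [Ultrapower.mk_eq]
    have := Ultrapower.mk_eq.1 (Ultrapower.mk_out (Ultrapower.mk fun _ => (⟨a i, ha i⟩ : S)))
    exact this.mono fun j hj => congr_arg Subtype.val hj
  have ea' : (fun z : Ultrapower S => Ultrapower.mk fun j => (z.out j : N)) ∘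
      (fun i => Ultrapower.mk fun _ => (⟨a i, ha i⟩ : S)) = fun i => Ultrapower.mk fun _ => a i :=
    funext ea
  refine ⟨k, φ, Ultrapower N, Ultrapower S, inferInstance, inferInstance, fun ψ hψ => ?_,
    ⟨{ satN := countablySat_ultrapower
       satP := countablySat_ultrapower
       ι := fun z => Ultrapower.mk fun j => (z.out j : N)
       elem := fun ψ v => ?_
       a := fun i => Ultrapower.mk fun _ => ⟨a i, ha i⟩
       sub := fun x hx => ?_
       ne := ⟨Ultrapower.mk fun _ => b, fun z hz => ?_⟩
       inf := ?_ }⟩⟩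
  · rw [Ultraproduct.sentence_realize]
    exact Filter.Eventually.of_forall fun _ => hN ψ hψ
  · rw [Ultrapower.realize_out]
    have := Ultrapower.realize_mk ψ fun i j => ((v i).out j : N)
    refine Iff.trans ?_ this.symm
    refine Filter.eventually_congr (Filter.Eventually.of_forall fun j => ?_)
    exact (S.subtype.map_formula ψ _).symm
  · rw [ea', hφ] at hx
    classical
    refine ⟨Ultrapower.mk fun j => if h : x.out j ∈ S then ⟨x.out j, h⟩ else ⟨s, hsub hs⟩, ?_⟩
    conv_rhs => rw [← Ultrapower.mk_out x]
    rw [Ultrapower.mk_eq]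
    filter_upwards [hx, Ultrapower.mk_eq.1 (Ultrapower.mk_out (Ultrapower.mk
      fun j => if h : x.out j ∈ S then (⟨x.out j, h⟩ : S) else ⟨s, hsub hs⟩))] with j h1 h2
    have : x.out j ∈ S := hsub h1
    simp only [this, dif_pos] at h2
    rw [h2]
  · rw [Ultrapower.mk_eq] at hz
    obtain ⟨j, hj⟩ := hz.exists
    exact hb (hj ▸ (z.out j).2)
  · rw [ea']
    have hinj : Function.Injective (fun x : N => Ultrapower.mk fun _ => x) := by
      intro x y hxy
      obtain ⟨j, hj⟩ := (Ultrapower.mk_eq.1 hxy).exists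
      exact hj
    refine (hinf.image hinj.injOn).mono ?_
    rintro _ ⟨x, hx, rfl⟩
    have := (Ultrapower.realize_mk φ (Sum.elim (fun _ _ => x) fun i _ => a i)).2
      (Filter.Eventually.of_forall fun j => by
        have hx' : φ.Realize (Sum.elim (fun _ => x) a) := hx
        convert hx' using 1
        funext i
        cases i <;> rfl)
    change φ.Realize _
    convert this using 1
    funext i
    cases i <;> rfl

/-! ## Chains of elementary submodels with a fixed definable set -/

section BackAndForth

variable {L : FirstOrder.Language} {A B : Type} [L.Structure A] [L.Structure B]

/-- Two sequences satisfy the same formulas. -/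
def SameType (L : FirstOrder.Language) {A B β : Type} [L.Structure A] [L.Structure B]
    (x : β → A) (y : β → B) : Prop :=
  ∀ ψ : L.Formula β, ψ.Realize x ↔ ψ.Realize y

theorem SameType.symm {β : Type} {x : β → A} {y : β → B} (h : SameType L x y) :
    SameType L y x := fun ψ => (h ψ).symm

theorem SameType.comp {β γ : Type} {x : β → A} {y : β → B} (h : SameType L x y) (σ : γ → β) :
    SameType L (x ∘ σ) (y ∘ σ) := fun ψ => by
  rw [← Formula.realize_relabel, ← Formula.realize_relabel]
  exact h _

theorem SameType.eq_iff {β : Type} {x : β → A} {y : β → B} (h : SameType L x y) (i j : β) :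
    x i = x j ↔ y i = y j := by
  simpa using h ((Term.var i).equal (Term.var j))

theorem SameType.extend [Countable L.Symbols] (hB : CountablySat L B) {x : ℕ → A} {y : ℕ → B}
    (h : SameType L x y) (c : A) :
    ∃ d, SameType L (Sum.elim x fun _ : Unit => c) (Sum.elim y fun _ => d) := by
  have : Nonempty {ψ : L.Formula (ℕ ⊕ Unit) // ψ.Realize (Sum.elim x fun _ => c)} :=
    ⟨⟨⊤, by simp⟩⟩
  obtain ⟨f, hf⟩ := exists_surjective_nat
    {ψ : L.Formula (ℕ ⊕ Unit) // ψ.Realize (Sum.elim x fun _ => c)}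
  obtain ⟨d, hd⟩ := hB (fun i => (f i).1) y fun n => by
    have h1 : ((Formula.iInf fun i : Fin n => (f i).1).iExs Unit).Realize x := by
      rw [Formula.realize_iExs]
      exact ⟨fun _ => c, Formula.realize_iInf.2 fun i => (f i).2⟩
    rw [h, Formula.realize_iExs] at h1
    obtain ⟨d, hd⟩ := h1
    exact ⟨d (), fun i hi => Formula.realize_iInf.1 hd ⟨i, hi⟩⟩
  refine ⟨d, fun ψ => ⟨fun hψ => ?_, fun hψ => ?_⟩⟩
  · obtain ⟨i, hi⟩ := hf ⟨ψ, hψ⟩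
    have := hd i
    rwa [hi] at this
  · by_contra hn
    obtain ⟨i, hi⟩ := hf ⟨ψ.not, Formula.realize_not.2 hn⟩
    have := hd i
    rw [hi] at this
    exact Formula.realize_not.1 this hψ

theorem SameType.update {x : ℕ → A} {y : ℕ → B} {c : A} {d : B}
    (h : SameType L (Sum.elim x fun _ : Unit => c) (Sum.elim y fun _ => d)) (n : ℕ) :
    SameType L (Function.update x n c) (Function.update y n d) := by
  have e : ∀ {C : Type} (z : ℕ → C) (c : C), (Sum.elim z fun _ : Unit => c) ∘
      (fun i => if i = n then Sum.inr () else Sum.inl i) = Function.update z n c := by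
    intro C z c
    funext i
    by_cases hi : i = n
    · subst hi
      simp
    · simp [hi]
  rw [← e, ← e]
  exact h.comp _

/-- Existential formulas over finite tuples from `S` have witnesses in `S`. -/
def TarskiVaught (L : FirstOrder.Language) {M : Type} [L.Structure M] (S : Set M) : Prop :=
  ∀ {β : Type} [Finite β] (ψ : L.Formula (β ⊕ Unit)) (v : β → M), (∀ i, v i ∈ S) →
    (∃ c, ψ.Realize (Sum.elim v fun _ => c)) → ∃ c ∈ S, ψ.Realize (Sum.elim v fun _ => c)

theorem elim_comp_map {β γ C : Type} (x : γ → C) (σ : β → γ) (c : C) :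
    (Sum.elim x fun _ : Unit => c) ∘ Sum.map σ id = Sum.elim (x ∘ σ) fun _ => c := by
  funext j
  cases j <;> rfl

theorem exists_lt_of_finite {β : Type} [Finite β] (σ : β → ℕ) : ∃ n, ∀ j, σ j < n := by
  obtain ⟨n, hn⟩ := (Set.finite_range σ).bddAbove
  exact ⟨n + 1, fun j => Nat.lt_succ_of_le (hn ⟨j, rfl⟩)⟩

/-- The requirement treated at one stage of the back-and-forth construction. -/
def StageReq {k : ℕ} {φ : L.Formula (Fin 1 ⊕ Fin k)} (p : SaturatedPair φ A B)
    (x : ℕ → A) (y : ℕ → B) (c : A) (d : B) : L.Formula (ℕ ⊕ Unit) ⊕ ℕ ⊕ ℕ → Prop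
  | .inl ψ => (∃ c', ψ.Realize (Sum.elim x fun _ => c')) → ψ.Realize (Sum.elim x fun _ => c)
  | .inr (.inl m) => c = p.ι (y m)
  | .inr (.inr m) => φ.Realize (Sum.elim (fun _ => x m) (p.ι ∘ p.a)) → p.ι d = x m

theorem exists_stage [Countable L.Symbols] {k : ℕ} {φ : L.Formula (Fin 1 ⊕ Fin k)}
    (p : SaturatedPair φ A B) {x : ℕ → A} {y : ℕ → B} (h : SameType L x y)
    (t : L.Formula (ℕ ⊕ Unit) ⊕ ℕ ⊕ ℕ) :
    ∃ c d, SameType L (Sum.elim x fun _ : Unit => c) (Sum.elim y fun _ => d) ∧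
      StageReq p x y c d t := by
  rcases t with ψ | m | m
  · by_cases hψ : ∃ c, ψ.Realize (Sum.elim x fun _ => c)
    · obtain ⟨c, hc⟩ := hψ
      obtain ⟨d, hd⟩ := h.extend p.satP c
      exact ⟨c, d, hd, fun _ => hc⟩
    · obtain ⟨d, hd⟩ := h.extend p.satP (x 0)
      exact ⟨_, d, hd, fun h => absurd h hψ⟩
  · obtain ⟨d, hd⟩ := h.extend p.satP (p.ι (y m))
    exact ⟨_, d, hd, rfl⟩
  · by_cases hφ : φ.Realize (Sum.elim (fun _ => x m) (p.ι ∘ p.a))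
    · obtain ⟨d, hd⟩ := p.sub _ hφ
      obtain ⟨c, hc⟩ := h.symm.extend p.satN d
      exact ⟨c, d, hc.symm, fun _ => hd⟩
    · obtain ⟨d, hd⟩ := h.extend p.satP (x 0)
      exact ⟨_, d, hd, fun h => absurd h hφ⟩

/-- A countable model, given by the sequence `X`, with an elementary self-embedding `X i ↦ X (r i)`
whose range contains `φ` but not the whole model. -/
structure ShiftModel {k : ℕ} (φ : L.Formula (Fin 1 ⊕ Fin k)) (A : Type) [L.Structure A] where
  X : ℕ → A
  r : ℕ → ℕ
  tv : TarskiVaught L (Set.range X)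
  elem : ∀ {β : Type} [Finite β] (σ : β → ℕ), SameType L (X ∘ σ) (X ∘ r ∘ σ)
  fix : ∀ i < k, X (r i) = X i
  sub : ∀ m, φ.Realize (Sum.elim (fun _ => X m) fun i : Fin k => X i) → ∃ i, X m = X (r i)
  ne : ∃ b, ∀ i, X (r i) ≠ X b
  inf : {x : A | φ.Realize (Sum.elim (fun _ => x) fun i : Fin k => X i)}.Infinite

theorem SaturatedPair.exists_shiftModel [Countable L.Symbols] {k : ℕ}
    {φ : L.Formula (Fin 1 ⊕ Fin k)} (p : SaturatedPair φ A B) : Nonempty (ShiftModel φ A) := by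
  classical
  obtain ⟨b, hb⟩ := p.ne
  obtain ⟨w, hw⟩ := p.inf.nonempty
  obtain ⟨z₀, -⟩ := p.sub w hw
  let y₀ : ℕ → B := fun i => if h : i < k then p.a ⟨i, h⟩ else z₀
  have h₀ : SameType L (p.ι ∘ y₀) y₀ := fun ψ => (p.elem ψ y₀).symm
  obtain ⟨d₀, hd₀⟩ := h₀.extend p.satP b
  have h₁ := hd₀.update k
  obtain ⟨e, he⟩ := exists_surjective_nat (L.Formula (ℕ ⊕ Unit) ⊕ ℕ ⊕ ℕ)
  let State := {s : (ℕ → A) × (ℕ → B) // SameType L s.1 s.2}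
  have hstep : ∀ (n : ℕ) (s : State), ∃ (s' : State) (c : A) (d : B),
      s'.1.1 = Function.update s.1.1 (n + (k + 1)) c ∧
      s'.1.2 = Function.update s.1.2 (n + (k + 1)) d ∧
      StageReq p s.1.1 s.1.2 c d (e n.unpair.1) := by
    intro n s
    obtain ⟨c, d, h1, h2⟩ := exists_stage p s.2 (e n.unpair.1)
    exact ⟨⟨(_, _), h1.update (n + (k + 1))⟩, c, d, rfl, rfl, h2⟩
  choose step cs ds hx hy hreq using hstep
  let st : ℕ → State := fun n => n.rec ⟨(_, _), h₁⟩ step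
  let X : ℕ → A := fun i => (st (i + 1)).1.1 i
  let Y : ℕ → B := fun i => (st (i + 1)).1.2 i
  have hst : ∀ n, st (n + 1) = step n (st n) := fun n => rfl
  have hmx : ∀ n m, n ≤ m → ∀ i < n + (k + 1), (st m).1.1 i = (st n).1.1 i := by
    intro n m hnm i hi
    induction hnm with
    | refl => rfl
    | @step m hm ih =>
      have hm' : n ≤ m := hm
      rw [hst, hx, Function.update_of_ne (by omega), ih]
  have hmy : ∀ n m, n ≤ m → ∀ i < n + (k + 1), (st m).1.2 i = (st n).1.2 i := by
    intro n m hnm i hi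
    induction hnm with
    | refl => rfl
    | @step m hm ih =>
      have hm' : n ≤ m := hm
      rw [hst, hy, Function.update_of_ne (by omega), ih]
  have hX : ∀ n, ∀ i < n + (k + 1), X i = (st n).1.1 i := by
    intro n i hi
    rcases le_total n (i + 1) with h | h
    · exact hmx _ _ h i hi
    · exact (hmx _ _ h i (by omega)).symm
  have hY : ∀ n, ∀ i < n + (k + 1), Y i = (st n).1.2 i := by
    intro n i hi
    rcases le_total n (i + 1) with h | h
    · exact hmy _ _ h i hi
    · exact (hmy _ _ h i (by omega)).symm
  have hXn : ∀ n, X (n + (k + 1)) = cs n (st n) := by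
    intro n
    rw [hX (n + 1) _ (by omega), hst, hx, Function.update_self]
  have hYn : ∀ n, Y (n + (k + 1)) = ds n (st n) := by
    intro n
    rw [hY (n + 1) _ (by omega), hst, hy, Function.update_self]
  have htask : ∀ (t) (N : ℕ), ∃ n : ℕ, N ≤ n ∧ e n.unpair.1 = t := by
    intro t N
    obtain ⟨i, hi⟩ := he t
    exact ⟨Nat.pair i N, Nat.right_le_pair _ _, by simpa using hi⟩
  have hXσ : ∀ {β : Type} (σ : β → ℕ) (n : ℕ), (∀ j, σ j < n) → X ∘ σ = (st n).1.1 ∘ σ :=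
    fun σ n h => funext fun j => hX n _ (by have := h j; omega)
  have hYσ : ∀ {β : Type} (σ : β → ℕ) (n : ℕ), (∀ j, σ j < n) → Y ∘ σ = (st n).1.2 ∘ σ :=
    fun σ n h => funext fun j => hY n _ (by have := h j; omega)
  have hXY : ∀ {β : Type} [Finite β] (σ : β → ℕ), SameType L (X ∘ σ) (Y ∘ σ) := by
    intro β _ σ
    obtain ⟨n, hn⟩ := exists_lt_of_finite σ
    rw [hXσ σ n hn, hYσ σ n hn]
    exact (st n).2.comp σ
  have hr : ∀ m, ∃ i, X i = p.ι (Y m) := by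
    intro m
    obtain ⟨n, hn, ht⟩ := htask (.inr (.inl m)) m
    refine ⟨n + (k + 1), ?_⟩
    have := hreq n (st n)
    rw [ht] at this
    rw [hXn, hY n m (by omega)]
    exact this
  choose r hr using hr
  have hXa : ∀ i : Fin k, X i = p.ι (p.a i) := by
    intro i
    rw [hX 0 i (by omega)]
    change Function.update (p.ι ∘ y₀) k b i = _
    rw [Function.update_of_ne i.2.ne]
    simp [y₀]
  have hYa : ∀ i : Fin k, Y i = p.a i := by
    intro i
    rw [hY 0 i (by omega)]
    change Function.update y₀ k d₀ i = _
    rw [Function.update_of_ne i.2.ne]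
    simp [y₀]
  have hXa' : (fun i : Fin k => X i) = p.ι ∘ p.a := funext hXa
  refine ⟨⟨X, r, ?_, ?_, ?_, ?_, ⟨k, ?_⟩, ?_⟩⟩
  · intro β _ ψ v hv hc
    choose σ hσ using hv
    obtain rfl : X ∘ σ = v := funext hσ
    obtain ⟨N, hN⟩ := exists_lt_of_finite σ
    obtain ⟨n, hn, ht⟩ := htask (.inl (ψ.relabel (Sum.map σ id))) N
    have hσn : ∀ j, σ j < n := fun j => (hN j).trans_le hn
    have := hreq n (st n)
    rw [ht] at this
    simp only [StageReq, Formula.realize_relabel, elim_comp_map] at this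
    rw [hXσ σ n hσn] at hc ⊢
    exact ⟨_, ⟨n + (k + 1), hXn n⟩, this hc⟩
  · intro β _ σ ψ
    rw [hXY σ ψ, p.elem]
    have : p.ι ∘ Y ∘ σ = X ∘ r ∘ σ := funext fun j => (hr _).symm
    rw [this]
  · intro i hi
    rw [hr, hYa ⟨i, hi⟩, hXa ⟨i, hi⟩]
  · intro m hm
    rw [hXa'] at hm
    obtain ⟨n, hn, ht⟩ := htask (.inr (.inr m)) m
    have := hreq n (st n)
    rw [ht] at this
    refine ⟨n + (k + 1), ?_⟩
    rw [hr, hYn, hX n m (by omega)]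
    refine (this ?_).symm
    rwa [← hX n m (by omega)]
  · intro i
    rw [hr]
    have : X k = b := by
      rw [hX 0 k (by omega)]
      exact Function.update_self ..
    rw [this]
    exact hb _
  · rw [hXa']
    exact p.inf

end BackAndForth

section Chains

variable {L : FirstOrder.Language} {A : Type} [L.Structure A]

/-- A chain of elementary substructures in which `φ` does not grow below the index `n`, and grows
at every step from `n` on. -/
structure FormulaChain {k : ℕ} (φ : L.Formula (Fin 1 ⊕ Fin k)) (A : Type) [L.Structure A]
    (n : ℕ) where
  a : Fin k → A
  S : ℕ → Set A
  mono : Monotone S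
  tv : ∀ i, TarskiVaught L (S i)
  mem_a : ∀ i, a i ∈ S 0
  sub : ∀ x ∈ S n, φ.Realize (Sum.elim (fun _ => x) a) → x ∈ S 0
  gen : ∀ i, ∃ c ∈ S (i + 1), c ∉ S i ∧ (n ≤ i → φ.Realize (Sum.elim (fun _ => c) a))

theorem ElementarySubstructure.tarskiVaught (S : L.ElementarySubstructure A) :
    TarskiVaught L (S : Set A) := by
  intro β _ ψ v hv ⟨c, hc⟩
  have h1 : (ψ.iExs Unit).Realize v := by
    rw [Formula.realize_iExs]
    exact ⟨fun _ => c, hc⟩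
  have h2 : (ψ.iExs Unit).Realize fun i => (⟨v i, hv i⟩ : S) :=
    (S.subtype.map_formula _ _).1 h1
  rw [Formula.realize_iExs] at h2
  obtain ⟨d, hd⟩ := h2
  refine ⟨d (), (d ()).2, ?_⟩
  have h3 := (S.subtype.map_formula _ _).2 hd
  convert h3 using 1
  funext j
  cases j <;> rfl

theorem exists_countable_tarskiVaught [Countable L.Symbols] [Infinite A] {B : Set A}
    (hB : B.Countable) : ∃ S : Set A, B ⊆ S ∧ S.Countable ∧ TarskiVaught L S := by
  obtain ⟨S, hBS, hS⟩ := exists_elementarySubstructure_card_eq L B Cardinal.aleph0.{0} le_rfl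
    (by simpa using hB)
    (by rw [Cardinal.lift_aleph0]; exact Cardinal.lift_le_aleph0.2 (Cardinal.mk_le_aleph0 (α := L.Symbols)))
    (by simp)
  refine ⟨S, hBS, ?_, ElementarySubstructure.tarskiVaught S⟩
  have : Cardinal.mk S = Cardinal.aleph0 := by simpa using hS
  exact Cardinal.le_aleph0_iff_set_countable.1 this.le

theorem CountablySat.exists_notMem (hA : CountablySat L A) {k : ℕ}
    (φ : L.Formula (Fin 1 ⊕ Fin k)) (a : Fin k → A)
    (hinf : {x | φ.Realize (Sum.elim (fun _ => x) a)}.Infinite) {B : Set A} (hB : B.Countable) :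
    ∃ c, c ∉ B ∧ φ.Realize (Sum.elim (fun _ => c) a) := by
  obtain ⟨w, hw⟩ := hinf.nonempty
  obtain ⟨f, hf⟩ := (hB.insert w).exists_eq_range ⟨w, by simp⟩
  let v : ℕ → A := fun i => if h : i < k then a ⟨i, h⟩ else f (i - k)
  have hva : ∀ x : A, (Sum.elim v fun _ : Unit => x) ∘
      (Sum.elim (fun _ : Fin 1 => Sum.inr ()) fun i : Fin k => Sum.inl i.1) =
      Sum.elim (fun _ => x) a := by
    intro x
    funext j
    rcases j with j | j <;> simp [v]
  have hvf : ∀ i, v (i + k) = f i := fun i => by simp [v]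
  let ψ : ℕ → L.Formula (ℕ ⊕ Unit) := fun n => Nat.casesOn n
    (φ.relabel (Sum.elim (fun _ => Sum.inr ()) fun i => Sum.inl i.1))
    (fun i => ((Term.var (Sum.inr ())).equal (Term.var (Sum.inl (i + k)))).not)
  have h0 : ∀ x, (ψ 0).Realize (Sum.elim v fun _ => x) ↔ φ.Realize (Sum.elim (fun _ => x) a) := by
    intro x
    rw [← hva x]
    exact Formula.realize_relabel
  have h1 : ∀ i x, (ψ (i + 1)).Realize (Sum.elim v fun _ => x) ↔ x ≠ f i := by
    intro i x
    rw [← hvf]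
    change (Formula.not _).Realize _ ↔ _
    rw [Formula.realize_not, Formula.realize_equal]
    rfl
  obtain ⟨c, hc⟩ := hA ψ v fun n => by
    obtain ⟨x, hx, hn⟩ := hinf.exists_notMem_finite ((Set.finite_Iio n).image f)
    refine ⟨x, fun i hi => ?_⟩
    rcases i with _ | i
    · exact (h0 x).2 hx
    · exact (h1 i x).2 fun h => hn ⟨i, by simp; omega, h.symm⟩
  refine ⟨c, fun hcB => ?_, (h0 c).1 (hc 0)⟩
  obtain ⟨i, hi⟩ : c ∈ Set.range f := hf ▸ Set.mem_insert_of_mem _ hcB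
  exact (h1 i c).1 (hc (i + 1)) hi.symm

namespace ShiftModel

variable {k : ℕ} {φ : L.Formula (Fin 1 ⊕ Fin k)} (s : ShiftModel φ A)

theorem elem_iterate {β : Type} [Finite β] (σ : β → ℕ) (j : ℕ) :
    SameType L (s.X ∘ σ) (s.X ∘ s.r^[j] ∘ σ) := by
  induction j with
  | zero => exact fun _ => Iff.rfl
  | succ j ih =>
    intro ψ
    rw [ih ψ, s.elem (s.r^[j] ∘ σ) ψ, Function.iterate_succ']
    rfl

theorem tv_iterate (j : ℕ) : TarskiVaught L (Set.range (s.X ∘ s.r^[j])) := by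
  intro β _ ψ v hv ⟨c, hc⟩
  choose σ hσ using hv
  obtain rfl : s.X ∘ s.r^[j] ∘ σ = v := funext hσ
  have h1 : (ψ.iExs Unit).Realize (s.X ∘ s.r^[j] ∘ σ) := by
    rw [Formula.realize_iExs]
    exact ⟨fun _ => c, hc⟩
  rw [← s.elem_iterate, Formula.realize_iExs] at h1
  obtain ⟨d, hd⟩ := h1
  obtain ⟨-, ⟨m, rfl⟩, hm⟩ := s.tv ψ (s.X ∘ σ) (fun i => ⟨_, rfl⟩) ⟨d (), hd⟩
  refine ⟨_, ⟨m, rfl⟩, ?_⟩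
  have := s.elem_iterate (Sum.elim σ fun _ : Unit => m) j ψ
  simp only [Sum.comp_elim] at this
  exact this.1 hm

theorem range_succ (j : ℕ) :
    Set.range (s.X ∘ s.r^[j + 1]) ⊆ Set.range (s.X ∘ s.r^[j]) := by
  rintro _ ⟨i, rfl⟩
  exact ⟨s.r i, rfl⟩

theorem antitone_range : Antitone fun j => Set.range (s.X ∘ s.r^[j]) :=
  antitone_nat_of_succ_le s.range_succ

theorem eq_iterate (i j m : ℕ) : s.X i = s.X m ↔ s.X (s.r^[j] i) = s.X (s.r^[j] m) :=
  (s.elem_iterate (fun b : Bool => if b then i else m) j).eq_iff true false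

theorem fix_iterate (j : ℕ) (i : Fin k) : s.X (s.r^[j] i) = s.X i := by
  induction j with
  | zero => rfl
  | succ j ih =>
    rw [Function.iterate_succ_apply, ← ih]
    exact (s.eq_iterate _ _ _).1 (s.fix i i.2)

theorem realize_iterate (j m : ℕ) :
    φ.Realize (Sum.elim (fun _ => s.X m) fun i : Fin k => s.X i) ↔
      φ.Realize (Sum.elim (fun _ => s.X (s.r^[j] m)) fun i : Fin k => s.X i) := by
  have := s.elem_iterate (Sum.elim (fun _ : Fin 1 => m) fun i : Fin k => i.1) j φ
  simp only [Sum.comp_elim] at this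
  have e : s.X ∘ s.r^[j] ∘ (fun i : Fin k => i.1) = fun i : Fin k => s.X i :=
    funext fun i => s.fix_iterate j i
  rw [e] at this
  exact this

theorem sub_iterate (j : ℕ) {m : ℕ}
    (h : φ.Realize (Sum.elim (fun _ => s.X m) fun i : Fin k => s.X i)) :
    ∃ i, s.X m = s.X (s.r^[j] i) := by
  induction j with
  | zero => exact ⟨m, rfl⟩
  | succ j ih =>
    obtain ⟨i, hi⟩ := ih
    rw [hi, ← s.realize_iterate] at h
    obtain ⟨l, hl⟩ := s.sub i h
    exact ⟨l, hi.trans ((s.eq_iterate _ _ _).1 hl)⟩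

theorem exists_formulaChain [Countable L.Symbols] (s : ShiftModel φ A) (hA : CountablySat L A) (n : ℕ) :
    Nonempty (FormulaChain φ A n) := by
  have : Infinite A := Set.infinite_univ_iff.1 (s.inf.mono (Set.subset_univ _))
  have hstep : ∀ B : {B : Set A // B.Countable ∧ TarskiVaught L B},
      ∃ B' : {B : Set A // B.Countable ∧ TarskiVaught L B}, B.1 ⊆ B'.1 ∧
        ∃ c ∈ B'.1, c ∉ B.1 ∧ φ.Realize (Sum.elim (fun _ => c) fun i : Fin k => s.X i) := by
    intro B
    obtain ⟨c, hc, hφ⟩ := hA.exists_notMem φ _ s.inf B.2.1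
    obtain ⟨B', h1, h2, h3⟩ := exists_countable_tarskiVaught (L := L) (B.2.1.insert c)
    exact ⟨⟨B', h2, h3⟩, fun x hx => h1 (Set.mem_insert_of_mem _ hx), c,
      h1 (Set.mem_insert _ _), hc, hφ⟩
  choose next hsub hnext using hstep
  let U : ℕ → {B : Set A // B.Countable ∧ TarskiVaught L B} := fun i =>
    i.rec ⟨Set.range s.X, Set.countable_range _, s.tv⟩ fun _ => next
  let S : ℕ → Set A := fun i => if i ≤ n then Set.range (s.X ∘ s.r^[n - i]) else (U (i - n)).1
  have hlo : ∀ i ≤ n, S i = Set.range (s.X ∘ s.r^[n - i]) := fun i hi => if_pos hi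
  have hhi : ∀ i, S (n + i) = (U i).1 := by
    intro i
    rcases i with _ | i
    · rw [Nat.add_zero, hlo n le_rfl, Nat.sub_self]
      rfl
    · change (if _ then _ else _) = _
      rw [if_neg (by omega), Nat.add_sub_cancel_left]
  have hmono : Monotone S := by
    refine monotone_nat_of_le_succ fun i => ?_
    rcases lt_or_ge i n with h | h
    · rw [hlo i h.le, hlo (i + 1) h]
      exact s.antitone_range (by omega)
    · obtain ⟨j, rfl⟩ := Nat.exists_eq_add_of_le h
      rw [hhi, Nat.add_assoc, hhi]
      exact hsub _
  refine ⟨⟨fun i => s.X i, S, hmono, fun i => ?_, fun i => ?_, ?_, fun i => ?_⟩⟩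
  · rcases le_total i n with h | h
    · rw [hlo i h]
      exact s.tv_iterate _
    · obtain ⟨j, rfl⟩ := Nat.exists_eq_add_of_le h
      rw [hhi]
      exact (U j).2.2
  · rw [hlo 0 (Nat.zero_le n)]
    exact ⟨i, s.fix_iterate _ i⟩
  · rw [hlo n le_rfl, hlo 0 (Nat.zero_le n), Nat.sub_self]
    rintro _ ⟨m, rfl⟩ hm
    obtain ⟨i, hi⟩ := s.sub_iterate (n - 0) hm
    exact ⟨i, hi.symm⟩
  · rcases lt_or_ge i n with h | h
    · rw [hlo i h.le, hlo (i + 1) h]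
      obtain ⟨b, hb⟩ := s.ne
      refine ⟨_, ⟨b, rfl⟩, ?_, fun h' => by omega⟩
      rintro ⟨l, hl⟩
      rw [show n - i = n - (i + 1) + 1 by omega] at hl
      exact hb l ((s.eq_iterate _ _ _).2 hl)
    · obtain ⟨j, rfl⟩ := Nat.exists_eq_add_of_le h
      rw [hhi, Nat.add_assoc, hhi]
      obtain ⟨c, h1, h2, h3⟩ := hnext (U j)
      exact ⟨c, h1, h2, fun _ => h3⟩

end ShiftModel

theorem GoedelCoding.countable_symbols (g : GoedelCoding L) : Countable L.Symbols := by
  have h1 : Countable (Σ n, L.Functions n) := by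
    have := fun n => (g.encFun_inj n).countable
    infer_instance
  have h2 : Countable (Σ n, L.Relations n) := by
    have := fun n => (g.encRel_inj n).countable
    infer_instance
  exact inferInstanceAs (Countable ((Σ n, L.Functions n) ⊕ Σ n, L.Relations n))

theorem HasVaughtianPair.exists_formulaChain {T : L.Theory} (g : GoedelCoding L)
    (h : HasVaughtianPair T) : ∃ (k : ℕ) (φ : L.Formula (Fin 1 ⊕ Fin k)) (N : Type)
      (_ : L.Structure N), (∀ ψ ∈ T, N ⊨ ψ) ∧ ∀ n, Nonempty (FormulaChain φ N n) := by
  have := g.countable_symbols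
  obtain ⟨k, φ, N, P, SN, SP, hN, ⟨p⟩⟩ := h.exists_saturatedPair
  obtain ⟨s⟩ := p.exists_shiftModel
  exact ⟨k, φ, N, SN, hN, s.exists_formulaChain p.satN⟩

end Chains

/-! ## Codes of terms and formulas -/

section Codes

variable {L : FirstOrder.Language} (g : GoedelCoding L)

/-- The list of naturals whose code is the code of a term. -/
def termList {α : Type} {n : ℕ} (enc : α → ℕ) (t : L.Term (α ⊕ Fin n)) : List ℕ :=
  t.listEncode.map (Sum.elim
    (fun a => Nat.pair 0 (Sum.elim (fun a => Nat.pair 0 (enc a)) (fun i => Nat.pair 1 i.1) a))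
    (fun p => Nat.pair 1 (Nat.pair p.1 (g.encFun p.1 p.2))))

/-- The list of naturals whose code is the code of a formula. -/
def formList {α : Type} {n : ℕ} (enc : α → ℕ) (φ : L.BoundedFormula α n) : List ℕ :=
  φ.listEncode.map (Sum.elim
    (fun p => Nat.pair 0 (Nat.pair p.1 (listCode (termList g enc p.2))))
    (Sum.elim
      (fun q => Nat.pair 1 (Nat.pair q.1 (g.encRel q.1 q.2)))
      (fun m => Nat.pair 2 m)))

theorem formulaCode_eq {α : Type} {n : ℕ} (enc : α → ℕ) (φ : L.BoundedFormula α n) :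
    formulaCode g enc φ = Encodable.encode (formList g enc φ) := rfl

/-- A free variable. -/
def freeTok (i : ℕ) : List ℕ := [Nat.pair 0 (Nat.pair 0 i)]
/-- A bound variable. -/
def boundTok (i : ℕ) : List ℕ := [Nat.pair 0 (Nat.pair 1 i)]
/-- A compound term. -/
def funcTok (f : ℕ) (ts : List (List ℕ)) : List ℕ :=
  Nat.pair 1 (Nat.pair ts.length f) :: ts.flatten
/-- Falsity. -/
def falsumTok (n : ℕ) : List ℕ := [Nat.pair 2 (n + 2)]
/-- An equation. -/
def equalTok (n : ℕ) (s t : List ℕ) : List ℕ :=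
  [Nat.pair 0 (Nat.pair n (Encodable.encode s)), Nat.pair 0 (Nat.pair n (Encodable.encode t))]
/-- An atomic formula. -/
def relTok (n r : ℕ) (ts : List (List ℕ)) : List ℕ :=
  Nat.pair 1 (Nat.pair ts.length r) :: Nat.pair 2 n ::
    ts.map fun t => Nat.pair 0 (Nat.pair n (Encodable.encode t))
/-- An implication. -/
def impTok (l m : List ℕ) : List ℕ := Nat.pair 2 0 :: (l ++ m)
/-- A universal formula. -/
def allTok (l : List ℕ) : List ℕ := Nat.pair 2 1 :: l

section Codes

variable {α : Type} {n : ℕ} (enc : α → ℕ)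

theorem termList_free (a : α) :
    termList g enc (.var (.inl a) : L.Term (α ⊕ Fin n)) = freeTok (enc a) := rfl

theorem termList_bound (i : Fin n) :
    termList g enc (.var (.inr i) : L.Term (α ⊕ Fin n)) = boundTok i := rfl

theorem termList_func {m : ℕ} (f : L.Functions m) (ts : Fin m → L.Term (α ⊕ Fin n)) :
    termList g enc (.func f ts) =
      funcTok (g.encFun m f) (List.ofFn fun i => termList g enc (ts i)) := by
  rw [termList, Term.listEncode, funcTok, List.length_ofFn, List.map_cons, List.map_flatMap,
    List.ofFn_eq_map, ← List.flatMap_def]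
  rfl

theorem formList_falsum :
    formList g enc (.falsum : L.BoundedFormula α n) = falsumTok n := rfl

theorem formList_equal (s t : L.Term (α ⊕ Fin n)) :
    formList g enc (.equal s t) = equalTok n (termList g enc s) (termList g enc t) := rfl

theorem formList_rel {m : ℕ} (r : L.Relations m) (ts : Fin m → L.Term (α ⊕ Fin n)) :
    formList g enc (.rel r ts) =
      relTok n (g.encRel m r) (List.ofFn fun i => termList g enc (ts i)) := by
  rw [formList, BoundedFormula.listEncode, relTok, List.length_ofFn, List.ofFn_eq_map,
    List.map_append, List.map_map, List.map_map]
  rfl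

theorem formList_imp (φ ψ : L.BoundedFormula α n) :
    formList g enc (φ.imp ψ) = impTok (formList g enc φ) (formList g enc ψ) := by
  simp [formList, BoundedFormula.listEncode, impTok]

theorem formList_all (φ : L.BoundedFormula α (n + 1)) :
    formList g enc φ.all = allTok (formList g enc φ) := by
  simp [formList, BoundedFormula.listEncode, allTok]

end Codes

theorem termList_injective {k n : ℕ} :
    Function.Injective (termList g Fin.val : L.Term (Fin k ⊕ Fin n) → List ℕ) := by
  refine (List.map_injective_iff.2 ?_).comp Term.listEncode_injective
  rintro (i | ⟨m, f⟩) (j | ⟨m', f'⟩) h <;> simp only [Sum.elim_inl, Sum.elim_inr,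
    Nat.pair_eq_pair, zero_ne_one, one_ne_zero, false_and, true_and] at h
  · rcases i with i | i <;> rcases j with j | j <;> simp [Nat.pair_eq_pair, Fin.ext_iff] at h ⊢ <;>
      exact h
  · obtain ⟨rfl, h⟩ := h
    rw [g.encFun_inj _ h]

theorem formList_injective {k n : ℕ} :
    Function.Injective (formList g Fin.val : L.BoundedFormula (Fin k) n → List ℕ) := by
  have h : Function.Injective
      fun φ : Σ n, L.BoundedFormula (Fin k) n => formList g Fin.val φ.2 := by
    refine (List.map_injective_iff.2 ?_).comp BoundedFormula.encoding.encode_injective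
    rintro (⟨i, s⟩ | ⟨m, r⟩ | a) (⟨j, t⟩ | ⟨m', r'⟩ | b) h <;>
      simp [Nat.pair_eq_pair] at h
    · obtain ⟨rfl, h⟩ := h
      rw [termList_injective g (Encodable.encode_injective h)]
    · obtain ⟨rfl, h⟩ := h
      rw [g.encRel_inj _ h]
    · rw [h]
  intro φ ψ hφ
  simpa using h (a₁ := ⟨n, φ⟩) (a₂ := ⟨n, ψ⟩) hφ

/-- `f` is the code of a function symbol. -/
def IsFun (m f : ℕ) : Prop := ∃ F : L.Functions m, g.encFun m F = f
/-- `r` is the code of a relation symbol. -/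
def IsRel (m r : ℕ) : Prop := ∃ R : L.Relations m, g.encRel m R = r
/-- `l` is a term with `k` free and `n` bound variables. -/
def IsTerm (k n : ℕ) (l : List ℕ) : Prop :=
  ∃ t : L.Term (Fin k ⊕ Fin n), termList g Fin.val t = l
/-- `l` is a formula with `k` free and `n` bound variables. -/
def IsForm (k n : ℕ) (l : List ℕ) : Prop :=
  ∃ φ : L.BoundedFormula (Fin k) n, formList g Fin.val φ = l

variable {g}

theorem arP_isFun (hL : ArithLang g) (Z : Set ℕ) : ArP Z fun x : ℕ × ℕ => IsFun g x.1 x.2 := by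
  have h : ArP Z (· ∈ symbolCodes g) := ArP.of_reducible (IsArithmetical.arReducible hL Z)
  have h' : ArP Z fun x : ℕ × ℕ => Nat.pair 0 (Nat.pair x.1 x.2) ∈ symbolCodes g := by
    exact h.comp' (f := fun x : ℕ × ℕ => Nat.pair 0 (Nat.pair x.1 x.2)) (by fun_prop)
  refine h'.congr fun x => ?_
  simp only [symbolCodes, Set.mem_ofPred_eq, Nat.pair_eq_pair, IsFun]
  constructor
  · rintro ⟨F, hF⟩
    exact .inl ⟨_, F, trivial, rfl, hF.symm⟩
  · rintro (⟨m, F, -, rfl, hF⟩ | ⟨m, R, h, -⟩)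
    · exact ⟨F, hF.symm⟩
    · cases h

theorem arP_isRel (hL : ArithLang g) (Z : Set ℕ) : ArP Z fun x : ℕ × ℕ => IsRel g x.1 x.2 := by
  have h : ArP Z (· ∈ symbolCodes g) := ArP.of_reducible (IsArithmetical.arReducible hL Z)
  have h' : ArP Z fun x : ℕ × ℕ => Nat.pair 1 (Nat.pair x.1 x.2) ∈ symbolCodes g := by
    exact h.comp' (f := fun x : ℕ × ℕ => Nat.pair 1 (Nat.pair x.1 x.2)) (by fun_prop)
  refine h'.congr fun x => ?_
  simp only [symbolCodes, Set.mem_ofPred_eq, Nat.pair_eq_pair, IsRel]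
  constructor
  · rintro ⟨F, hF⟩
    exact .inr ⟨_, F, trivial, rfl, hF.symm⟩
  · rintro (⟨m, F, h, -⟩ | ⟨m, R, -, rfl, hF⟩)
    · cases h
    · exact ⟨R, hF.symm⟩

section Closure

variable {k n : ℕ}

theorem isTerm_free {i : ℕ} (h : i < k) : IsTerm g k n (freeTok i) :=
  ⟨.var (.inl ⟨i, h⟩), rfl⟩

theorem isTerm_bound {i : ℕ} (h : i < n) : IsTerm g k n (boundTok i) :=
  ⟨.var (.inr ⟨i, h⟩), rfl⟩

theorem IsFun.exists_func {f : ℕ} {ts : List (List ℕ)} (hf : IsFun g ts.length f)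
    (hts : ∀ t ∈ ts, IsTerm g k n t) : ∃ (F : L.Functions ts.length)
      (s : Fin ts.length → L.Term (Fin k ⊕ Fin n)), g.encFun _ F = f ∧
        (∀ i, termList g Fin.val (s i) = ts[i]) ∧
        termList g Fin.val (.func F s) = funcTok f ts := by
  obtain ⟨F, rfl⟩ := hf
  choose s hs using fun i : Fin ts.length => hts (ts.get i) (ts.get_mem i)
  refine ⟨F, s, rfl, hs, ?_⟩
  rw [termList_func]
  congr 1
  rw [funext hs]
  exact List.ofFn_get ts

theorem IsRel.exists_rel {r : ℕ} {ts : List (List ℕ)} (hr : IsRel g ts.length r)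
    (hts : ∀ t ∈ ts, IsTerm g k n t) : ∃ (R : L.Relations ts.length)
      (s : Fin ts.length → L.Term (Fin k ⊕ Fin n)), g.encRel _ R = r ∧
        (∀ i, termList g Fin.val (s i) = ts[i]) ∧
        formList g Fin.val (.rel R s) = relTok n r ts := by
  obtain ⟨R, rfl⟩ := hr
  choose s hs using fun i : Fin ts.length => hts (ts.get i) (ts.get_mem i)
  refine ⟨R, s, rfl, hs, ?_⟩
  rw [formList_rel]
  congr 1
  rw [funext hs]
  exact List.ofFn_get ts

theorem isForm_imp {l l' : List ℕ} (h : IsForm g k n l) (h' : IsForm g k n l') :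
    IsForm g k n (impTok l l') := by
  obtain ⟨φ, rfl⟩ := h
  obtain ⟨ψ, rfl⟩ := h'
  exact ⟨φ.imp ψ, formList_imp ..⟩

theorem isForm_all {l : List ℕ} (h : IsForm g k (n + 1) l) : IsForm g k n (allTok l) := by
  obtain ⟨φ, rfl⟩ := h
  exact ⟨φ.all, formList_all ..⟩

theorem isTerm_termList {α : Type} {enc : α → ℕ} (h : ∀ a, enc a < k)
    (t : L.Term (α ⊕ Fin n)) : IsTerm g k n (termList g enc t) := by
  induction t with
  | var i =>
    rcases i with a | i
    · exact isTerm_free (h a)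
    · exact isTerm_bound i.2
  | @func m f ts ih =>
    obtain ⟨F, s, -, -, h⟩ := IsFun.exists_func (g := g) (k := k) (n := n) (f := g.encFun m f)
      (ts := List.ofFn fun i => termList g enc (ts i))
      (by rw [List.length_ofFn]; exact ⟨f, rfl⟩)
      (by simpa [List.mem_ofFn] using ih)
    exact ⟨_, h.trans (termList_func ..).symm⟩

theorem isForm_formList {α : Type} {enc : α → ℕ} (h : ∀ a, enc a < k)
    (φ : L.BoundedFormula α n) : IsForm g k n (formList g enc φ) := by
  induction φ with
  | falsum => exact ⟨.falsum, rfl⟩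
  | equal s t =>
    obtain ⟨s', hs⟩ := isTerm_termList (g := g) h s
    obtain ⟨t', ht⟩ := isTerm_termList (g := g) h t
    exact ⟨.equal s' t', by rw [formList_equal, formList_equal, hs, ht]⟩
  | @rel n m r ts =>
    obtain ⟨F, s, -, -, h⟩ := IsRel.exists_rel (g := g) (k := k) (n := n) (r := g.encRel m r)
      (ts := List.ofFn fun i => termList g enc (ts i))
      (by rw [List.length_ofFn]; exact ⟨r, rfl⟩)
      (by simpa [List.mem_ofFn] using fun i => isTerm_termList (g := g) h (ts i))
    exact ⟨_, h.trans (formList_rel ..).symm⟩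
  | imp φ ψ ih ih' =>
    rw [formList_imp]
    exact isForm_imp ih ih'
  | all φ ih =>
    rw [formList_all]
    exact isForm_all ih

end Closure

/-- Formation rules of terms. -/
def TermRule (g : GoedelCoding L) : List (ℕ × ℕ × List ℕ) × (ℕ × ℕ × List ℕ) → Prop := fun c =>
  (∃ i, i < c.2.1 ∧ c.2.2.2 = freeTok i) ∨ (∃ i, i < c.2.2.1 ∧ c.2.2.2 = boundTok i) ∨
  ∃ f, IsFun g c.1.length f ∧ (∀ p, p ∈ c.1 → p.1 = c.2.1 ∧ p.2.1 = c.2.2.1) ∧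
    c.2.2.2 = funcTok f (c.1.map fun p => p.2.2)

theorem gen_termRule {k n : ℕ} {l : List ℕ} : Gen (TermRule g) (k, n, l) ↔ IsTerm g k n l := by
  constructor
  · suffices ∀ x, Gen (TermRule g) x → IsTerm g x.1 x.2.1 x.2.2 from this _
    intro x hx
    induction hx with
    | mk ps y hR _ ih =>
      obtain ⟨k, n, l⟩ := y
      dsimp only [TermRule] at hR
      rcases hR with ⟨i, hi, rfl⟩ | ⟨i, hi, rfl⟩ | ⟨f, hf, hp, rfl⟩
      · exact isTerm_free hi
      · exact isTerm_bound hi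
      · obtain ⟨F, s, -, -, h⟩ := IsFun.exists_func (g := g) (k := k) (n := n) (f := f)
          (ts := ps.map fun p => p.2.2) (by rwa [List.length_map]) (by
            simp only [List.mem_map, forall_exists_index, and_imp, forall_apply_eq_imp_iff₂]
            intro p hps
            have := ih p hps
            rwa [(hp p hps).1, (hp p hps).2] at this)
        exact ⟨_, h⟩
  · rintro ⟨t, rfl⟩
    induction t with
    | var i =>
      rcases i with i | i
      · exact .mk [] _ (.inl ⟨i, i.2, rfl⟩) (by simp)
      · exact .mk [] _ (.inr (.inl ⟨i, i.2, rfl⟩)) (by simp)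
    | @func m f ts ih =>
      refine .mk (List.ofFn fun i => (k, n, termList g Fin.val (ts i))) _
        (.inr (.inr ⟨g.encFun m f, ?_, ?_, ?_⟩)) ?_
      · rw [List.length_ofFn]
        exact ⟨f, rfl⟩
      · simp [List.mem_ofFn]
      · rw [termList_func, List.map_ofFn]
        rfl
      · simpa [List.mem_ofFn] using ih

theorem primrec_freeTok {α : Type} [Primcodable α] {f : α → ℕ} (hf : Primrec f) :
    Primrec fun x => freeTok (f x) := by
  unfold freeTok
  fun_prop

theorem primrec_boundTok {α : Type} [Primcodable α] {f : α → ℕ} (hf : Primrec f) :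
    Primrec fun x => boundTok (f x) := by
  unfold boundTok
  fun_prop

theorem primrec_funcTok {α : Type} [Primcodable α] {f : α → ℕ} {h : α → List (List ℕ)}
    (hf : Primrec f) (hh : Primrec h) : Primrec fun x => funcTok (f x) (h x) := by
  unfold funcTok
  fun_prop

theorem primrec_falsumTok {α : Type} [Primcodable α] {f : α → ℕ} (hf : Primrec f) :
    Primrec fun x => falsumTok (f x) := by
  unfold falsumTok
  fun_prop

theorem primrec_equalTok {α : Type} [Primcodable α] {f : α → ℕ} {s t : α → List ℕ}
    (hf : Primrec f) (hs : Primrec s) (ht : Primrec t) :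
    Primrec fun x => equalTok (f x) (s x) (t x) := by
  unfold equalTok
  fun_prop

theorem primrec_relTok {α : Type} [Primcodable α] {f r : α → ℕ} {h : α → List (List ℕ)}
    (hf : Primrec f) (hr : Primrec r) (hh : Primrec h) :
    Primrec fun x => relTok (f x) (r x) (h x) := by
  unfold relTok
  fun_prop

theorem primrec_impTok {α : Type} [Primcodable α] {s t : α → List ℕ}
    (hs : Primrec s) (ht : Primrec t) : Primrec fun x => impTok (s x) (t x) := by
  unfold impTok
  fun_prop

theorem primrec_allTok {α : Type} [Primcodable α] {s : α → List ℕ}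
    (hs : Primrec s) : Primrec fun x => allTok (s x) := by
  unfold allTok
  fun_prop

attribute [fun_prop] primrec_freeTok primrec_boundTok primrec_funcTok primrec_falsumTok
  primrec_equalTok primrec_relTok primrec_impTok primrec_allTok

theorem arP_isTerm (hL : ArithLang g) (Z : Set ℕ) :
    ArP Z fun x : ℕ × ℕ × List ℕ => IsTerm g x.1 x.2.1 x.2.2 := by
  have hF := arP_isFun hL Z
  have hR : ArP Z (TermRule g) := by
    unfold TermRule
    have h1 : ArP Z fun x : (List (ℕ × ℕ × List ℕ) × (ℕ × ℕ × List ℕ)) × ℕ =>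
        IsFun g x.1.1.length x.2 :=
      hF.comp' (f := fun x : (List (ℕ × ℕ × List ℕ) × (ℕ × ℕ × List ℕ)) × ℕ =>
        (x.1.1.length, x.2)) (by fun_prop)
    fun_prop
  exact hR.gen.congr fun x => gen_termRule.symm

/-- Formation rules of formulas. -/
def FormRule (g : GoedelCoding L) : List (ℕ × ℕ × List ℕ) × (ℕ × ℕ × List ℕ) → Prop := fun c =>
  c.2.2.2 = falsumTok c.2.2.1 ∨
  (∃ s t, IsTerm g c.2.1 c.2.2.1 s ∧ IsTerm g c.2.1 c.2.2.1 t ∧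
    c.2.2.2 = equalTok c.2.2.1 s t) ∨
  (∃ (r : ℕ) (ts : List (List ℕ)), IsRel g ts.length r ∧
    (∀ t, t ∈ ts → IsTerm g c.2.1 c.2.2.1 t) ∧ c.2.2.2 = relTok c.2.2.1 r ts) ∨
  (∃ l l', c.1 = [(c.2.1, c.2.2.1, l), (c.2.1, c.2.2.1, l')] ∧ c.2.2.2 = impTok l l') ∨
  ∃ l, c.1 = [(c.2.1, c.2.2.1 + 1, l)] ∧ c.2.2.2 = allTok l

theorem gen_formRule {k n : ℕ} {l : List ℕ} : Gen (FormRule g) (k, n, l) ↔ IsForm g k n l := by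
  constructor
  · suffices ∀ x, Gen (FormRule g) x → IsForm g x.1 x.2.1 x.2.2 from this _
    intro x hx
    induction hx with
    | mk ps y hR _ ih =>
      obtain ⟨k, n, l⟩ := y
      dsimp only [FormRule] at hR
      rcases hR with rfl | ⟨s, t, ⟨s, rfl⟩, ⟨t, rfl⟩, rfl⟩ | ⟨r, ts, hr, hts, rfl⟩ |
        ⟨l, l', rfl, rfl⟩ | ⟨l, rfl, rfl⟩
      · exact ⟨.falsum, rfl⟩
      · exact ⟨.equal s t, rfl⟩
      · obtain ⟨R, s, -, -, h⟩ := hr.exists_rel hts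
        exact ⟨_, h⟩
      · exact isForm_imp (ih (k, n, l) (by simp)) (ih (k, n, l') (by simp))
      · exact isForm_all (ih (k, n + 1, l) (by simp))
  · rintro ⟨φ, rfl⟩
    induction φ with
    | falsum => exact .mk [] _ (.inl rfl) (by simp)
    | equal s t => exact .mk [] _ (.inr (.inl ⟨_, _, ⟨s, rfl⟩, ⟨t, rfl⟩, rfl⟩)) (by simp)
    | @rel n m r ts =>
      refine .mk [] _ (.inr (.inr (.inl ⟨g.encRel m r,
        List.ofFn fun i => termList g Fin.val (ts i), ?_, ?_, formList_rel ..⟩))) (by simp)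
      · rw [List.length_ofFn]
        exact ⟨r, rfl⟩
      · simp only [List.mem_ofFn]
        rintro _ ⟨i, rfl⟩
        exact ⟨_, rfl⟩
    | @imp n φ ψ ih ih' =>
      refine .mk [(k, n, formList g Fin.val φ), (k, n, formList g Fin.val ψ)] _ (.inr (.inr (.inr (.inl ⟨_, _, rfl, formList_imp ..⟩)))) ?_
      simp [ih, ih']
    | @all n φ ih =>
      refine .mk [(k, n + 1, formList g Fin.val φ)] _ (.inr (.inr (.inr (.inr ⟨_, rfl, formList_all ..⟩)))) ?_
      simp [ih]

theorem arP_isForm (hL : ArithLang g) (Z : Set ℕ) :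
    ArP Z fun x : ℕ × ℕ × List ℕ => IsForm g x.1 x.2.1 x.2.2 := by
  have hT := arP_isTerm hL Z
  have hRel := arP_isRel hL Z
  have hR : ArP Z (FormRule g) := by
    unfold FormRule
    fun_prop
  exact hR.gen.congr fun x => gen_formRule.symm

end Codes

/-! ## The clause system -/

section ClauseSystem

/-- Junk names; the first one names an element of the bottom model. -/
def nJunk (m : ℕ) : ℕ := Nat.pair 0 m
/-- Names of parameters. -/
def nPar (j : ℕ) : ℕ := Nat.pair 1 j
/-- Names of generators. -/
def nGen (b : Bool) (F : List ℕ) : ℕ := Nat.pair 2 (Encodable.encode (b, F))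
/-- Names of counterexamples to universal formulas. -/
def nWit (l a xs : List ℕ) : ℕ := Nat.pair 3 (Encodable.encode (l, a, xs))
/-- Names of values of terms. -/
def nVal (t a xs : List ℕ) : ℕ := Nat.pair 4 (Encodable.encode (t, a, xs))
/-- Names of values of functions. -/
def nFun (f : ℕ) (ys : List ℕ) : ℕ := Nat.pair 5 (Encodable.encode (f, ys))

/-- Propositional atoms: truth of formulas, equality, atomic relations, membership in submodels. -/
abbrev Idx : Type :=
  (List ℕ × List ℕ × List ℕ) ⊕ (ℕ × ℕ) ⊕ (ℕ × List ℕ) ⊕ (Option (Bool × List ℕ) × ℕ)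

/-- The formula `l` holds at the free assignment `a` and the bound assignment `xs`. -/
def iV (l a xs : List ℕ) : Idx := .inl (l, a, xs)
/-- Two names denote the same element. -/
def iEq (x y : ℕ) : Idx := .inr (.inl (x, y))
/-- The relation `r` holds at `ys`. -/
def iRel (r : ℕ) (ys : List ℕ) : Idx := .inr (.inr (.inl (r, ys)))
/-- The element `x` lies in the submodel `j`. -/
def iP (j : Option (Bool × List ℕ)) (x : ℕ) : Idx := .inr (.inr (.inr (j, x)))

/-- The lexicographic order on sets of naturals. -/
def LexLt (P Q : ℕ → Prop) : Prop := ∃ i, ¬ P i ∧ Q i ∧ ∀ m, m < i → (P m ↔ Q m)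

section Primrec

variable {α : Type} [Primcodable α]

@[fun_prop] theorem primrec_nJunk {f : α → ℕ} (hf : Primrec f) :
    Primrec fun x => nJunk (f x) := by
  unfold nJunk
  fun_prop

@[fun_prop] theorem primrec_nPar {f : α → ℕ} (hf : Primrec f) :
    Primrec fun x => nPar (f x) := by
  unfold nPar
  fun_prop

@[fun_prop] theorem primrec_nGen {b : α → Bool} {f : α → List ℕ} (hb : Primrec b)
    (hf : Primrec f) : Primrec fun x => nGen (b x) (f x) := by
  unfold nGen
  fun_prop

@[fun_prop] theorem primrec_nWit {l a s : α → List ℕ} (hl : Primrec l) (ha : Primrec a)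
    (hs : Primrec s) : Primrec fun x => nWit (l x) (a x) (s x) := by
  unfold nWit
  fun_prop

@[fun_prop] theorem primrec_nVal {l a s : α → List ℕ} (hl : Primrec l) (ha : Primrec a)
    (hs : Primrec s) : Primrec fun x => nVal (l x) (a x) (s x) := by
  unfold nVal
  fun_prop

@[fun_prop] theorem primrec_nFun {f : α → ℕ} {s : α → List ℕ} (hf : Primrec f)
    (hs : Primrec s) : Primrec fun x => nFun (f x) (s x) := by
  unfold nFun
  fun_prop

@[fun_prop] theorem primrec_iV {l a s : α → List ℕ} (hl : Primrec l) (ha : Primrec a)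
    (hs : Primrec s) : Primrec fun x => iV (l x) (a x) (s x) := by
  unfold iV
  fun_prop

@[fun_prop] theorem primrec_iEq {f h : α → ℕ} (hf : Primrec f) (hh : Primrec h) :
    Primrec fun x => iEq (f x) (h x) := by
  unfold iEq
  fun_prop

@[fun_prop] theorem primrec_iRel {f : α → ℕ} {s : α → List ℕ} (hf : Primrec f)
    (hs : Primrec s) : Primrec fun x => iRel (f x) (s x) := by
  unfold iRel
  fun_prop

@[fun_prop] theorem primrec_iP {j : α → Option (Bool × List ℕ)} {f : α → ℕ} (hj : Primrec j)
    (hf : Primrec f) : Primrec fun x => iP (j x) (f x) := by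
  unfold iP
  fun_prop

end Primrec

/-- Clauses. -/
abbrev Clause : Type := List Idx × List Idx

/-- Equality clauses. -/
def EqClause (c : Clause) : Prop :=
  (∃ x, c = ([], [iEq x x])) ∨ (∃ x y, c = ([iEq x y], [iEq y x])) ∨
  (∃ x y z, c = ([iEq x y, iEq y z], [iEq x z])) ∨ ∃ m, c = ([], [iEq (nJunk m) (nJunk 0)])

variable {L : FirstOrder.Language} (g : GoedelCoding L) (T : L.Theory)

/-- Clauses evaluating terms. -/
def TermClause (c : Clause) : Prop :=
  (∃ (a xs : List ℕ) (i x : ℕ), a[i]? = some x ∧ c = ([], [iEq x (nVal (freeTok i) a xs)])) ∨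
  (∃ (a xs : List ℕ) (i x : ℕ), xs[i]? = some x ∧ c = ([], [iEq x (nVal (boundTok i) a xs)])) ∨
  ∃ (a xs : List ℕ) (f : ℕ) (zs : List (List ℕ × ℕ)), IsFun g zs.length f ∧
    (∀ z, z ∈ zs → IsTerm g a.length xs.length z.1) ∧
    c = (zs.map fun z => iEq z.2 (nVal z.1 a xs),
      [iEq (nFun f (zs.map fun z => z.2)) (nVal (funcTok f (zs.map fun z => z.1)) a xs)])

/-- Clauses for atomic formulas. -/
def AtomClause (c : Clause) : Prop :=
  (∃ a xs : List ℕ, c = ([iV (falsumTok xs.length) a xs], [])) ∨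
  (∃ a xs s t : List ℕ, IsTerm g a.length xs.length s ∧ IsTerm g a.length xs.length t ∧
    c = ([iV (equalTok xs.length s t) a xs], [iEq (nVal s a xs) (nVal t a xs)])) ∨
  (∃ a xs s t : List ℕ, IsTerm g a.length xs.length s ∧ IsTerm g a.length xs.length t ∧
    c = ([iEq (nVal s a xs) (nVal t a xs)], [iV (equalTok xs.length s t) a xs])) ∨
  (∃ (a xs : List ℕ) (r : ℕ) (zs : List (List ℕ × ℕ)), IsRel g zs.length r ∧
    (∀ z, z ∈ zs → IsTerm g a.length xs.length z.1) ∧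
    c = ((iV (relTok xs.length r (zs.map fun z => z.1)) a xs) ::
        zs.map (fun z => iEq z.2 (nVal z.1 a xs)), [iRel r (zs.map fun z => z.2)])) ∨
  ∃ (a xs : List ℕ) (r : ℕ) (zs : List (List ℕ × ℕ)), IsRel g zs.length r ∧
    (∀ z, z ∈ zs → IsTerm g a.length xs.length z.1) ∧
    c = ((iRel r (zs.map fun z => z.2)) :: zs.map (fun z => iEq z.2 (nVal z.1 a xs)),
      [iV (relTok xs.length r (zs.map fun z => z.1)) a xs])

/-- Clauses for compound formulas. -/
def CompoundClause (c : Clause) : Prop :=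
  (∃ a xs l l' : List ℕ, IsForm g a.length xs.length l ∧ IsForm g a.length xs.length l' ∧
    (c = ([iV (impTok l l') a xs, iV l a xs], [iV l' a xs]) ∨
      c = ([], [iV (impTok l l') a xs, iV l a xs]) ∨
      c = ([iV l' a xs], [iV (impTok l l') a xs]))) ∨
  (∃ a xs l : List ℕ, IsForm g a.length (xs.length + 1) l ∧ ∃ y : ℕ,
    (c = ([iV (allTok l) a xs], [iV l a (xs ++ [y])]) ∨
      c = ([iEq y (nWit l a xs), iV l a (xs ++ [y])], [iV (allTok l) a xs]))) ∨
  ∃ l : List ℕ, Encodable.encode l ∈ theoryCode g T ∧ c = ([], [iV l [] [] ])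

/-- Clauses for the chain of submodels. -/
def ChainClause (c : Clause) : Prop :=
  (∃ j x y, c = ([iEq x y, iP j x], [iP j y])) ∨
  (∃ j, c = ([], [iP j (nJunk 0)])) ∨
  (∃ j i, c = ([], [iP j (nPar i)])) ∨
  (∃ j f ys, IsFun g ys.length f ∧ c = (ys.map fun y => iP j y, [iP j (nFun f ys)])) ∨
  (∃ j l a xs, c = ((a.map fun y => iP j y) ++ xs.map fun y => iP j y, [iP j (nWit l a xs)])) ∨
  (∃ j x, c = ([iP none x], [iP j x])) ∨
  (∃ b F G x, ¬ LexLt (· ∈ G) (· ∈ F) ∧ c = ([iP (some (b, F)) x], [iP (some (b, G)) x])) ∨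
  (∃ b F G, LexLt (· ∈ F) (· ∈ G) ∧ c = ([], [iP (some (b, G)) (nGen b F)])) ∨
  ∃ b F, c = ([iP (some (b, F)) (nGen b F)], [])

/-- Clauses for the formula with code list `l` in `k` parameters: it does not grow in the submodels
`(false, F)`, and it contains all generators `(true, F)`. -/
def GrowthClause (k : ℕ) (l : List ℕ) (c : Clause) : Prop :=
  ∃ (x : ℕ) (F : List ℕ) (zs : List (ℕ × ℕ)), (zs.map fun z => z.2) = (List.range k).map nPar ∧
    (c = (iV l (x :: zs.map fun z => z.1) [] :: iP (some (false, F)) x ::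
        zs.map (fun z => iEq z.1 z.2), [iP none x]) ∨
      c = (iEq x (nGen true F) :: zs.map (fun z => iEq z.1 z.2),
        [iV l (x :: zs.map fun z => z.1) [] ]))

/-- The whole clause system. -/
def SysClause (k : ℕ) (l : List ℕ) (c : Clause) : Prop :=
  EqClause c ∨ TermClause g c ∨ AtomClause g c ∨ CompoundClause g T c ∨ ChainClause g c ∨
    GrowthClause k l c

variable {g T}

theorem arP_eqClause (Z : Set ℕ) : ArP Z EqClause := by
  unfold EqClause
  fun_prop

theorem arP_termClause (hL : ArithLang g) (Z : Set ℕ) : ArP Z (TermClause g) := by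
  have h1 := arP_isFun hL Z
  have h2 := arP_isTerm hL Z
  unfold TermClause
  fun_prop

theorem arP_atomClause (hL : ArithLang g) (Z : Set ℕ) : ArP Z (AtomClause g) := by
  have h1 := arP_isRel hL Z
  have h2 := arP_isTerm hL Z
  unfold AtomClause
  fun_prop

theorem arP_compoundClause (hL : ArithLang g) (hT : ArithTheory g T) (Z : Set ℕ) :
    ArP Z (CompoundClause g T) := by
  have h1 := arP_isForm hL Z
  have h2 : ArP Z (· ∈ theoryCode g T) := ArP.of_reducible (IsArithmetical.arReducible hT Z)
  unfold CompoundClause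
  fun_prop

theorem arP_chainClause (hL : ArithLang g) (Z : Set ℕ) : ArP Z (ChainClause g) := by
  have h1 := arP_isFun hL Z
  unfold ChainClause LexLt
  fun_prop

theorem arP_growthClause (k : ℕ) (l : List ℕ) (Z : Set ℕ) : ArP Z (GrowthClause k l) := by
  unfold GrowthClause
  fun_prop

theorem arP_sysClause (hL : ArithLang g) (hT : ArithTheory g T) (k : ℕ) (l : List ℕ)
    (Z : Set ℕ) : ArP Z (SysClause g T k l) := by
  have h1 := arP_eqClause Z
  have h2 := arP_termClause hL Z
  have h3 := arP_atomClause hL Z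
  have h4 := arP_compoundClause hL hT Z
  have h5 := arP_chainClause hL Z
  have h6 := arP_growthClause k l Z
  unfold SysClause
  fun_prop

end ClauseSystem

/-! ## Finite sets of clauses are satisfiable -/

section Satisfiability

theorem LexLt.trans {P Q R : ℕ → Prop} (h : LexLt P Q) (h' : LexLt Q R) : LexLt P R := by
  obtain ⟨i, h1, h2, h3⟩ := h
  obtain ⟨j, h4, h5, h6⟩ := h'
  rcases lt_trichotomy i j with hij | rfl | hij
  · exact ⟨i, h1, (h6 i hij).1 h2, fun m hm => (h3 m hm).trans (h6 m (hm.trans hij))⟩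
  · exact absurd h2 h4
  · exact ⟨j, fun h => h4 ((h3 j hij).1 h), h5, fun m hm => (h3 m (hm.trans hij)).trans (h6 m hm)⟩

theorem LexLt.irrefl (P : ℕ → Prop) : ¬ LexLt P P := fun ⟨_, h, h', _⟩ => h h'

theorem LexLt.trichotomy (P Q : ℕ → Prop) : LexLt P Q ∨ LexLt Q P ∨ ∀ m, P m ↔ Q m := by
  classical
  by_cases h : ∀ m, P m ↔ Q m
  · exact .inr (.inr h)
  · push Not at h
    have h1 := Nat.find_spec h
    have h2 : ∀ m, m < Nat.find h → (P m ↔ Q m) := by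
      intro m hm
      have := Nat.find_min h hm
      tauto
    by_cases hP : P (Nat.find h)
    · exact .inr (.inl ⟨_, by tauto, hP, fun m hm => (h2 m hm).symm⟩)
    · exact .inl ⟨_, hP, by tauto, h2⟩

theorem LexLt.of_not_lt_of_lt {P Q R : ℕ → Prop} (h : ¬ LexLt Q P) (h' : LexLt R P) :
    LexLt R Q := by
  rcases LexLt.trichotomy P Q with h1 | h1 | h1
  · exact h'.trans h1
  · exact absurd h1 h
  · rwa [← funext fun m => propext (h1 m)]

open Classical in
/-- The number of members of `S` below `F`. -/
noncomputable def lexRank (S : Finset (List ℕ)) (F : List ℕ) : ℕ :=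
  (S.filter fun G => LexLt (· ∈ G) (· ∈ F)).card

theorem lexRank_le_card (S : Finset (List ℕ)) (F : List ℕ) : lexRank S F ≤ S.card := by
  classical
  exact Finset.card_filter_le _ _

theorem lexRank_mono (S : Finset (List ℕ)) {F G : List ℕ} (h : ¬ LexLt (· ∈ G) (· ∈ F)) :
    lexRank S F ≤ lexRank S G := by
  classical
  unfold lexRank
  refine Finset.card_le_card fun H hH => ?_
  simp only [Finset.mem_filter] at hH ⊢
  exact ⟨hH.1, LexLt.of_not_lt_of_lt h hH.2⟩

theorem lexRank_lt {S : Finset (List ℕ)} {F G : List ℕ} (hF : F ∈ S)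
    (h : LexLt (· ∈ F) (· ∈ G)) : lexRank S F < lexRank S G := by
  classical
  unfold lexRank
  refine Finset.card_lt_card ⟨fun H hH => ?_, fun hsub => ?_⟩
  · simp only [Finset.mem_filter] at hH ⊢
    exact ⟨hH.1, hH.2.trans h⟩
  · have := hsub (Finset.mem_filter.2 ⟨hF, h⟩)
    exact LexLt.irrefl _ (Finset.mem_filter.1 this).2

/-- The position in the chain of the submodel `j`. -/
noncomputable def chainLevel (S : Finset (List ℕ)) : Option (Bool × List ℕ) → ℕ
  | none => 0
  | some (b, F) => (if b then S.card else 0) + lexRank S F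

variable {L : FirstOrder.Language} {N : Type} [L.Structure N]

theorem TarskiVaught.nonempty {S : Set N} (h : TarskiVaught L S) [Nonempty N] : S.Nonempty := by
  obtain ⟨c, hc, -⟩ := h (β := Empty) ⊤ (fun i => i.elim) (fun i => i.elim)
    ⟨Classical.arbitrary N, by simp⟩
  exact ⟨c, hc⟩

theorem TarskiVaught.funMap_mem {S : Set N} (h : TarskiVaught L S) {m : ℕ} (F : L.Functions m)
    (v : Fin m → N) (hv : ∀ i, v i ∈ S) : Structure.funMap F v ∈ S := by
  obtain ⟨c, hc, hc'⟩ := h ((Term.var (.inr ())).equal (Term.func F fun i => Term.var (.inl i))) v hv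
    ⟨Structure.funMap F v, by simp [Formula.realize_equal, Term.realize_func]⟩
  simp [Formula.realize_equal, Term.realize_func] at hc'
  rwa [← hc']

theorem TarskiVaught.exists_mem {S : Set N} (h : TarskiVaught L S) {k m : ℕ}
    (ψ : L.BoundedFormula (Fin k) (m + 1)) (ρ : Fin k → N) (σ : Fin m → N) (hρ : ∀ i, ρ i ∈ S)
    (hσ : ∀ i, σ i ∈ S) (hc : ∃ c, ψ.Realize ρ (Fin.snoc σ c)) :
    ∃ c ∈ S, ψ.Realize ρ (Fin.snoc σ c) := by
  have key : ∀ c, (ψ.toFormula.relabel (Sum.elim (fun a => Sum.inl (Sum.inl a))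
      (Fin.lastCases (Sum.inr ()) fun i => Sum.inl (Sum.inr i)) :
        Fin k ⊕ Fin (m + 1) → (Fin k ⊕ Fin m) ⊕ Unit)).Realize
      (Sum.elim (Sum.elim ρ σ) fun _ => c) ↔ ψ.Realize ρ (Fin.snoc σ c) := by
    intro c
    rw [Formula.realize_relabel, BoundedFormula.realize_toFormula]
    have e : ((Sum.elim (Sum.elim ρ σ) fun _ : Unit => c) ∘
      (Sum.elim (fun a => Sum.inl (Sum.inl a))
      (Fin.lastCases (Sum.inr ()) fun i => Sum.inl (Sum.inr i)) :
        Fin k ⊕ Fin (m + 1) → (Fin k ⊕ Fin m) ⊕ Unit)) ∘ Sum.inr = Fin.snoc σ c := by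
      funext i
      induction i using Fin.lastCases <;> simp
    rw [e]
    rfl
  simp only [← key] at hc ⊢
  exact h _ _ (by rintro (i | i) <;> simp [hρ, hσ]) hc

variable (g : GoedelCoding L)

/-- The truth value of a coded formula at named assignments. -/
def FormVal (e : ℕ → N) (l a xs : List ℕ) : Prop :=
  ∃ (k m : ℕ) (φ : L.BoundedFormula (Fin k) m) (ρ : Fin k → N) (σ : Fin m → N),
    formList g Fin.val φ = l ∧ List.ofFn ρ = a.map e ∧ List.ofFn σ = xs.map e ∧ φ.Realize ρ σ

theorem ofFn_eq_ofFn {β : Type} {k k' : ℕ} {ρ : Fin k → β} {ρ' : Fin k' → β}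
    (h : List.ofFn ρ = List.ofFn ρ') : ∃ h : k = k', ρ' = ρ ∘ Fin.cast h.symm := by
  have := congrArg List.length h
  simp only [List.length_ofFn] at this
  subst this
  exact ⟨rfl, (List.ofFn_injective h).symm⟩

variable {g} in
theorem formVal_iff {e : ℕ → N} {l a xs : List ℕ} {k m : ℕ} {φ : L.BoundedFormula (Fin k) m}
    {ρ : Fin k → N} {σ : Fin m → N} (hl : formList g Fin.val φ = l)
    (ha : List.ofFn ρ = a.map e) (hx : List.ofFn σ = xs.map e) :
    FormVal g e l a xs ↔ φ.Realize ρ σ := by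
  refine ⟨?_, fun h => ⟨k, m, φ, ρ, σ, hl, ha, hx, h⟩⟩
  rintro ⟨k', m', φ', ρ', σ', hl', ha', hx', h⟩
  obtain ⟨rfl, rfl⟩ := ofFn_eq_ofFn (ha.trans ha'.symm)
  obtain ⟨rfl, rfl⟩ := ofFn_eq_ofFn (hx.trans hx'.symm)
  rw [formList_injective g (hl.trans hl'.symm)]
  exact h

theorem strong_choice {N : Type} (R : (ℕ → N) → ℕ → N → Prop)
    (hloc : ∀ e e' x y, (∀ z < x, e z = e' z) → R e x y → R e' x y)
    (hex : ∀ e x, ∃ y, R e x y) [Nonempty N] : ∃ e, ∀ x, R e x (e x) := by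
  classical
  choose f hf using hex
  let step : (x : ℕ) → ((z : ℕ) → z < x → N) → N := fun x h =>
    f (fun z => if hz : z < x then h z hz else Classical.arbitrary N) x
  refine ⟨fun x => WellFoundedLT.fix step x, fun x => ?_⟩
  have h : WellFoundedLT.fix step x = step x fun z _ => WellFoundedLT.fix step z :=
    WellFoundedLT.fix_eq step x
  change R _ x (WellFoundedLT.fix step x)
  rw [h]
  refine hloc _ _ _ _ ?_ (hf _ _)
  intro z hz
  simp [hz]

theorem lt_encode_of_mem {a : List ℕ} {z : ℕ} (h : z ∈ a) : z < Encodable.encode a := by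
  induction a with
  | nil => simp at h
  | cons y a ih =>
    rw [Encodable.encode_list_cons, Encodable.encode_nat, Nat.lt_succ_iff]
    rcases List.mem_cons.1 h with rfl | h
    · exact Nat.left_le_pair _ _
    · exact (ih h).le.trans (Nat.right_le_pair _ _)

theorem lt_nFun {f : ℕ} {ys : List ℕ} {z : ℕ} (h : z ∈ ys) : z < nFun f ys :=
  (lt_encode_of_mem h).trans_le ((Nat.right_le_pair _ _).trans (Nat.right_le_pair _ _))

theorem lt_nWit {l a xs : List ℕ} {z : ℕ} (h : z ∈ a ∨ z ∈ xs) : z < nWit l a xs := by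
  have h1 : Nat.pair (Encodable.encode a) (Encodable.encode xs) ≤ nWit l a xs :=
    (Nat.right_le_pair (Encodable.encode l) _).trans (Nat.right_le_pair _ _)
  rcases h with h | h
  · exact (lt_encode_of_mem h).trans_le ((Nat.left_le_pair _ _).trans h1)
  · exact (lt_encode_of_mem h).trans_le ((Nat.right_le_pair _ _).trans h1)

theorem lt_nVal {l a xs : List ℕ} {z : ℕ} (h : z ∈ a ∨ z ∈ xs) : z < nVal l a xs := by
  have h1 : Nat.pair (Encodable.encode a) (Encodable.encode xs) ≤ nVal l a xs :=
    (Nat.right_le_pair (Encodable.encode l) _).trans (Nat.right_le_pair _ _)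
  rcases h with h | h
  · exact (lt_encode_of_mem h).trans_le ((Nat.left_le_pair _ _).trans h1)
  · exact (lt_encode_of_mem h).trans_le ((Nat.right_le_pair _ _).trans h1)

theorem nJunk_zero_lt (m : ℕ) : nJunk 0 < nJunk (m + 1) := Nat.pair_lt_pair_right _ (by omega)

variable {k : ℕ} {φ : L.Formula (Fin 1 ⊕ Fin k)} {S : Finset (List ℕ)}
  (C : FormulaChain φ N S.card)

/-- The requirement on the element `y` named by `x`, given the elements `e z` named by `z < x`. -/
structure NameReq (e : ℕ → N) (x : ℕ) (y : N) : Prop where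
  base : x = nJunk 0 → y ∈ C.S 0
  junk : ∀ m, x = nJunk (m + 1) → y = e (nJunk 0)
  par : ∀ i, x = nPar i → y ∈ C.S 0 ∧ ∀ h : i < k, y = C.a ⟨i, h⟩
  gen : ∀ b F, x = nGen b F → y ∈ C.S (chainLevel S (some (b, F)) + 1) ∧
    y ∉ C.S (chainLevel S (some (b, F))) ∧
    (b = true → φ.Realize (Sum.elim (fun _ => y) C.a))
  wit : ∀ l a xs, x = nWit l a xs →
    (∀ i, (∀ z ∈ a, e z ∈ C.S i) → (∀ z ∈ xs, e z ∈ C.S i) → y ∈ C.S i) ∧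
    ∀ (k m : ℕ) (ψ : L.BoundedFormula (Fin k) (m + 1)) (ρ : Fin k → N) (σ : Fin m → N),
      formList g Fin.val ψ = l → List.ofFn ρ = a.map e → List.ofFn σ = xs.map e →
      ψ.Realize ρ (Fin.snoc σ y) → ∀ c, ψ.Realize ρ (Fin.snoc σ c)
  val : ∀ t a xs, x = nVal t a xs →
    ∀ (k m : ℕ) (s : L.Term (Fin k ⊕ Fin m)) (ρ : Fin k → N) (σ : Fin m → N),
      termList g Fin.val s = t → List.ofFn ρ = a.map e → List.ofFn σ = xs.map e →
      y = s.realize (Sum.elim ρ σ)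
  func : ∀ f ys, x = nFun f ys → ∀ (m : ℕ) (F : L.Functions m) (v : Fin m → N),
    g.encFun m F = f → List.ofFn v = ys.map e → y = Structure.funMap F v

theorem NameReq.congr {C : FormulaChain φ N S.card} {e e' : ℕ → N} {x : ℕ} {y : N}
    (he : ∀ z < x, e z = e' z) (h : NameReq g C e x y) : NameReq g C e' x y where
  base := h.base
  junk m hm := (h.junk m hm).trans (he _ (hm ▸ nJunk_zero_lt m))
  par := h.par
  gen := h.gen
  wit l a xs hx := by
    have ha : ∀ z ∈ a, e z = e' z := fun z hz => he z (hx ▸ lt_nWit (.inl hz))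
    have hxs : ∀ z ∈ xs, e z = e' z := fun z hz => he z (hx ▸ lt_nWit (.inr hz))
    rw [← List.map_congr_left ha, ← List.map_congr_left hxs]
    obtain ⟨h1, h2⟩ := h.wit l a xs hx
    refine ⟨fun i hi hi' => h1 i (fun z hz => ?_) (fun z hz => ?_), h2⟩
    · rw [ha z hz]
      exact hi z hz
    · rw [hxs z hz]
      exact hi' z hz
  val t a xs hx := by
    rw [← List.map_congr_left fun z hz => he z (hx ▸ lt_nVal (.inl hz)),
      ← List.map_congr_left fun z hz => he z (hx ▸ lt_nVal (.inr hz))]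
    exact h.val t a xs hx
  func f ys hx := by
    rw [← List.map_congr_left fun z hz => he z (hx ▸ lt_nFun hz)]
    exact h.func f ys hx

theorem exists_witness (e : ℕ → N) (l a xs : List ℕ) [Nonempty N] :
    ∃ y, (∀ i, (∀ z ∈ a, e z ∈ C.S i) → (∀ z ∈ xs, e z ∈ C.S i) → y ∈ C.S i) ∧
    ∀ (k m : ℕ) (ψ : L.BoundedFormula (Fin k) (m + 1)) (ρ : Fin k → N) (σ : Fin m → N),
      formList g Fin.val ψ = l → List.ofFn ρ = a.map e → List.ofFn σ = xs.map e →
      ψ.Realize ρ (Fin.snoc σ y) → ∀ c, ψ.Realize ρ (Fin.snoc σ c) := by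
  classical
  obtain ⟨y₀, hy₀⟩ := TarskiVaught.nonempty (C.tv 0)
  by_cases hψ : ∃ (k m : ℕ) (ψ : L.BoundedFormula (Fin k) (m + 1)) (ρ : Fin k → N)
      (σ : Fin m → N), formList g Fin.val ψ = l ∧ List.ofFn ρ = a.map e ∧
      List.ofFn σ = xs.map e ∧ ∃ c, ψ.not.Realize ρ (Fin.snoc σ c)
  swap
  · refine ⟨y₀, fun i _ _ => C.mono (Nat.zero_le i) hy₀, ?_⟩
    intro k m ψ ρ σ h1 h2 h3 _ c
    by_contra hc
    exact hψ ⟨k, m, ψ, ρ, σ, h1, h2, h3, c, hc⟩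
  obtain ⟨k, m, ψ, ρ, σ, h1, h2, h3, hc⟩ := hψ
  obtain ⟨y, hy, hy'⟩ : ∃ y, (∀ i, (∀ z ∈ a, e z ∈ C.S i) → (∀ z ∈ xs, e z ∈ C.S i) →
      y ∈ C.S i) ∧ ψ.not.Realize ρ (Fin.snoc σ y) := by
    by_cases hi : ∃ i, (∀ z ∈ a, e z ∈ C.S i) ∧ ∀ z ∈ xs, e z ∈ C.S i
    · obtain ⟨ha, hx⟩ := Nat.find_spec hi
      have hmem : ∀ {k : ℕ} {ρ : Fin k → N} {a : List ℕ} {i : ℕ}, List.ofFn ρ = a.map e →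
          (∀ z ∈ a, e z ∈ C.S i) → ∀ j, ρ j ∈ C.S i := by
        intro k ρ a i h ha j
        have : ρ j ∈ a.map e := h ▸ (List.mem_ofFn).2 ⟨j, rfl⟩
        obtain ⟨z, hz, hz'⟩ := List.mem_map.1 this
        rw [← hz']
        exact ha z hz
      obtain ⟨y, hy, hy'⟩ := TarskiVaught.exists_mem (C.tv _) ψ.not ρ σ (hmem h2 ha) (hmem h3 hx) hc
      exact ⟨y, fun i h h' => C.mono (Nat.find_min' hi ⟨h, h'⟩) hy, hy'⟩
    · obtain ⟨y, hy⟩ := hc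
      exact ⟨y, fun i h h' => absurd ⟨i, h, h'⟩ hi, hy⟩
  refine ⟨y, hy, ?_⟩
  intro k' m' ψ' ρ' σ' h1' h2' h3' hr
  obtain ⟨rfl, rfl⟩ := ofFn_eq_ofFn (h2.trans h2'.symm)
  obtain ⟨rfl, rfl⟩ := ofFn_eq_ofFn (h3.trans h3'.symm)
  obtain rfl := formList_injective g (h1.trans h1'.symm)
  exact absurd hr (BoundedFormula.realize_not.1 hy')

theorem exists_nameReq [Nonempty N] (e : ℕ → N) (x : ℕ) : ∃ y, NameReq g C e x y := by
  obtain ⟨y₀, hy₀⟩ := TarskiVaught.nonempty (C.tv 0)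
  by_cases h0 : ∃ m, x = nJunk (m + 1)
  · obtain ⟨m, rfl⟩ := h0
    refine ⟨e (nJunk 0), ?_, ?_, ?_, ?_, ?_, ?_, ?_⟩ <;>
      simp [nJunk, nPar, nGen, nWit, nVal, nFun, Nat.pair_eq_pair]
  by_cases h1 : ∃ i, x = nPar i
  · obtain ⟨i, rfl⟩ := h1
    by_cases hi : i < k
    · refine ⟨C.a ⟨i, hi⟩, ?_, ?_, ?_, ?_, ?_, ?_, ?_⟩ <;>
        simp +contextual [nJunk, nPar, nGen, nWit, nVal, nFun, Nat.pair_eq_pair, C.mem_a]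
    · refine ⟨y₀, ?_, ?_, ?_, ?_, ?_, ?_, ?_⟩ <;>
        simp +contextual [nJunk, nPar, nGen, nWit, nVal, nFun, Nat.pair_eq_pair, hy₀]
      omega
  by_cases h2 : ∃ b F, x = nGen b F
  · obtain ⟨b, F, rfl⟩ := h2
    obtain ⟨y, h1, h2, h3⟩ := C.gen (chainLevel S (some (b, F)))
    refine ⟨y, ?_, ?_, ?_, ?_, ?_, ?_, ?_⟩
    case refine_4 =>
      intro b' F' hbF
      simp only [nGen, Nat.pair_eq_pair, true_and, Encodable.encode_inj, Prod.mk.injEq] at hbF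
      obtain ⟨rfl, rfl⟩ := hbF
      exact ⟨h1, h2, fun hb => h3 (by simp [chainLevel, hb])⟩
    all_goals simp [nJunk, nPar, nGen, nWit, nVal, nFun, Nat.pair_eq_pair]
  by_cases h3 : ∃ l a xs, x = nWit l a xs
  · obtain ⟨l, a, xs, rfl⟩ := h3
    obtain ⟨y, hy⟩ := exists_witness g C e l a xs
    refine ⟨y, ?_, ?_, ?_, ?_, ?_, ?_, ?_⟩
    case refine_5 =>
      intro l' a' xs' hx
      simp only [nWit, Nat.pair_eq_pair, true_and, Encodable.encode_inj, Prod.mk.injEq] at hx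
      obtain ⟨rfl, rfl, rfl⟩ := hx
      exact hy
    all_goals simp [nJunk, nPar, nGen, nWit, nVal, nFun, Nat.pair_eq_pair]
  by_cases h : ∃ t a xs, x = nVal t a xs ∧ ∃ (k m : ℕ) (s : L.Term (Fin k ⊕ Fin m))
      (ρ : Fin k → N) (σ : Fin m → N),
      termList g Fin.val s = t ∧ List.ofFn ρ = a.map e ∧ List.ofFn σ = xs.map e
  · obtain ⟨t, a, xs, rfl, k', m, s, ρ, σ, h1, h2, h3⟩ := h
    refine ⟨s.realize (Sum.elim ρ σ), ?_, ?_, ?_, ?_, ?_, ?_, ?_⟩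
    case refine_6 =>
      intro t' a' xs' hx k' m' s' ρ' σ' h1' h2' h3'
      simp only [nVal, Nat.pair_eq_pair, true_and, Encodable.encode_inj, Prod.mk.injEq] at hx
      obtain ⟨rfl, rfl, rfl⟩ := hx
      obtain ⟨rfl, rfl⟩ := ofFn_eq_ofFn (h2.trans h2'.symm)
      obtain ⟨rfl, rfl⟩ := ofFn_eq_ofFn (h3.trans h3'.symm)
      obtain rfl := termList_injective g (h1.trans h1'.symm)
      rfl
    all_goals simp [nJunk, nPar, nGen, nWit, nVal, nFun, Nat.pair_eq_pair]
  by_cases h' : ∃ f ys, x = nFun f ys ∧ ∃ (m : ℕ) (F : L.Functions m) (v : Fin m → N),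
      g.encFun m F = f ∧ List.ofFn v = ys.map e
  · obtain ⟨f, ys, rfl, m, F, v, h1, h2⟩ := h'
    refine ⟨Structure.funMap F v, ?_, ?_, ?_, ?_, ?_, ?_, ?_⟩
    case refine_7 =>
      intro f' ys' hx m' F' v' h1' h2'
      simp only [nFun, Nat.pair_eq_pair, true_and, Encodable.encode_inj, Prod.mk.injEq] at hx
      obtain ⟨rfl, rfl⟩ := hx
      obtain ⟨rfl, rfl⟩ := ofFn_eq_ofFn (h2.trans h2'.symm)
      obtain rfl := g.encFun_inj _ (h1.trans h1'.symm)
      rfl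
    all_goals simp [nJunk, nPar, nGen, nWit, nVal, nFun, Nat.pair_eq_pair]
  refine ⟨y₀, fun _ => hy₀, ?_, ?_, ?_, ?_, ?_, ?_⟩
  · exact fun m hm => absurd ⟨m, hm⟩ h0
  · exact fun m hm => absurd ⟨m, hm⟩ h1
  · exact fun b F hm => absurd ⟨b, F, hm⟩ h2
  · exact fun l a xs hm => absurd ⟨l, a, xs, hm⟩ h3
  · exact fun t a xs hm k m s ρ σ h1 h2 h3 => absurd ⟨t, a, xs, hm, k, m, s, ρ, σ, h1, h2, h3⟩ h
  · exact fun f ys hm m F v h1 h2 => absurd ⟨f, ys, hm, m, F, v, h1, h2⟩ h'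

theorem exists_naming [Nonempty N] : ∃ e : ℕ → N, ∀ x, NameReq g C e x (e x) :=
  strong_choice _ (fun _ _ _ _ he h => h.congr g he) (exists_nameReq g C)

end Satisfiability

/-! ## The interpretation of the propositional atoms in a chain -/

section Interpretation

variable {L : FirstOrder.Language} {N : Type} [L.Structure N] (g : GoedelCoding L)
  {k : ℕ} {φ : L.Formula (Fin 1 ⊕ Fin k)} {S : Finset (List ℕ)}
  (C : FormulaChain φ N S.card) (e : ℕ → N)

/-- The truth values of the atoms in a chain with named elements. -/
def Interp : Idx → Prop
  | .inl (l, a, xs) => FormVal g e l a xs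
  | .inr (.inl (x, y)) => e x = e y
  | .inr (.inr (.inl (r, ys))) => ∃ (m : ℕ) (R : L.Relations m) (v : Fin m → N),
      g.encRel m R = r ∧ List.ofFn v = ys.map e ∧ Structure.RelMap R v
  | .inr (.inr (.inr (j, x))) => e x ∈ C.S (chainLevel S j)

theorem interp_iV {l a xs : List ℕ} : Interp g C e (iV l a xs) ↔ FormVal g e l a xs := Iff.rfl

theorem interp_iEq {x y : ℕ} : Interp g C e (iEq x y) ↔ e x = e y := Iff.rfl

theorem interp_iRel {r : ℕ} {ys : List ℕ} : Interp g C e (iRel r ys) ↔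
    ∃ (m : ℕ) (R : L.Relations m) (v : Fin m → N),
      g.encRel m R = r ∧ List.ofFn v = ys.map e ∧ Structure.RelMap R v := Iff.rfl

theorem interp_iP {j : Option (Bool × List ℕ)} {x : ℕ} :
    Interp g C e (iP j x) ↔ e x ∈ C.S (chainLevel S j) := Iff.rfl

theorem ofFn_getElem_map (a : List ℕ) : List.ofFn (fun i : Fin a.length => e a[i]) = a.map e := by
  rw [show (fun i : Fin a.length => e a[i]) = e ∘ a.get from rfl, ← List.map_ofFn,
      List.ofFn_get]

theorem termList_subst {α : Type} {k n : ℕ} {enc : α → ℕ} (f : α → Fin k)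
    (hf : ∀ a, (f a).val = enc a) (t : L.Term (α ⊕ Fin n)) :
    termList g Fin.val (t.subst (Sum.elim (Term.relabel Sum.inl ∘ fun a => .var (f a))
      (Term.var ∘ Sum.inr)) : L.Term (Fin k ⊕ Fin n)) = termList g enc t := by
  induction t with
  | var i =>
    rcases i with a | i
    · exact (termList_free g _ _).trans (congrArg freeTok (hf a))
    · rfl
  | func F ts ih => rw [Term.subst, termList_func, termList_func, funext ih]

theorem formList_subst {α : Type} {k n : ℕ} {enc : α → ℕ} (f : α → Fin k)
    (hf : ∀ a, (f a).val = enc a) (ψ : L.BoundedFormula α n) :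
    formList g Fin.val (ψ.subst fun a => .var (f a)) = formList g enc ψ := by
  induction ψ with
  | falsum => rfl
  | equal s t =>
    exact (formList_equal ..).trans (by
      rw [formList_equal, termList_subst g f hf, termList_subst g f hf])
  | rel R ts =>
    exact (formList_rel ..).trans (by
      rw [formList_rel, funext fun i => termList_subst g f hf (ts i)]
      rfl)
  | imp φ ψ ih ih' => exact (formList_imp ..).trans (by rw [formList_imp, ← ih, ← ih']; rfl)
  | all φ ih => exact (formList_all ..).trans (by rw [formList_all, ← ih]; rfl)

variable {g C e}

theorem interp_iRel_iff {m r : ℕ} {ys : List ℕ} {R : L.Relations m} {v : Fin m → N}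
    (hR : g.encRel m R = r) (hv : List.ofFn v = ys.map e) :
    Interp g C e (iRel r ys) ↔ Structure.RelMap R v := by
  rw [interp_iRel]
  refine ⟨?_, fun h => ⟨m, R, v, hR, hv, h⟩⟩
  rintro ⟨m', R', v', hR', hv', h⟩
  obtain ⟨rfl, rfl⟩ := ofFn_eq_ofFn (hv.trans hv'.symm)
  rwa [g.encRel_inj _ (hR.trans hR'.symm)]

theorem nVal_eq (he : ∀ x, NameReq g C e x (e x)) {t a xs : List ℕ}
    {s : L.Term (Fin a.length ⊕ Fin xs.length)} (hs : termList g Fin.val s = t) :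
    e (nVal t a xs) = s.realize (Sum.elim (fun i => e a[i]) fun i => e xs[i]) :=
  (he _).val _ _ _ rfl _ _ s _ _ hs (ofFn_getElem_map e a) (ofFn_getElem_map e xs)

theorem formVal_getElem_iff {l a xs : List ℕ} {ψ : L.BoundedFormula (Fin a.length) xs.length}
    (hl : formList g Fin.val ψ = l) :
    FormVal g e l a xs ↔ ψ.Realize (fun i => e a[i]) fun i => e xs[i] :=
  formVal_iff hl (ofFn_getElem_map e a) (ofFn_getElem_map e xs)

theorem ofFn_realize (he : ∀ x, NameReq g C e x (e x)) {a xs : List ℕ} {zs : List (List ℕ × ℕ)}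
    {s : Fin (zs.map fun z => z.1).length → L.Term (Fin a.length ⊕ Fin xs.length)}
    (hs : ∀ i, termList g Fin.val (s i) = (zs.map fun z => z.1)[i])
    (hz : ∀ z ∈ zs, e z.2 = e (nVal z.1 a xs)) :
    List.ofFn (fun i => (s i).realize (Sum.elim (fun i => e a[i]) fun i => e xs[i])) =
      (zs.map fun z => z.2).map e := by
  refine List.ext_getElem (by simp) fun i h1 h2 => ?_
  simp only [List.getElem_ofFn, List.getElem_map]
  rw [← nVal_eq he (hs _)]
  simp only [Fin.getElem_fin, List.getElem_map]
  exact (hz _ (List.getElem_mem _)).symm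

theorem clauseSat_eq (he : ∀ x, NameReq g C e x (e x)) {c : Clause} (hc : EqClause c) :
    ClauseSat (Interp g C e) c := by
  rcases hc with ⟨x, rfl⟩ | ⟨x, y, rfl⟩ | ⟨x, y, z, rfl⟩ | ⟨m, rfl⟩ <;>
    simp only [ClauseSat, List.mem_cons, List.not_mem_nil, or_false, forall_eq_or_imp, forall_eq,
      exists_eq_left, interp_iEq, false_imp_iff, implies_true, true_imp_iff]
  · exact Eq.symm
  · exact fun h => h.1.trans h.2
  · cases m with
    | zero => rfl
    | succ m => exact (he _).junk m rfl

theorem clauseSat_term (he : ∀ x, NameReq g C e x (e x)) {c : Clause} (hc : TermClause g c) :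
    ClauseSat (Interp g C e) c := by
  rcases hc with ⟨a, xs, i, x, hi, rfl⟩ | ⟨a, xs, i, x, hi, rfl⟩ | ⟨a, xs, f, zs, hf, hz, rfl⟩ <;>
    simp only [ClauseSat, List.mem_cons, List.not_mem_nil, or_false,
      exists_eq_left, interp_iEq, false_imp_iff, implies_true, true_imp_iff, List.mem_map,
      forall_exists_index, and_imp, forall_apply_eq_imp_iff₂]
  · obtain ⟨h, rfl⟩ := List.getElem?_eq_some_iff.1 hi
    exact (nVal_eq he (s := .var (.inl ⟨i, h⟩)) rfl).symm
  · obtain ⟨h, rfl⟩ := List.getElem?_eq_some_iff.1 hi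
    exact (nVal_eq he (s := .var (.inr ⟨i, h⟩)) rfl).symm
  · intro h
    obtain ⟨F, s, h1, h2, h3⟩ := IsFun.exists_func (g := g) (k := a.length) (n := xs.length) (f := f)
      (ts := zs.map fun z => z.1) (by rwa [List.length_map]) (by simpa using fun a b h => hz (a, b) h)
    rw [nVal_eq he h3, (he _).func _ _ rfl _ F _ h1 (ofFn_realize he h2 h)]
    rfl

theorem clauseSat_atom (he : ∀ x, NameReq g C e x (e x)) {c : Clause} (hc : AtomClause g c) :
    ClauseSat (Interp g C e) c := by
  rcases hc with ⟨a, xs, rfl⟩ | ⟨a, xs, s, t, ⟨s, rfl⟩, ⟨t, rfl⟩, rfl⟩ |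
      ⟨a, xs, s, t, ⟨s, rfl⟩, ⟨t, rfl⟩, rfl⟩ | ⟨a, xs, r, zs, hr, hz, rfl⟩ |
      ⟨a, xs, r, zs, hr, hz, rfl⟩ <;>
    simp only [ClauseSat, List.mem_cons, List.not_mem_nil, or_false, forall_eq,
      exists_eq_left, interp_iEq, interp_iV,
      List.mem_map, forall_exists_index, and_imp, forall_apply_eq_imp_iff₂, forall_eq_or_imp,
      false_and, exists_false]
  · exact fun h => (formVal_getElem_iff (formList_falsum g Fin.val)).1 h
  · rw [formVal_getElem_iff (formList_equal g _ s t), nVal_eq he rfl, nVal_eq he rfl]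
    exact id
  · rw [formVal_getElem_iff (formList_equal g _ s t), nVal_eq he rfl, nVal_eq he rfl]
    exact id
  · intro h0 h
    obtain ⟨R, s, h1, h2, h3⟩ := IsRel.exists_rel (g := g) (k := a.length) (n := xs.length) (r := r)
      (ts := zs.map fun z => z.1) (by rwa [List.length_map]) (by simpa using fun a b h => hz (a, b) h)
    rw [formVal_getElem_iff h3] at h0
    exact (interp_iRel_iff h1 (ofFn_realize he h2 h)).2 h0
  · intro h0 h
    obtain ⟨R, s, h1, h2, h3⟩ := IsRel.exists_rel (g := g) (k := a.length) (n := xs.length) (r := r)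
      (ts := zs.map fun z => z.1) (by rwa [List.length_map]) (by simpa using fun a b h => hz (a, b) h)
    rw [formVal_getElem_iff h3]
    exact (interp_iRel_iff h1 (ofFn_realize he h2 h)).1 h0

theorem ofFn_snoc {m : ℕ} {σ : Fin m → N} {xs : List ℕ} (hσ : List.ofFn σ = xs.map e) (y : ℕ) :
    List.ofFn (Fin.snoc σ (e y) : Fin (m + 1) → N) = (xs ++ [y]).map e := by
  rw [List.ofFn_succ']
  simp [hσ, List.concat_eq_append]

theorem clauseSat_compound {T : L.Theory} (hT : ∀ ψ ∈ T, N ⊨ ψ) (he : ∀ x, NameReq g C e x (e x))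
    {c : Clause} (hc : CompoundClause g T c) : ClauseSat (Interp g C e) c := by
  rcases hc with ⟨a, xs, l, l', ⟨ψ, rfl⟩, ⟨χ, rfl⟩, hc⟩ | ⟨a, xs, l, ⟨ψ, rfl⟩, y, hc⟩ | ⟨l, hl, rfl⟩
  · have h1 := formVal_getElem_iff (e := e) (formList_imp g Fin.val ψ χ)
    have h2 := formVal_getElem_iff (g := g) (e := e) (ψ := ψ) rfl
    have h3 := formVal_getElem_iff (g := g) (e := e) (ψ := χ) rfl
    rw [BoundedFormula.realize_imp] at h1
    rcases hc with rfl | rfl | rfl <;>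
    simp only [ClauseSat, List.mem_cons, List.not_mem_nil, or_false, forall_eq,
      exists_eq_left, interp_iV, false_imp_iff, implies_true, true_imp_iff,
      forall_eq_or_imp, exists_eq_or_imp, h1, h2, h3] <;> tauto
  · have h1 := formVal_getElem_iff (e := e) (formList_all g Fin.val ψ)
    have h2 := formVal_iff (g := g) (φ := ψ) rfl (ofFn_getElem_map e a)
      (ofFn_snoc (ofFn_getElem_map e xs) y)
    rw [BoundedFormula.realize_all] at h1
    rcases hc with rfl | rfl <;>
    simp only [ClauseSat, List.mem_cons, List.not_mem_nil, or_false, forall_eq,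
      exists_eq_left, interp_iV, interp_iEq, forall_eq_or_imp, h1, h2]
    · exact fun h => h _
    · rintro ⟨h, h'⟩
      rw [h] at h'
      exact ((he _).wit _ _ _ rfl).2 _ _ _ _ _ rfl (ofFn_getElem_map e a) (ofFn_getElem_map e xs) h'
  · obtain ⟨ψ, hψ, hl⟩ := hl
    have hl : l = formList g (fun a : Empty => a.elim) ψ := Encodable.encode_injective hl
    have h := formVal_iff (g := g) (e := e) (a := []) (xs := []) (ρ := Fin.elim0) (σ := Fin.elim0)
      (φ := ψ.subst fun a : Empty => .var (a.elim : Fin 0))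
      ((formList_subst g (fun a : Empty => (a.elim : Fin 0)) (fun a => a.elim) ψ).trans hl.symm)
      rfl rfl
    simp only [ClauseSat, List.mem_cons, List.not_mem_nil, or_false, false_imp_iff, implies_true,
      true_imp_iff, exists_eq_left, interp_iV, h, BoundedFormula.realize_subst]
    have h' := hT ψ hψ
    rwa [Sentence.Realize, Formula.Realize,
      Subsingleton.elim (default : Empty → N) fun a => Term.realize Fin.elim0 (.var (a.elim : Fin 0) : L.Term (Fin 0)),
      Subsingleton.elim (default : Fin 0 → N) Fin.elim0] at h'

theorem clauseSat_chain (he : ∀ x, NameReq g C e x (e x)) {c : Clause}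
    (hS : ∀ b F G, c = ([], [iP (some (b, G)) (nGen b F)]) → F ∈ S) (hc : ChainClause g c) :
    ClauseSat (Interp g C e) c := by
  rcases hc with ⟨j, x, y, rfl⟩ | ⟨j, rfl⟩ | ⟨j, i, rfl⟩ | ⟨j, f, ys, ⟨F, rfl⟩, rfl⟩ |
      ⟨j, l, a, xs, rfl⟩ | ⟨j, x, rfl⟩ | ⟨b, F, G, x, hFG, rfl⟩ | ⟨b, F, G, hFG, rfl⟩ |
      ⟨b, F, rfl⟩ <;>
    simp only [ClauseSat, List.mem_cons, List.not_mem_nil, or_false, forall_eq,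
      exists_eq_left, interp_iEq, interp_iP, false_imp_iff, implies_true, true_imp_iff,
      List.mem_map, forall_exists_index, and_imp, forall_apply_eq_imp_iff₂,
      false_and, exists_false, List.mem_append, or_imp, forall_and]
  · exact fun h h' => h ▸ h'
  · exact C.mono (Nat.zero_le _) ((he _).base rfl)
  · exact C.mono (Nat.zero_le _) ((he _).par i rfl).1
  · intro h
    rw [(he _).func _ _ rfl _ F _ rfl (ofFn_getElem_map e ys)]
    exact TarskiVaught.funMap_mem (C.tv _) _ _ fun i => h _ (List.getElem_mem _)
  · exact fun h h' => ((he _).wit _ _ _ rfl).1 _ h h'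
  · exact fun h => C.mono (Nat.zero_le _) h
  · exact fun h => C.mono (Nat.add_le_add_left (lexRank_mono S hFG) _) h
  · exact C.mono (Nat.add_lt_add_left (lexRank_lt (hS b F G rfl) hFG) _) ((he _).gen b F rfl).1
  · exact ((he _).gen b F rfl).2.1

/-- A formula with one distinguished variable, with all variables numbered. -/
def numberVars {k : ℕ} (φ : L.Formula (Fin 1 ⊕ Fin k)) : L.Formula (Fin (k + 1)) :=
  φ.relabel (Sum.elim (fun _ => 0) Fin.succ)

theorem realize_numberVars {M : Type} [L.Structure M] {k : ℕ} (φ : L.Formula (Fin 1 ⊕ Fin k))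
    (x : M) (a : Fin k → M) :
    (numberVars φ).Realize (Fin.cons x a : Fin (k + 1) → M) ↔ φ.Realize (Sum.elim (fun _ => x) a) := by
  rw [numberVars, Formula.realize_relabel]
  have : (Fin.cons x a : Fin (k + 1) → M) ∘ Sum.elim (fun _ : Fin 1 => 0) Fin.succ =
      Sum.elim (fun _ => x) a := by
    funext i
    cases i <;> simp
  rw [this]

theorem clauseSat_growth (he : ∀ x, NameReq g C e x (e x)) {c : Clause}
    (hc : GrowthClause k (formList g Fin.val (numberVars φ)) c) :
    ClauseSat (Interp g C e) c := by
  obtain ⟨x, F, zs, hz, hc⟩ := hc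
  have key : (∀ z ∈ zs, e z.1 = e z.2) →
      (FormVal g e (formList g Fin.val (numberVars φ)) (x :: zs.map fun z => z.1) [] ↔
        φ.Realize (Sum.elim (fun _ => e x) C.a)) := by
    intro h
    rw [← realize_numberVars]
    refine formVal_iff (xs := []) (σ := default) rfl ?_ (by simp)
    rw [List.ofFn_cons, List.map_cons, List.map_map,
      List.map_congr_left (f := e ∘ fun z : ℕ × ℕ => z.1) (g := e ∘ fun z => z.2) h, ← List.map_map, hz]
    congr 1
    refine List.ext_getElem (by simp) fun i h1 h2 => ?_
    simp only [List.getElem_ofFn, List.getElem_map, List.getElem_range]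
    rw [((he _).par i rfl).2]
  rcases hc with rfl | rfl <;>
    simp only [ClauseSat, List.mem_cons, List.not_mem_nil, or_false,
      exists_eq_left, interp_iEq, interp_iP, interp_iV,
      List.mem_map, forall_exists_index, and_imp, forall_apply_eq_imp_iff₂, forall_eq_or_imp]
  · intro h1 h2 h3
    refine C.sub _ (C.mono ?_ h2) ((key h3).1 h1)
    simp [chainLevel, lexRank_le_card]
  · intro h1 h2
    rw [key h2, h1]
    exact ((he _).gen true F rfl).2.2 rfl

theorem exists_arithmetical_sysModel {T : L.Theory} (hL : ArithLang g) (hT : ArithTheory g T)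
    (hN : ∀ ψ ∈ T, N ⊨ ψ) (hC : ∀ n, Nonempty (FormulaChain φ N n)) :
    ∃ X : Idx → Prop, ArP ∅ X ∧
      ∀ c, SysClause g T k (formList g Fin.val (numberVars φ)) c → ClauseSat X c := by
  classical
  refine exists_arithmetical_assignment (arP_sysClause hL hT _ _ ∅) fun Fs hFs => ?_
  have h0 : ∀ c : Clause, ∃ F : List ℕ, ∀ b F' G, c = ([], [iP (some (b, G)) (nGen b F')]) →
      F' = F := by
    intro c
    by_cases h : ∃ b F' G, c = ([], [iP (some (b, G)) (nGen b F')])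
    · obtain ⟨b, F, G, rfl⟩ := h
      refine ⟨F, fun b' F' G' h => ?_⟩
      simp [iP, nGen, Nat.pair_eq_pair] at h
      exact h.2.2.symm
    · exact ⟨[], fun b F' G hc => absurd ⟨b, F', G, hc⟩ h⟩
  choose F0 hF0 using h0
  obtain ⟨C⟩ := hC (Fs.map F0).toFinset.card
  obtain ⟨c, -, -⟩ := C.gen 0
  have : Nonempty N := ⟨c⟩
  obtain ⟨e, he⟩ := exists_naming g C
  refine ⟨Interp g C e, fun c hc => ?_⟩
  rcases hFs c hc with h | h | h | h | h | h
  · exact clauseSat_eq he h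
  · exact clauseSat_term he h
  · exact clauseSat_atom he h
  · exact clauseSat_compound hN he h
  · refine clauseSat_chain he (fun b F G hcF => ?_) h
    rw [hF0 c b F G hcF]
    exact List.mem_toFinset.2 (List.mem_map_of_mem hc)
  · exact clauseSat_growth he h

end Interpretation

/-! ## Coded models from an assignment satisfying the clause system -/

section TermModels

variable {L : FirstOrder.Language}

/-- The assignment `X` satisfies the clause system. -/
def SysModel (g : GoedelCoding L) (T : L.Theory) (k : ℕ) (l : List ℕ) (X : Idx → Prop) : Prop :=
  ∀ c, SysClause g T k l c → ClauseSat X c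

/-- The canonical name of the element named by `x`. -/
noncomputable def rep (X : Idx → Prop) (x : ℕ) : ℕ := sInf {y | X (iEq x y)}

/-- `x` is a canonical name. -/
def IsRep (X : Idx → Prop) (x : ℕ) : Prop := ∀ y, y < x → ¬ X (iEq x y)

variable {g : GoedelCoding L} {T : L.Theory} {k : ℕ} {l : List ℕ} {X : Idx → Prop}

namespace SysModel

theorem eq_refl (hX : SysModel g T k l X) (x : ℕ) : X (iEq x x) := by
  simpa [ClauseSat] using hX _ (.inl (.inl ⟨x, rfl⟩))

theorem eq_symm (hX : SysModel g T k l X) {x y : ℕ} : X (iEq x y) → X (iEq y x) := by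
  simpa [ClauseSat] using hX _ (.inl (.inr (.inl ⟨x, y, rfl⟩)))

theorem eq_trans (hX : SysModel g T k l X) {x y z : ℕ} :
    X (iEq x y) → X (iEq y z) → X (iEq x z) := by
  simpa [ClauseSat] using hX _ (.inl (.inr (.inr (.inl ⟨x, y, z, rfl⟩))))

theorem eq_junk (hX : SysModel g T k l X) (m : ℕ) : X (iEq (nJunk m) (nJunk 0)) := by
  simpa [ClauseSat] using hX _ (.inl (.inr (.inr (.inr ⟨m, rfl⟩))))

theorem eq_rep (hX : SysModel g T k l X) (x : ℕ) : X (iEq x (rep X x)) :=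
  Nat.sInf_mem (s := {y | X (iEq x y)}) ⟨x, hX.eq_refl x⟩

theorem rep_eq_iff (hX : SysModel g T k l X) {x y : ℕ} : rep X x = rep X y ↔ X (iEq x y) := by
  refine ⟨fun h => hX.eq_trans (hX.eq_rep x) (h ▸ hX.eq_symm (hX.eq_rep y)), fun h => ?_⟩
  have : {z | X (iEq x z)} = {z | X (iEq y z)} :=
    Set.ext fun z => ⟨hX.eq_trans (hX.eq_symm h), hX.eq_trans h⟩
  rw [rep, rep, this]

theorem isRep_iff (hX : SysModel g T k l X) {x : ℕ} : IsRep X x ↔ rep X x = x := by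
  constructor
  · intro h
    exact le_antisymm (Nat.sInf_le (hX.eq_refl x)) (not_lt.1 fun h' => h _ h' (hX.eq_rep x))
  · intro h y hy hxy
    exact absurd (Nat.sInf_le hxy) (not_le.2 (by rwa [← rep, h]))

theorem rep_rep (hX : SysModel g T k l X) (x : ℕ) : rep X (rep X x) = rep X x :=
  (hX.rep_eq_iff.2 (hX.eq_rep x)).symm

theorem isRep_rep (hX : SysModel g T k l X) (x : ℕ) : IsRep X (rep X x) :=
  hX.isRep_iff.2 (hX.rep_rep x)

theorem not_isRep_junk (hX : SysModel g T k l X) (m : ℕ) : ¬ IsRep X (nJunk (m + 1)) :=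
  fun h => h _ (nJunk_zero_lt m) (hX.eq_junk _)

theorem theory (hX : SysModel g T k l X) {ψ : L.Sentence} (h : ψ ∈ T) :
    X (iV (formList g (fun a : Empty => a.elim) ψ) [] []) := by
  simpa [ClauseSat] using hX _ (.inr (.inr (.inr (.inl (.inr (.inr
    ⟨formList g (fun a : Empty => a.elim) ψ, ⟨ψ, h, rfl⟩, rfl⟩))))))

theorem equal_iff (hX : SysModel g T k l X) {a xs s t : List ℕ}
    (hs : IsTerm g a.length xs.length s) (ht : IsTerm g a.length xs.length t) :
    X (iV (equalTok xs.length s t) a xs) ↔ X (iEq (nVal s a xs) (nVal t a xs)) := by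
  constructor
  · simpa [ClauseSat] using hX _ (.inr (.inr (.inl (.inr (.inl ⟨a, xs, s, t, hs, ht, rfl⟩)))))
  · simpa [ClauseSat] using
      hX _ (.inr (.inr (.inl (.inr (.inr (.inl ⟨a, xs, s, t, hs, ht, rfl⟩))))))

theorem rel_iff (hX : SysModel g T k l X) {a xs : List ℕ} {r : ℕ} {zs : List (List ℕ × ℕ)}
    (hr : IsRel g zs.length r) (ht : ∀ z, z ∈ zs → IsTerm g a.length xs.length z.1)
    (hz : ∀ z ∈ zs, X (iEq z.2 (nVal z.1 a xs))) :
    X (iV (relTok xs.length r (zs.map fun z => z.1)) a xs) ↔ X (iRel r (zs.map fun z => z.2)) := by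
  have h1 := hX _ (.inr (.inr (.inl (.inr (.inr (.inr (.inl ⟨a, xs, r, zs, hr, ht, rfl⟩)))))))
  have h2 := hX _ (.inr (.inr (.inl (.inr (.inr (.inr (.inr ⟨a, xs, r, zs, hr, ht, rfl⟩)))))))
  simp only [ClauseSat, List.mem_map, forall_exists_index, and_imp, forall_apply_eq_imp_iff₂,
    List.mem_cons, List.not_mem_nil, or_false, exists_eq_left, forall_eq_or_imp] at h1 h2
  exact ⟨fun h => h1 h hz, fun h => h2 h hz⟩

theorem imp_iff (hX : SysModel g T k l X) {a xs l₁ l₂ : List ℕ}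
    (h₁ : IsForm g a.length xs.length l₁) (h₂ : IsForm g a.length xs.length l₂) :
    X (iV (impTok l₁ l₂) a xs) ↔ (X (iV l₁ a xs) → X (iV l₂ a xs)) := by
  have h := fun c hc => hX c (.inr (.inr (.inr (.inl (.inl ⟨a, xs, l₁, l₂, h₁, h₂, hc⟩)))))
  have h1 := h _ (.inl rfl)
  have h2 := h _ (.inr (.inl rfl))
  have h3 := h _ (.inr (.inr rfl))
  simp only [ClauseSat, List.mem_cons, List.not_mem_nil, or_false, forall_eq, exists_eq_left,
    forall_eq_or_imp, exists_eq_or_imp, false_imp_iff, implies_true, true_imp_iff] at h1 h2 h3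
  tauto

theorem all_elim (hX : SysModel g T k l X) {a xs l' : List ℕ}
    (h : IsForm g a.length (xs.length + 1) l') (y : ℕ) :
    X (iV (allTok l') a xs) → X (iV l' a (xs ++ [y])) := by
  simpa [ClauseSat] using
    hX _ (.inr (.inr (.inr (.inl (.inr (.inl ⟨a, xs, l', h, y, .inl rfl⟩))))))

theorem all_intro (hX : SysModel g T k l X) {a xs l' : List ℕ}
    (h : IsForm g a.length (xs.length + 1) l') :
    X (iV l' a (xs ++ [rep X (nWit l' a xs)])) → X (iV (allTok l') a xs) := by
  have := hX _ (.inr (.inr (.inr (.inl (.inr (.inl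
    ⟨a, xs, l', h, rep X (nWit l' a xs), .inr rfl⟩))))))
  simp only [ClauseSat, List.mem_cons, List.not_mem_nil, or_false, forall_eq, exists_eq_left,
    forall_eq_or_imp] at this
  exact fun h => this ⟨hX.eq_symm (hX.eq_rep _), h⟩

section Membership

theorem mem_congr (hX : SysModel g T k l X) {j : Option (Bool × List ℕ)} {x y : ℕ} :
    X (iEq x y) → X (iP j x) → X (iP j y) := by
  simpa [ClauseSat] using hX _ (.inr (.inr (.inr (.inr (.inl (.inl ⟨j, x, y, rfl⟩))))))

theorem mem_par (hX : SysModel g T k l X) (j : Option (Bool × List ℕ)) (i : ℕ) :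
    X (iP j (nPar i)) := by
  simpa [ClauseSat] using hX _ (.inr (.inr (.inr (.inr (.inl (.inr (.inr (.inl ⟨j, i, rfl⟩))))))))

theorem mem_fun (hX : SysModel g T k l X) {j : Option (Bool × List ℕ)} {f : ℕ} {ys : List ℕ}
    (hf : IsFun g ys.length f) : (∀ y ∈ ys, X (iP j y)) → X (iP j (nFun f ys)) := by
  simpa [ClauseSat] using
    hX _ (.inr (.inr (.inr (.inr (.inl (.inr (.inr (.inr (.inl ⟨j, f, ys, hf, rfl⟩)))))))))

theorem mem_wit (hX : SysModel g T k l X) {j : Option (Bool × List ℕ)} {l' a xs : List ℕ}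
    (ha : ∀ y ∈ a, X (iP j y)) (hxs : ∀ y ∈ xs, X (iP j y)) : X (iP j (nWit l' a xs)) := by
  have := hX _ (.inr (.inr (.inr (.inr (.inl (.inr (.inr (.inr (.inr (.inl
    ⟨j, l', a, xs, rfl⟩))))))))))
  simp only [ClauseSat, List.mem_append, List.mem_map, or_imp, forall_and, forall_exists_index,
    and_imp, forall_apply_eq_imp_iff₂, List.mem_cons, List.not_mem_nil, or_false,
    exists_eq_left] at this
  exact this ha hxs

theorem mem_none (hX : SysModel g T k l X) (j : Option (Bool × List ℕ)) {x : ℕ} :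
    X (iP none x) → X (iP j x) := by
  simpa [ClauseSat] using
    hX _ (.inr (.inr (.inr (.inr (.inl (.inr (.inr (.inr (.inr (.inr (.inl ⟨j, x, rfl⟩)))))))))))

theorem mem_mono (hX : SysModel g T k l X) {b : Bool} {F G : List ℕ}
    (h : ¬ LexLt (· ∈ G) (· ∈ F)) {x : ℕ} : X (iP (some (b, F)) x) → X (iP (some (b, G)) x) := by
  simpa [ClauseSat] using hX _ (.inr (.inr (.inr (.inr (.inl (.inr (.inr (.inr (.inr (.inr (.inr
    (.inl ⟨b, F, G, x, h, rfl⟩))))))))))))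

theorem mem_gen (hX : SysModel g T k l X) (b : Bool) {F G : List ℕ}
    (h : LexLt (· ∈ F) (· ∈ G)) : X (iP (some (b, G)) (nGen b F)) := by
  simpa [ClauseSat] using hX _ (.inr (.inr (.inr (.inr (.inl (.inr (.inr (.inr (.inr (.inr (.inr
    (.inr (.inl ⟨b, F, G, h, rfl⟩)))))))))))))

theorem notMem_gen (hX : SysModel g T k l X) (b : Bool) (F : List ℕ) :
    ¬ X (iP (some (b, F)) (nGen b F)) := by
  simpa [ClauseSat] using hX _ (.inr (.inr (.inr (.inr (.inl (.inr (.inr (.inr (.inr (.inr (.inr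
    (.inr (.inr ⟨b, F, rfl⟩)))))))))))))

end Membership

/-- The canonical names of the parameters. -/
noncomputable def params (X : Idx → Prop) (k : ℕ) : List ℕ :=
  (List.range k).map fun i => rep X (nPar i)

theorem growth_aux (X : Idx → Prop) (k : ℕ) :
    ((List.range k).map fun i => (rep X (nPar i), nPar i)).map (fun z => z.2) =
      (List.range k).map nPar := by
  simp [Function.comp_def]

theorem mem_of_growth (hX : SysModel g T k l X) {x : ℕ} {F : List ℕ}
    (h : X (iV l (x :: params X k) [])) (hx : X (iP (some (false, F)) x)) : X (iP none x) := by
  have := hX _ (.inr (.inr (.inr (.inr (.inr ⟨x, F, _, growth_aux X k, .inl rfl⟩)))))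
  simp only [ClauseSat, List.mem_map, List.map_map, forall_exists_index, Function.comp_def,
    and_imp, forall_apply_eq_imp_iff₂, List.mem_cons, List.not_mem_nil, or_false,
    exists_eq_left, forall_eq_or_imp] at this
  exact this h hx fun i _ => hX.eq_symm (hX.eq_rep _)

theorem growth (hX : SysModel g T k l X) {x : ℕ} {F : List ℕ} (h : X (iEq x (nGen true F))) :
    X (iV l (x :: params X k) []) := by
  have := hX _ (.inr (.inr (.inr (.inr (.inr ⟨x, F, _, growth_aux X k, .inr rfl⟩)))))
  simp only [ClauseSat, List.mem_map, List.map_map, forall_exists_index, Function.comp_def,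
    and_imp, forall_apply_eq_imp_iff₂, List.mem_cons, List.not_mem_nil, or_false,
    exists_eq_left, forall_eq_or_imp] at this
  exact this h fun i _ => hX.eq_symm (hX.eq_rep _)

end SysModel

instance CodedStructure.instStructure (M : CodedStructure L) : L.Structure M.carrier := M.struc

/-- `M` consists of canonical names, with operations and relations given by `X`. -/
structure IsTermModel (g : GoedelCoding L) (X : Idx → Prop) (M : CodedStructure L) : Prop where
  rep_eq : ∀ x ∈ M.carrier, rep X x = x
  wit : ∀ l a xs : List ℕ, (∀ x ∈ a, x ∈ M.carrier) → (∀ x ∈ xs, x ∈ M.carrier) →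
    rep X (nWit l a xs) ∈ M.carrier
  funMap : ∀ {m : ℕ} (F : L.Functions m) (v : Fin m → M.carrier),
    ((Structure.funMap F v : M.carrier) : ℕ) = rep X (nFun (g.encFun m F) (List.ofFn fun i => (v i : ℕ)))
  relMap : ∀ {m : ℕ} (R : L.Relations m) (v : Fin m → M.carrier),
    Structure.RelMap R v ↔ X (iRel (g.encRel m R) (List.ofFn fun i => (v i : ℕ)))

namespace IsTermModel

variable {M : CodedStructure L}

theorem realize_term (hX : SysModel g T k l X) (hM : IsTermModel g X M) {α : Type} {n : ℕ}
    {enc : α → ℕ} {a : List ℕ} {ρ : α → M.carrier} (hρ : ∀ i, a[enc i]? = some (ρ i : ℕ))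
    (σ : Fin n → M.carrier) (t : L.Term (α ⊕ Fin n)) :
    ((t.realize (Sum.elim ρ σ) : M.carrier) : ℕ) =
      rep X (nVal (termList g enc t) a (List.ofFn fun i => (σ i : ℕ))) := by
  have henc : ∀ i, enc i < a.length := fun i => (List.getElem?_eq_some_iff.1 (hρ i)).1
  induction t with
  | var i =>
    rcases i with i | i
    · rw [termList_free, ← (hX.rep_eq_iff (x := (ρ i : ℕ))).2]
      · exact (hM.rep_eq _ (ρ i).2).symm
      · simpa [ClauseSat] using hX _ (.inr (.inl (.inl ⟨_, _, _, _, hρ i, rfl⟩)))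
    · rw [termList_bound, ← (hX.rep_eq_iff (x := (σ i : ℕ))).2]
      · exact (hM.rep_eq _ (σ i).2).symm
      · have := hX _ (.inr (.inl (.inr (.inl
          ⟨a, List.ofFn fun i => (σ i : ℕ), i, (σ i : ℕ), by simp, rfl⟩))))
        simpa [ClauseSat] using this
  | @func m F ts ih =>
    rw [Term.realize_func, hM.funMap, hX.rep_eq_iff, termList_func]
    have := hX _ (.inr (.inl (.inr (.inr ⟨a, List.ofFn fun i => (σ i : ℕ), g.encFun m F,
      List.ofFn fun i => (termList g enc (ts i), (((ts i).realize (Sum.elim ρ σ) : M.carrier) : ℕ)),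
      by rw [List.length_ofFn]; exact ⟨F, rfl⟩, ?_, rfl⟩))))
    · simp only [ClauseSat, List.mem_ofFn, List.map_ofFn, forall_exists_index,
        Function.comp_def, forall_apply_eq_imp_iff, List.mem_cons, List.not_mem_nil, or_false,
        exists_eq_left] at this
      refine this fun i => ?_
      rw [ih]
      exact hX.eq_symm (hX.eq_rep _)
    · simp only [List.mem_ofFn, forall_exists_index, forall_apply_eq_imp_iff, List.length_ofFn]
      exact fun i => isTerm_termList henc _

theorem realize_iff (hX : SysModel g T k l X) (hM : IsTermModel g X M) {α : Type} {n : ℕ}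
    {enc : α → ℕ} {a : List ℕ} {ρ : α → M.carrier} (hρ : ∀ i, a[enc i]? = some (ρ i : ℕ))
    (ha : ∀ x ∈ a, x ∈ M.carrier) (σ : Fin n → M.carrier) (φ : L.BoundedFormula α n) :
    φ.Realize ρ σ ↔ X (iV (formList g enc φ) a (List.ofFn fun i => (σ i : ℕ))) := by
  have henc : ∀ i, enc i < a.length := fun i => (List.getElem?_eq_some_iff.1 (hρ i)).1
  induction φ with
  | @falsum n =>
    have := hX _ (.inr (.inr (.inl (.inl ⟨a, List.ofFn fun i => (σ i : ℕ), rfl⟩))))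
    simp only [ClauseSat, List.mem_cons, List.not_mem_nil, or_false, forall_eq, false_and,
      exists_false, List.length_ofFn] at this
    exact iff_of_false id this
  | @equal n s t =>
    have := hX.equal_iff (a := a) (xs := List.ofFn fun i => (σ i : ℕ))
      (s := termList g enc s) (t := termList g enc t)
      (by simpa using isTerm_termList henc s) (by simpa using isTerm_termList henc t)
    rw [List.length_ofFn] at this
    rw [formList_equal, this, ← hX.rep_eq_iff, ← hM.realize_term hX hρ σ,
      ← hM.realize_term hX hρ σ, Subtype.val_inj]
    rfl
  | @rel n m R ts =>
    have := hX.rel_iff (a := a) (xs := List.ofFn fun i => (σ i : ℕ)) (r := g.encRel m R)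
      (zs := List.ofFn fun i =>
        (termList g enc (ts i), (((ts i).realize (Sum.elim ρ σ) : M.carrier) : ℕ)))
      (by rw [List.length_ofFn]; exact ⟨R, rfl⟩)
      (by
        simp only [List.mem_ofFn, forall_exists_index, forall_apply_eq_imp_iff, List.length_ofFn]
        exact fun i => isTerm_termList henc _)
      (by
        simp only [List.mem_ofFn, forall_exists_index, forall_apply_eq_imp_iff]
        intro i
        rw [hM.realize_term hX hρ σ]
        exact hX.eq_symm (hX.eq_rep _))
    rw [List.map_ofFn, List.map_ofFn, List.length_ofFn] at this
    rw [formList_rel]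
    exact (hM.relMap R _).trans this.symm
  | @imp n φ ψ ih ih' =>
    rw [BoundedFormula.realize_imp, formList_imp, hX.imp_iff]
    · exact imp_congr (ih σ) (ih' σ)
    · simpa using isForm_formList henc φ
    · simpa using isForm_formList henc ψ
  | @all n φ ih =>
    have hφ : IsForm g a.length ((List.ofFn fun i => (σ i : ℕ)).length + 1) (formList g enc φ) := by
      simpa using isForm_formList henc φ
    have hsnoc : ∀ y : M.carrier, (List.ofFn fun i => ((Fin.snoc σ y : Fin (n + 1) → M.carrier) i : ℕ)) =
        (List.ofFn fun i => (σ i : ℕ)) ++ [(y : ℕ)] := by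
      intro y
      rw [List.ofFn_succ']
      simp [List.concat_eq_append]
    rw [BoundedFormula.realize_all, formList_all]
    simp only [ih, hsnoc]
    refine ⟨fun h => hX.all_intro hφ ?_, fun h y => hX.all_elim hφ _ h⟩
    exact h ⟨_, hM.wit _ _ _ ha (by simp [List.mem_ofFn])⟩

theorem realize_formula_iff (hX : SysModel g T k l X) (hM : IsTermModel g X M) {m : ℕ}
    (φ : L.Formula (Fin m)) (ρ : Fin m → M.carrier) :
    φ.Realize ρ ↔ X (iV (formList g Fin.val φ) (List.ofFn fun i => (ρ i : ℕ)) []) := by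
  have := hM.realize_iff hX (enc := Fin.val) (a := List.ofFn fun i => (ρ i : ℕ)) (ρ := ρ)
    (by simp) (by simp [List.mem_ofFn]) default φ
  rw [List.ofFn_zero] at this
  exact this

theorem models (hX : SysModel g T k l X) (hM : IsTermModel g X M) : M.Models T := by
  intro ψ hψ
  have := hM.realize_iff hX (enc := fun a : Empty => a.elim) (a := []) (ρ := default)
    (fun i => i.elim) (by simp) default ψ
  rw [List.ofFn_zero] at this
  exact this.2 (hX.theory hψ)

theorem elemSub (hX : SysModel g T k l X) {M' : CodedStructure L} (hM : IsTermModel g X M)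
    (hM' : IsTermModel g X M') (h : M.carrier ⊆ M'.carrier) : ElemSub M M' where
  subset := h
  elem _ φ a := (hM.realize_formula_iff hX φ a).trans 
    (hM'.realize_formula_iff hX φ fun i => ⟨(a i : ℕ), h (a i).2⟩).symm

theorem arithDecidable (hL : ArithLang g) (hX : SysModel g T k l X) (hXa : ArP ∅ X)
    (hM : IsTermModel g X M) (hMa : ArP ∅ (· ∈ M.carrier)) : ArithDecidable g M := by
  have h1 := arP_isForm hL ∅
  have key : ArP ∅ fun c : ℕ => ∃ (k : ℕ) (l' a : List ℕ),
      c = Nat.pair (Nat.pair k (Encodable.encode l')) (Encodable.encode a) ∧ a.length = k ∧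
        IsForm g k 0 l' ∧ (∀ x, x ∈ a → x ∈ M.carrier) ∧ X (iV l' a []) := by
    fun_prop
  refine ArP.nat_iff.1 (key.congr fun c => ?_)
  constructor
  · rintro ⟨m, φ, ρ, rfl, h⟩
    exact ⟨m, formList g Fin.val φ, List.ofFn fun i => (ρ i : ℕ), rfl, by simp, ⟨φ, rfl⟩,
      by simp [List.mem_ofFn], (hM.realize_formula_iff hX φ ρ).1 h⟩
  · rintro ⟨m, l', a, rfl, rfl, ⟨φ, rfl⟩, ha, h⟩
    refine ⟨a.length, φ, fun i => ⟨a[i], ha _ (List.getElem_mem _)⟩, ?_, ?_⟩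
    · rw [formulaCode_eq, tupleCode, listCode]
      congr 2
      exact (List.ofFn_get a).symm
    · refine (hM.realize_formula_iff hX φ _).2 ?_
      have : (List.ofFn fun i : Fin a.length => a[i]) = a := List.ofFn_get a
      simpa [this] using h

end IsTermModel

/-- The predicate `P` defines a submodel. -/
structure IsClosed (g : GoedelCoding L) (X : Idx → Prop) (P : ℕ → Prop) : Prop where
  congr : ∀ x y, X (iEq x y) → P x → P y
  func : ∀ f ys, IsFun g ys.length f → (∀ y ∈ ys, P y) → P (nFun f ys)
  wit : ∀ l a xs : List ℕ, (∀ y ∈ a, P y) → (∀ y ∈ xs, P y) → P (nWit l a xs)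

theorem SysModel.exists_termModel (hX : SysModel g T k l X) {P : ℕ → Prop}
    (hP : IsClosed g X P) :
    ∃ M : CodedStructure L, (∀ x, x ∈ M.carrier ↔ IsRep X x ∧ P x) ∧ IsTermModel g X M := by
  have hrep : ∀ x, P x → IsRep X (rep X x) ∧ P (rep X x) := fun x hx =>
    ⟨hX.isRep_rep x, hP.congr _ _ (hX.eq_rep x) hx⟩
  refine ⟨⟨{x | IsRep X x ∧ P x}, ?_, ⟨fun {m} F v =>
    ⟨rep X (nFun (g.encFun m F) (List.ofFn fun i => (v i : ℕ))), hrep _ (hP.func _ _ ?_ ?_)⟩,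
    fun {m} R v => X (iRel (g.encRel m R) (List.ofFn fun i => (v i : ℕ)))⟩⟩, fun x => Iff.rfl,
    fun x hx => hX.isRep_iff.1 hx.1, fun l a xs ha hxs =>
      hrep _ (hP.wit _ _ _ (fun y hy => (ha y hy).2) fun y hy => (hxs y hy).2),
    fun F v => rfl, fun R v => Iff.rfl⟩
  · refine Set.infinite_of_injective_forall_mem (f := fun m => nJunk (m + 1)) ?_
      fun m h => hX.not_isRep_junk m h.1
    intro m m' h
    simpa [nJunk, Nat.pair_eq_pair] using h
  · rw [List.length_ofFn]
    exact ⟨F, rfl⟩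
  · intro y hy
    obtain ⟨i, rfl⟩ := List.mem_ofFn.1 hy
    exact (v i).2.2

end TermModels

/-! ## Cuts in the lexicographic order on finite sets -/

section Cuts

variable {D : Set ℕ}

theorem isArithmetical_of_finite (h : D.Finite) : IsArithmetical D := by
  have : ArP ∅ fun n : ℕ => n ∈ h.toFinset.toList := by fun_prop
  exact ArP.nat_iff.1 (this.congr fun n => by
    rw [Finset.mem_toList, h.mem_toFinset]
    rfl)

theorem lexLt_of_subset (hD : D.Infinite) {G : List ℕ} (h : ∀ x ∈ G, x ∈ D) :
    LexLt (· ∈ G) (· ∈ D) := by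
  classical
  have hex : ∃ j, j ∈ D ∧ j ∉ G := by
    obtain ⟨j, hj, hj'⟩ := hD.exists_notMem_finset G.toFinset
    exact ⟨j, hj, by simpa using hj'⟩
  refine ⟨Nat.find hex, (Nat.find_spec hex).2, (Nat.find_spec hex).1, fun m hm => ⟨h m, fun hmD => ?_⟩⟩
  by_contra hmG
  exact Nat.find_min hex hm ⟨hmD, hmG⟩

theorem exists_initial (D : Set ℕ) (i : ℕ) : ∃ F : List ℕ, ∀ x, x ∈ F ↔ x ≤ i ∧ x ∈ D := by
  classical
  exact ⟨(List.range (i + 1)).filter (· ∈ D), fun x => by simp⟩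

theorem exists_lexLt_between (hD : D.Infinite) {F : List ℕ} (h : LexLt (· ∈ F) (· ∈ D)) :
    ∃ G : List ℕ, LexLt (· ∈ F) (· ∈ G) ∧ LexLt (· ∈ G) (· ∈ D) := by
  obtain ⟨i, h1, h2, h3⟩ := h
  obtain ⟨G, hG⟩ := exists_initial D i
  refine ⟨G, ⟨i, h1, (hG i).2 ⟨le_rfl, h2⟩, fun m hm => ?_⟩,
    lexLt_of_subset hD fun x hx => ((hG x).1 hx).2⟩
  exact (h3 m hm).trans ⟨fun h => (hG m).2 ⟨hm.le, h⟩, fun h => ((hG m).1 h).2⟩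

theorem not_lexLt_of_initial {i : ℕ} {F G : List ℕ} (hF : ∀ x, x ∈ F ↔ x ≤ i ∧ x ∈ D)
    (hG : ∀ x ∈ G, x ≤ i) (h : LexLt (· ∈ G) (· ∈ D)) : ¬ LexLt (· ∈ F) (· ∈ G) := by
  rintro ⟨j, h1, h2, h3⟩
  have hji := hG j h2
  refine LexLt.irrefl _ (h.trans (R := (· ∈ G)) ⟨j, fun hj => h1 ((hF j).2 ⟨hji, hj⟩), h2, fun m hm => ?_⟩)
  refine Iff.trans ?_ (h3 m hm)
  exact ⟨fun h => (hF m).2 ⟨hm.le.trans hji, h⟩, fun h => ((hF m).1 h).2⟩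

/-- An infinite set is arithmetical in its lexicographic cut. -/
theorem arReducible_of_cut {Z : Set ℕ} (hD : D.Infinite)
    (h : ArP Z fun F : List ℕ => LexLt (· ∈ F) (· ∈ D)) : ArReducible D Z := by
  have key : ∀ C : List ℕ → Prop, ArP Z C → ArP Z fun i : ℕ => ∃ F : List ℕ,
      (∀ x : ℕ, x ∈ F → ¬ i < x) ∧ C F ∧ i ∈ F ∧
        ∀ G : List ℕ, (∀ x : ℕ, x ∈ G → ¬ i < x) → C G → ¬ LexLt (· ∈ F) (· ∈ G) := by
    intro C hC
    unfold LexLt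
    fun_prop
  refine ArP.nat_iff.1 ((key _ h).congr fun i => ?_)
  simp only [not_lt]
  obtain ⟨F₀, hF₀⟩ := exists_initial D i
  have hlt : LexLt (· ∈ F₀) (· ∈ D) := lexLt_of_subset hD fun x hx => ((hF₀ x).1 hx).2
  constructor
  · exact fun hi => ⟨F₀, fun x hx => ((hF₀ x).1 hx).1, hlt, (hF₀ i).2 ⟨le_rfl, hi⟩,
      fun G hG hGD => not_lexLt_of_initial hF₀ hG hGD⟩
  · rintro ⟨F, hF, hFD, hi, hmax⟩
    have h1 : ¬ LexLt (· ∈ F) (· ∈ F₀) := hmax F₀ (fun x hx => ((hF₀ x).1 hx).1) hlt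
    rcases LexLt.trichotomy (· ∈ F) (· ∈ F₀) with h2 | h2 | h2
    · exact absurd h2 h1
    · exact absurd h2 (not_lexLt_of_initial hF₀ hF hFD)
    · exact ((hF₀ i).1 ((h2 i).1 hi)).2

end Cuts

section CutModels

variable {L : FirstOrder.Language} {g : GoedelCoding L} {T : L.Theory} {k : ℕ} {l : List ℕ}
  {X : Idx → Prop} {D : Set ℕ}

/-- `x` lies in the union of the submodels `(b, F)` with `F` below `D`. -/
def CutMem (X : Idx → Prop) (D : Set ℕ) (b : Bool) (x : ℕ) : Prop :=
  ∃ F : List ℕ, LexLt (· ∈ F) (· ∈ D) ∧ X (iP (some (b, F)) x)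

theorem SysModel.cutMem_of_none (hX : SysModel g T k l X) (hD : D.Infinite) (b : Bool) {x : ℕ}
    (h : X (iP none x)) : CutMem X D b x :=
  ⟨[], lexLt_of_subset hD (by simp), hX.mem_none _ h⟩

theorem SysModel.exists_common (hX : SysModel g T k l X) (hD : D.Infinite) {b : Bool}
    (ys : List ℕ) (h : ∀ y ∈ ys, CutMem X D b y) :
    ∃ F : List ℕ, LexLt (· ∈ F) (· ∈ D) ∧ ∀ y ∈ ys, X (iP (some (b, F)) y) := by
  induction ys with
  | nil => exact ⟨[], lexLt_of_subset hD (by simp), by simp⟩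
  | cons y ys ih =>
    obtain ⟨F, hF, hF'⟩ := ih fun z hz => h z (List.mem_cons_of_mem _ hz)
    obtain ⟨G, hG, hG'⟩ := h y List.mem_cons_self
    by_cases hGF : LexLt (· ∈ G) (· ∈ F)
    · have hFG : ¬ LexLt (· ∈ F) (· ∈ G) := fun h => LexLt.irrefl _ (h.trans hGF)
      exact ⟨F, hF, by simpa using ⟨hX.mem_mono hFG hG', hF'⟩⟩
    · exact ⟨G, hG, by simpa using ⟨hG', fun z hz => hX.mem_mono hGF (hF' z hz)⟩⟩

theorem SysModel.isClosed_mem (hX : SysModel g T k l X) (j : Option (Bool × List ℕ)) :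
    IsClosed g X fun x => X (iP j x) where
  congr _ _ := hX.mem_congr
  func _ _ := hX.mem_fun
  wit _ _ _ := hX.mem_wit

theorem SysModel.isClosed_cutMem (hX : SysModel g T k l X) (hD : D.Infinite) (b : Bool) :
    IsClosed g X (CutMem X D b) where
  congr x y hxy := fun ⟨F, hF, hx⟩ => ⟨F, hF, hX.mem_congr hxy hx⟩
  func f ys hf hys := by
    obtain ⟨F, hF, h⟩ := hX.exists_common hD ys hys
    exact ⟨F, hF, hX.mem_fun hf h⟩
  wit l' a xs ha hxs := by
    obtain ⟨F, hF, h⟩ := hX.exists_common (b := b) hD (a ++ xs) (by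
      simp only [List.mem_append]
      exact fun y hy => hy.elim (ha y) (hxs y))
    exact ⟨F, hF, hX.mem_wit (fun y hy => h y (List.mem_append_left _ hy))
      fun y hy => h y (List.mem_append_right _ hy)⟩

theorem SysModel.cutMem_nGen_iff (hX : SysModel g T k l X) (hD : D.Infinite) {b : Bool}
    {F : List ℕ} : CutMem X D b (nGen b F) ↔ LexLt (· ∈ F) (· ∈ D) := by
  constructor
  · rintro ⟨G, hG, h⟩
    by_contra hF
    have hGF : LexLt (· ∈ G) (· ∈ F) := LexLt.of_not_lt_of_lt hF hG
    have hFG : ¬ LexLt (· ∈ F) (· ∈ G) := fun h => LexLt.irrefl _ (h.trans hGF)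
    exact hX.notMem_gen b F (hX.mem_mono hFG h)
  · intro hF
    obtain ⟨G, hFG, hG⟩ := exists_lexLt_between hD hF
    exact ⟨G, hG, hX.mem_gen b hFG⟩

theorem SysModel.lexLt_iff (hX : SysModel g T k l X) (hD : D.Infinite) {b : Bool} {F : List ℕ} :
    LexLt (· ∈ F) (· ∈ D) ↔ ∃ y, X (iEq (nGen b F) y) ∧ IsRep X y ∧ CutMem X D b y := by
  rw [← hX.cutMem_nGen_iff hD (b := b)]
  constructor
  · exact fun h => ⟨rep X (nGen b F), hX.eq_rep _, hX.isRep_rep _,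
      (hX.isClosed_cutMem hD b).congr _ _ (hX.eq_rep _) h⟩
  · exact fun ⟨y, h, _, hy⟩ => (hX.isClosed_cutMem hD b).congr _ _ (hX.eq_symm h) hy

theorem arP_isRep {Z : Set ℕ} (hXa : ArP Z X) : ArP Z (IsRep X) := by
  unfold IsRep
  fun_prop

theorem arP_cutMem (hXa : ArP D X) (b : Bool) : ArP D (CutMem X D b) := by
  have := ArP.oracle D
  unfold CutMem LexLt
  fun_prop

variable {M N : CodedStructure L}

theorem SysModel.arEquiv_carrier (hX : SysModel g T k l X) (hXa : ArP ∅ X) (hD : D.Infinite)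
    {b : Bool} (hM : ∀ x, x ∈ M.carrier ↔ IsRep X x ∧ CutMem X D b x) :
    ArEquiv M.carrier D := by
  constructor
  · have h1 := arP_isRep (hXa.mono D)
    have h2 := arP_cutMem (hXa.mono D) b
    have : ArP D fun x => IsRep X x ∧ CutMem X D b x := by fun_prop
    exact ArP.nat_iff.1 (this.congr hM)
  · have h1 := ArP.oracle M.carrier
    have h2 := hXa.mono M.carrier
    have : ArP M.carrier fun F : List ℕ => ∃ y : ℕ, X (iEq (nGen b F) y) ∧ y ∈ M.carrier := by
      fun_prop
    exact arReducible_of_cut hD (this.congr fun F => by simp only [hX.lexLt_iff hD (b := b), hM])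

theorem ofFn_cons_params {p : Fin k → M.carrier} (hp : ∀ i, (p i : ℕ) = rep X (nPar i))
    (x : M.carrier) : (List.ofFn fun i => ((Fin.cons x p : Fin (k + 1) → M.carrier) i : ℕ)) =
      (x : ℕ) :: SysModel.params X k := by
  rw [List.ofFn_succ]
  refine congr_arg _ (List.ext_getElem (by simp [SysModel.params]) fun i h1 h2 => ?_)
  simp [SysModel.params, hp]

/-- The set coded by the instances of `l` in `M`. -/
theorem IsTermModel.tupleSetCode_eq {φ : L.Formula (Fin 1 ⊕ Fin k)}
    (hX : SysModel g T k (formList g Fin.val (numberVars φ)) X) (hM : IsTermModel g X M)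
    {p : Fin k → M.carrier} (hp : ∀ i, (p i : ℕ) = rep X (nPar i)) :
    tupleSetCode {v : Fin 1 → M.carrier | φ.Realize (Sum.elim v p)} =
      {c | ∃ x : ℕ, (x ∈ M.carrier ∧ X (iV (formList g Fin.val (numberVars φ))
        (x :: SysModel.params X k) [] )) ∧ c = Encodable.encode [x]} := by
  have key : ∀ v : Fin 1 → M.carrier, φ.Realize (Sum.elim v p) ↔
      X (iV (formList g Fin.val (numberVars φ)) ((v 0 : ℕ) :: SysModel.params X k) [] ) := by
    intro v
    rw [← ofFn_cons_params hp, ← hM.realize_formula_iff hX, realize_numberVars,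
      show v = fun _ => v 0 from funext fun i => by rw [Subsingleton.elim i 0] ]
  ext c
  constructor
  · rintro ⟨v, hv, rfl⟩
    exact ⟨v 0, ⟨(v 0).2, (key v).1 hv⟩, by simp [tupleCode, listCode]⟩
  · rintro ⟨x, ⟨hx, h⟩, rfl⟩
    exact ⟨fun _ => ⟨x, hx⟩, (key _).2 h, by simp [tupleCode, listCode]⟩

/-- A coded isomorphism as an isomorphism of structures. -/
def CodedIso.toEquiv (f : CodedIso M N) : M.carrier ≃[L] N.carrier where
  toFun := f.toFun
  invFun := f.invFun
  left_inv := f.left_inv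
  right_inv := f.right_inv
  map_fun' := f.map_fun
  map_rel' r v := (f.map_rel r v).symm

theorem CodedIso.image_invFun (f : CodedIso M N) {φ : L.Formula (Fin 1 ⊕ Fin k)}
    {p : Fin k → M.carrier} {q : Fin k → N.carrier} (h : ∀ i, f.toFun (p i) = q i) :
    (fun v => f.invFun ∘ v) '' {v : Fin 1 → N.carrier | φ.Realize (Sum.elim v q)} =
      {v : Fin 1 → M.carrier | φ.Realize (Sum.elim v p)} := by
  have key : ∀ v : Fin 1 → M.carrier,
      φ.Realize (Sum.elim (f.toFun ∘ v) q) ↔ φ.Realize (Sum.elim v p) := by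
    intro v
    rw [← StrongHomClass.realize_formula f.toEquiv φ]
    have : ⇑f.toEquiv ∘ Sum.elim v p = Sum.elim (f.toFun ∘ v) q := by
      funext i
      rcases i with i | i
      · rfl
      · exact h i
    rw [this]
  ext v
  constructor
  · rintro ⟨w, hw, rfl⟩
    refine (key _).1 ?_
    rwa [← Function.comp_assoc, f.right_inv.comp_eq_id]
  · intro hv
    refine ⟨f.toFun ∘ v, (key v).2 hv, ?_⟩
    simp only [← Function.comp_assoc, f.left_inv.comp_eq_id, Function.id_comp]

end CutModels

/-- **Categoricity at one nonzero arithmetic degree implies no Vaughtian pairs.** -/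
theorem categoricity_implies_no_vaughtian_pair
    (L : FirstOrder.Language) (g : GoedelCoding L) (hL : ArithLang g)
    (T : L.Theory) (hT : ArithTheory g T) (hcomp : T.IsComplete)
    (hnf : NoFiniteModels L T)
    (D : Set ℕ) (hD : ¬ IsArithmetical D) (hcat : DCategorical g T D) :
    ¬ HasVaughtianPair T := by
  intro hV
  have hDi : D.Infinite := fun h => hD (isArithmetical_of_finite h)
  obtain ⟨k, φ, N, SN, hN, hC⟩ := hV.exists_formulaChain g
  obtain ⟨X, hXa, hX⟩ := exists_arithmetical_sysModel hL hT hN hC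
  replace hX : SysModel g T k (formList g Fin.val (numberVars φ)) X := hX
  obtain ⟨M₀, hM₀, hM₀'⟩ := hX.exists_termModel (hX.isClosed_mem none)
  obtain ⟨M₁, hM₁, hM₁'⟩ := hX.exists_termModel (hX.isClosed_cutMem hDi false)
  obtain ⟨M₂, hM₂, hM₂'⟩ := hX.exists_termModel (hX.isClosed_cutMem hDi true)
  obtain ⟨W, hW, hW'⟩ := hX.exists_termModel (P := fun _ => True) (by constructor <;> simp)
  have hrepa := arP_isRep hXa
  have ha₀ : ArP ∅ (· ∈ M₀.carrier) := by
    have : ArP ∅ fun x => IsRep X x ∧ X (iP none x) := by fun_prop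
    exact this.congr hM₀
  have haW : ArP ∅ (· ∈ W.carrier) := hrepa.congr fun x => by simp [hW]
  have hle : ∀ {M : CodedStructure L} {P : ℕ → Prop}, (∀ x, x ∈ M.carrier ↔ IsRep X x ∧ P x) →
      IsTermModel g X M → ArithExtendible g T M := fun {M P} h h' =>
    ⟨W, hW'.arithDecidable hL hX hXa haW, hW'.models hX,
      h'.elemSub hX hW' fun x hx => (hW x).2 ⟨((h x).1 hx).1, trivial⟩⟩
  have hsub₁ : M₀.carrier ⊆ M₁.carrier := fun x hx =>
    (hM₁ x).2 ⟨((hM₀ x).1 hx).1, hX.cutMem_of_none hDi _ ((hM₀ x).1 hx).2⟩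
  have hsub₂ : M₀.carrier ⊆ M₂.carrier := fun x hx =>
    (hM₂ x).2 ⟨((hM₀ x).1 hx).1, hX.cutMem_of_none hDi _ ((hM₀ x).1 hx).2⟩
  obtain ⟨f, ⟨-, -, -, hf⟩, hf₀⟩ := hcat M₀ M₁ M₂ (hM₀'.arithDecidable hL hX hXa ha₀)
    (hM₀'.models hX) (hM₁'.models hX) (hle hM₁ hM₁') (hM₂'.models hX) (hle hM₂ hM₂')
    (hM₀'.elemSub hX hM₁' hsub₁) (hM₀'.elemSub hX hM₂' hsub₂)
    (hX.arEquiv_carrier hXa hDi hM₁) (hX.arEquiv_carrier hXa hDi hM₂)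
  have hpar : ∀ i : Fin k, rep X (nPar i) ∈ M₀.carrier := fun i => (hM₀ _).2
    ⟨hX.isRep_rep _, hX.mem_congr (hX.eq_rep _) (hX.mem_par none i)⟩
  let p₁ : Fin k → M₁.carrier := fun i => ⟨rep X (nPar i), hsub₁ (hpar i)⟩
  let p₂ : Fin k → M₂.carrier := fun i => ⟨rep X (nPar i), hsub₂ (hpar i)⟩
  have himg := f.image_invFun (φ := φ) (p := p₁) (q := p₂)
    fun i => Subtype.ext (hf₀ _ (hpar i) (hsub₁ (hpar i)))
  have hdef : DefinableIn M₂ {v : Fin 1 → M₂.carrier | φ.Realize (Sum.elim v p₂)} :=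
    ⟨k, φ, p₂, fun _ => trivial, rfl⟩
  have hc₁ := hM₁'.tupleSetCode_eq (p := p₁) hX fun _ => rfl
  have hc₂ := hM₂'.tupleSetCode_eq (p := p₂) hX fun _ => rfl
  have hY : ArEquiv (tupleSetCode {v : Fin 1 → M₂.carrier | φ.Realize (Sum.elim v p₂)}) D := by
    constructor
    · rw [hc₂]
      have h1 := hXa.mono D
      have h2 : ArP D (· ∈ M₂.carrier) :=
        ArP.of_reducible (hX.arEquiv_carrier hXa hDi hM₂).1
      have : ArP D fun c : ℕ => ∃ x : ℕ, (x ∈ M₂.carrier ∧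
          X (iV (formList g Fin.val (numberVars φ)) (x :: SysModel.params X k) [])) ∧
          c = Encodable.encode [x] := by
        fun_prop
      exact ArP.nat_iff.1 this
    · have h1 := hXa.mono (tupleSetCode {v : Fin 1 → M₂.carrier | φ.Realize (Sum.elim v p₂)})
      have h2 := ArP.oracle (tupleSetCode {v : Fin 1 → M₂.carrier | φ.Realize (Sum.elim v p₂)})
      have : ArP (tupleSetCode {v : Fin 1 → M₂.carrier | φ.Realize (Sum.elim v p₂)})
          fun F : List ℕ => ∃ y : ℕ, X (iEq (nGen true F) y) ∧ Encodable.encode [y] ∈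
            tupleSetCode {v : Fin 1 → M₂.carrier | φ.Realize (Sum.elim v p₂)} := by
        fun_prop
      refine arReducible_of_cut hDi (this.congr fun F => ?_)
      rw [hX.lexLt_iff hDi (b := true), hc₂]
      refine exists_congr fun y => and_congr_right fun hy => ?_
      rw [← hM₂]
      constructor
      · exact fun h => ⟨y, ⟨h, hX.growth (hX.eq_symm hy)⟩, rfl⟩
      · rintro ⟨x, ⟨hx, -⟩, hxy⟩
        obtain rfl : y = x := by simpa using Encodable.encode_injective hxy
        exact hx
  have himg' := (hf 1 _ hdef hY).2
  rw [himg, hc₁] at himg'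
  refine hD (himg'.trans (ArP.nat_iff.1 ?_))
  have key : ArP ∅ fun c : ℕ => ∃ x : ℕ, (x ∈ M₀.carrier ∧
      X (iV (formList g Fin.val (numberVars φ)) (x :: SysModel.params X k) [] )) ∧
      c = Encodable.encode [x] := by
    fun_prop
  refine key.congr fun c => exists_congr fun x => and_congr_left fun _ => and_congr_left fun hx => ?_
  rw [hM₀, hM₁]
  refine and_congr_right fun _ => ⟨fun ⟨F, _, hF⟩ => hX.mem_of_growth hx hF, hX.cutMem_of_none hDi _⟩

end ArMorley
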